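/- arXiv:math/0207089 — 2 statements merged into one kernel-verified Lean document; each statement's English description precedes it below -/
import Mathlib

section
/- Let n ≥ 1, m ≥ 0, l ≥ 1. Let C_1^0,…,C_m^0, U^0, V^0, W^0 : N_0 → M_n(ℂ) be holomorphic maps on an open neighborhood N_0 of 0 in ℂ^m satisfying, for all i,j ∈ {1,…,m}: [C_i^0,C_j^0]=0, ∂C_i^0/∂t_j = ∂C_j^0/∂t_i, [C_i^0,U^0]=0, ∂U^0/∂t_i = [V^0,C_i^0] − C_i^0, ∂W^0/∂t_i = [W^0,C_i^0], and ∂V^0/∂t_i = −[W^0,C_i^0]. Assume the generation condition holds for the matrices C_1^0(0),…,C_m^0(0), U^0(0) with ζ equal to the first standard basis vector e_1 of ℂ^n. Let f_1,…,f_n be holomorphic functions on an open neighborhood of 0 in ℂ^m × ℂ^l with f_i(t,0)=0. Then there exist an open neighborhood N of 0 in ℂ^m × ℂ^l and holomorphic maps C_1,…,C_m, F_1,…,F_l, U, V, W : N → M_n(ℂ) such that: (i) C_i(t,0)=C_i^0(t), U(t,0)=U^0(t), V(t,0)=V^0(t), W(t,0)=W^0(t); (ii) for each α the first column of F_α is ((∂f_1/∂y_α),…,(∂f_n/∂y_α))^T;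 (iii) on N, for all i,j ∈ {1,…,m} and α,β ∈ {1,…,l}: [C_i,C_j]=0, [C_i,F_α]=0, [F_α,F_β]=0, ∂C_i/∂t_j=∂C_j/∂t_i, ∂C_i/∂y_α=∂F_α/∂t_i, ∂F_α/∂y_β=∂F_β/∂y_α, [C_i,U]=0, [F_α,U]=0, ∂U/∂t_i=[V,C_i]−C_i, ∂U/∂y_α=[V,F_α]−F_α, ∂W/∂t_i=[W,C_i], ∂W/∂y_α=[W,F_α], ∂V/∂t_i=−[W,C_i], ∂V/∂y_α=−[W,F_α]. -/
/-!
Statement 0 (Lemma 2.9, existence part): existence of an unfolding of the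
flat-connection system in connection-matrix form.
-/

noncomputable section

/-- `n × n` complex matrices. -/
abbrev Mat (n : ℕ) := Matrix (Fin n) (Fin n) ℂ

/-- The commutator `[A,B] = A*B - B*A`. -/
def matComm {n : ℕ} (A B : Mat n) : Mat n := A * B - B * A

/-- Entrywise holomorphy of a matrix-valued map on a set. -/
def MDiffOn {E : Type*} [NormedAddCommGroup E] [NormedSpace ℂ E] {n : ℕ}
    (f : E → Mat n) (s : Set E) : Prop :=
  ∀ k j, DifferentiableOn ℂ (fun q => f q k j) s

/-- Entrywise partial derivative of a matrix-valued map at `p` in direction `v`. -/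
def mpderiv {E : Type*} [NormedAddCommGroup E] [NormedSpace ℂ E] {n : ℕ}
    (f : E → Mat n) (p v : E) : Mat n :=
  Matrix.of fun k j => fderiv ℂ (fun q => f q k j) p v

/-- Generation condition: `ζ` together with all vectors obtained from `ζ` by finitely
many successive applications of the matrices `B i` spans `ℂ^n`. -/
def GenCond {n r : ℕ} (B : Fin r → Mat n) (ζ : Fin n → ℂ) : Prop :=
  Submodule.span ℂ
    {v : Fin n → ℂ | ∃ L : List (Fin r), v = Matrix.mulVec (L.map B).prod ζ} = ⊤

/-- Points of `ℂ^m × ℂ^l` with coordinates `(t, y)`. -/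
abbrev Pt (m l : ℕ) := (Fin m → ℂ) × (Fin l → ℂ)

/-- The full flatness system (2.16)–(2.29) at a point `p`. -/
def FullSystemAt {n m l : ℕ}
    (C : Fin m → Pt m l → Mat n) (F : Fin l → Pt m l → Mat n)
    (U V W : Pt m l → Mat n) (p : Pt m l) : Prop :=
  (∀ i j, matComm (C i p) (C j p) = 0) ∧
  (∀ i α, matComm (C i p) (F α p) = 0) ∧
  (∀ α β, matComm (F α p) (F β p) = 0) ∧
  (∀ i j, mpderiv (C i) p (Pi.single j 1, 0) = mpderiv (C j) p (Pi.single i 1, 0)) ∧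
  (∀ i α, mpderiv (C i) p (0, Pi.single α 1) = mpderiv (F α) p (Pi.single i 1, 0)) ∧
  (∀ α β, mpderiv (F α) p (0, Pi.single β 1) = mpderiv (F β) p (0, Pi.single α 1)) ∧
  (∀ i, matComm (C i p) (U p) = 0) ∧
  (∀ α, matComm (F α p) (U p) = 0) ∧
  (∀ i, mpderiv U p (Pi.single i 1, 0) = matComm (V p) (C i p) - C i p) ∧
  (∀ α, mpderiv U p (0, Pi.single α 1) = matComm (V p) (F α p) - F α p) ∧
  (∀ i, mpderiv W p (Pi.single i 1, 0) = matComm (W p) (C i p)) ∧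
  (∀ α, mpderiv W p (0, Pi.single α 1) = matComm (W p) (F α p)) ∧
  (∀ i, mpderiv V p (Pi.single i 1, 0) = - matComm (W p) (C i p)) ∧
  (∀ α, mpderiv V p (0, Pi.single α 1) = - matComm (W p) (F α p))

set_option linter.unusedSectionVars false

section

open Filter Topology MvPowerSeries

/-- A positive submultiplicative weight on exponents. -/
structure SeriesWeight (σ : Type*) where
  /-- The weight of an exponent. -/
  wt : (σ →₀ ℕ) → ℝ
  pos : ∀ α, 0 < wt α
  add_le : ∀ α β, wt (α + β) ≤ wt α * wt β

/-- The power series with prescribed coefficients. -/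
def seriesOf {σ : Type*} (c : (σ →₀ ℕ) → ℂ) : MvPowerSeries σ ℂ := c

@[simp]
theorem coeff_seriesOf {σ : Type*} (c : (σ →₀ ℕ) → ℂ) (α : σ →₀ ℕ) :
    coeff α (seriesOf c) = c α := rfl

namespace SeriesWeight

variable {σ : Type*} [DecidableEq σ] (w : SeriesWeight σ)

/-- Weighted absolute summability of the coefficients of a power series. -/
def IsSummable (K : MvPowerSeries σ ℂ) : Prop :=
  Summable fun α => ‖coeff α K‖ * w.wt α

variable {w}

theorem isSummable_of_finite {K : MvPowerSeries σ ℂ} {s : Finset (σ →₀ ℕ)}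
    (h : ∀ α ∉ s, coeff α K = 0) : w.IsSummable K :=
  summable_of_ne_finset_zero (s := s) fun α hα => by simp [h α hα]

theorem IsSummable.add {K L : MvPowerSeries σ ℂ} (hK : w.IsSummable K) (hL : w.IsSummable L) :
    w.IsSummable (K + L) := by
  refine Summable.of_nonneg_of_le (fun α => mul_nonneg (norm_nonneg _) (w.pos α).le)
    (fun α => ?_) (Summable.add hK hL)
  rw [map_add, ← add_mul]
  exact mul_le_mul_of_nonneg_right (norm_add_le _ _) (w.pos α).le

theorem wnorm_mul_coeff_le (K L : MvPowerSeries σ ℂ) (α : σ →₀ ℕ) :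
    ‖coeff α (K * L)‖ * w.wt α ≤ ∑ p ∈ Finset.HasAntidiagonal.antidiagonal α,
      (‖coeff p.1 K‖ * w.wt p.1) * (‖coeff p.2 L‖ * w.wt p.2) := by
  rw [coeff_mul]
  refine (mul_le_mul_of_nonneg_right (norm_sum_le _ _) (w.pos α).le).trans ?_
  rw [Finset.sum_mul]
  refine Finset.sum_le_sum fun p hp => ?_
  rw [← Finset.HasAntidiagonal.mem_antidiagonal.mp hp, norm_mul]
  calc ‖coeff p.1 K‖ * ‖coeff p.2 L‖ * w.wt (p.1 + p.2)
      ≤ ‖coeff p.1 K‖ * ‖coeff p.2 L‖ * (w.wt p.1 * w.wt p.2) :=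
        mul_le_mul_of_nonneg_left (w.add_le _ _) (by positivity)
    _ = _ := by ring

theorem summable_prod_aux {K L : MvPowerSeries σ ℂ} (hK : w.IsSummable K) (hL : w.IsSummable L) :
    Summable fun p : (σ →₀ ℕ) × (σ →₀ ℕ) =>
      (‖coeff p.1 K‖ * w.wt p.1) * (‖coeff p.2 L‖ * w.wt p.2) :=
  Summable.mul_of_nonneg (f := fun α => ‖coeff α K‖ * w.wt α)
    (g := fun α => ‖coeff α L‖ * w.wt α) hK hL
    (fun α => mul_nonneg (norm_nonneg _) (w.pos α).le)
    (fun α => mul_nonneg (norm_nonneg _) (w.pos α).le)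

theorem IsSummable.mul {K L : MvPowerSeries σ ℂ} (hK : w.IsSummable K) (hL : w.IsSummable L) :
    w.IsSummable (K * L) := by
  refine Summable.of_nonneg_of_le (fun α => mul_nonneg (norm_nonneg _) (w.pos α).le)
    (wnorm_mul_coeff_le K L)
    (summable_sum_mul_antidiagonal_of_summable_mul
      (f := fun α => ‖coeff α K‖ * w.wt α) (g := fun α => ‖coeff α L‖ * w.wt α)
      (summable_prod_aux hK hL))

variable (w)

/-- The algebra of power series with weighted absolutely summable coefficients. -/
def algebra : Subalgebra ℂ (MvPowerSeries σ ℂ) where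
  carrier := {K | w.IsSummable K}
  mul_mem' := IsSummable.mul
  add_mem' := IsSummable.add
  algebraMap_mem' c := by
    refine isSummable_of_finite (s := {0}) fun α hα => ?_
    rw [MvPowerSeries.algebraMap_apply, coeff_C]
    simp_all

instance : Norm w.algebra := ⟨fun K => ∑' α, ‖coeff α K.1‖ * w.wt α⟩

theorem norm_def (K : w.algebra) : ‖K‖ = ∑' α, ‖coeff α K.1‖ * w.wt α := rfl

theorem summable_norm (K : w.algebra) : Summable fun α => ‖coeff α K.1‖ * w.wt α := K.2

theorem norm_coeff_mul_le (K : w.algebra) (α : σ →₀ ℕ) : ‖coeff α K.1‖ * w.wt α ≤ ‖K‖ :=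
  (w.summable_norm K).le_tsum α fun β _ => mul_nonneg (norm_nonneg _) (w.pos β).le

instance : NormedAddCommGroup w.algebra :=
  AddGroupNorm.toNormedAddCommGroup
    { toFun := fun K => ‖K‖
      map_zero' := by simp [norm_def]
      neg' := fun K => by simp [norm_def]
      add_le' := fun K L => by
        rw [norm_def, norm_def, norm_def, ← (w.summable_norm K).tsum_add (w.summable_norm L)]
        refine (w.summable_norm (K + L)).tsum_le_tsum (fun α => ?_)
          ((w.summable_norm K).add (w.summable_norm L))
        rw [← add_mul]
        refine mul_le_mul_of_nonneg_right ?_ (w.pos α).le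
        simpa using norm_add_le (coeff α K.1) (coeff α L.1)
      eq_zero_of_map_eq_zero' := fun K hK => by
        ext α
        have h := w.norm_coeff_mul_le K α
        have h' : ‖coeff α K.1‖ * w.wt α ≤ 0 := h.trans hK.le
        have := nonpos_of_mul_nonpos_left h' (w.pos α)
        simpa using this }

instance : NormedCommRing w.algebra :=
  { (inferInstance : NormedAddCommGroup w.algebra), (inferInstance : CommRing w.algebra) with
    norm_mul_le := fun K L => by
      have hs := summable_prod_aux K.2 L.2
      have h := Summable.tsum_mul_tsum_eq_tsum_sum_antidiagonal
        (f := fun α => ‖coeff α K.1‖ * w.wt α) (g := fun α => ‖coeff α L.1‖ * w.wt α)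
        (w.summable_norm K) (w.summable_norm L) hs
      rw [norm_def, norm_def, norm_def, h]
      refine (w.summable_norm (K * L)).tsum_le_tsum (wnorm_mul_coeff_le K.1 L.1)
        (summable_sum_mul_antidiagonal_of_summable_mul
          (f := fun α => ‖coeff α K.1‖ * w.wt α) (g := fun α => ‖coeff α L.1‖ * w.wt α) hs) }

instance : NormedAlgebra ℂ w.algebra :=
  { (inferInstance : Algebra ℂ w.algebra) with
    norm_smul_le := fun c K => by
      rw [norm_def, norm_def, ← tsum_mul_left]
      refine le_of_eq (tsum_congr fun α => ?_)
      simp [mul_assoc] }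

/-- The comparison map with the unweighted `ℓ¹` space. -/
def toLp (K : w.algebra) : lp (fun _ : σ →₀ ℕ => ℂ) 1 :=
  ⟨fun α => coeff α K.1 * w.wt α, by
    refine memℓp_gen ?_
    simpa [abs_of_pos (w.pos _)] using w.summable_norm K⟩

theorem isometry_toLp : Isometry w.toLp := by
  refine Isometry.of_dist_eq fun K L => ?_
  rw [dist_eq_norm, dist_eq_norm, lp.norm_eq_tsum_rpow (by simp), norm_def]
  have h : ∀ α, ‖w.toLp K α - w.toLp L α‖ = ‖coeff α (K - L).1‖ * w.wt α := fun α => by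
    have : w.toLp K α - w.toLp L α = coeff α (K - L).1 * (w.wt α : ℂ) := by
      simp [toLp, sub_mul]
    rw [this, norm_mul, Complex.norm_real, Real.norm_eq_abs, abs_of_pos (w.pos α)]
  simp only [ENNReal.toReal_one, Real.rpow_one, div_one, lp.coeFn_sub, Pi.sub_apply, h]

theorem toLp_surjective : Function.Surjective w.toLp := by
  intro a
  have hw : ∀ α, (w.wt α : ℂ) ≠ 0 := fun α => by exact_mod_cast (w.pos α).ne'
  refine ⟨⟨seriesOf fun α => a α * (w.wt α : ℂ)⁻¹, ?_⟩, ?_⟩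
  · have h := (lp.memℓp a).summable (by simp)
    refine (by simpa using h : Summable fun α => ‖a α‖).congr fun α => ?_
    have := (w.pos α).ne'
    rw [coeff_seriesOf, norm_mul, norm_inv, Complex.norm_real, Real.norm_eq_abs,
      abs_of_pos (w.pos α), mul_assoc, inv_mul_cancel₀ this, mul_one]
  · ext α
    simp [toLp, hw α]

instance : CompleteSpace w.algebra :=
  (w.isometry_toLp.isUniformInducing.completeSpace_congr w.toLp_surjective).2 inferInstance

end SeriesWeight

end

section

open Filter Topology MvPowerSeries

variable {σ : Type*} [DecidableEq σ]

/-- The formal antiderivative with respect to the variable `s`, vanishing at `s = 0`. -/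
def antideriv (s : σ) : MvPowerSeries σ ℂ →ₗ[ℂ] MvPowerSeries σ ℂ where
  toFun K := seriesOf fun α => if α s = 0 then 0 else coeff (α - Finsupp.single s 1) K * (α s : ℂ)⁻¹
  map_add' K L := by
    ext α
    by_cases h : α s = 0 <;> simp [h, add_mul]
  map_smul' c K := by
    ext α
    by_cases h : α s = 0 <;> simp [h, mul_assoc]

theorem coeff_antideriv_of_eq_zero {s : σ} {α : σ →₀ ℕ} (h : α s = 0) (K : MvPowerSeries σ ℂ) :
    coeff α (antideriv s K) = 0 := by
  simp [antideriv, h]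

theorem coeff_antideriv_add (s : σ) (γ : σ →₀ ℕ) (K : MvPowerSeries σ ℂ) :
    coeff (γ + Finsupp.single s 1) (antideriv s K) = coeff γ K * ((γ s : ℂ) + 1)⁻¹ := by
  simp [antideriv]

theorem exists_eq_add_single {s : σ} {α : σ →₀ ℕ} (h : α s ≠ 0) :
    ∃ γ, α = γ + Finsupp.single s 1 := by
  refine ⟨α - Finsupp.single s 1, ?_⟩
  rw [tsub_add_cancel_of_le]
  exact Finsupp.single_le_iff.2 (Nat.one_le_iff_ne_zero.2 h)

@[simp]
theorem pderiv_antideriv (s : σ) (K : MvPowerSeries σ ℂ) :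
    pderiv ℂ s (antideriv s K) = K := by
  ext γ
  have : (γ s : ℂ) + 1 ≠ 0 := by exact_mod_cast Nat.succ_ne_zero (γ s)
  rw [coeff_pderiv, coeff_antideriv_add, mul_assoc, inv_mul_cancel₀ this, mul_one]

theorem pderiv_comm (a b : σ) (K : MvPowerSeries σ ℂ) :
    pderiv ℂ a (pderiv ℂ b K) = pderiv ℂ b (pderiv ℂ a K) := by
  ext γ
  simp only [coeff_pderiv]
  by_cases h : a = b
  · rw [h]
  · rw [add_right_comm]
    simp only [Finsupp.add_apply, Finsupp.single_eq_of_ne h,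
      Finsupp.single_eq_of_ne (Ne.symm h), add_zero]
    ring

/-- The weight `k! j! / (k + j)!` where `k` is the exponent of `s` and `k + j` is the degree. -/
def binWeight (s : σ) : SeriesWeight σ where
  wt α := ((α.degree.choose (α s) : ℕ) : ℝ)⁻¹
  pos α := by
    have := Nat.choose_pos (Finsupp.le_degree s α)
    positivity
  add_le α β := by
    have h1 := Nat.choose_pos (Finsupp.le_degree s α)
    have h2 := Nat.choose_pos (Finsupp.le_degree s β)
    rw [← mul_inv]
    refine inv_anti₀ (by positivity) ?_
    rw [map_add, Finsupp.add_apply, Nat.add_choose_eq]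
    exact_mod_cast Finset.single_le_sum (s := Finset.HasAntidiagonal.antidiagonal (α s + β s))
      (a := (α s, β s)) (f := fun p : ℕ × ℕ => α.degree.choose p.1 * β.degree.choose p.2)
      (fun _ _ => Nat.zero_le _) (Finset.HasAntidiagonal.mem_antidiagonal.2 (rfl : α s + β s = _))

theorem binWeight_add_single_le (s : σ) (γ : σ →₀ ℕ) :
    ((γ s : ℝ) + 1)⁻¹ * (binWeight s).wt (γ + Finsupp.single s 1) ≤ (binWeight s).wt γ := by
  have h1 := Nat.choose_pos (Finsupp.le_degree s γ)
  have h2 : ((γ s : ℝ) + 1)⁻¹ ≤ 1 := inv_le_one_of_one_le₀ <| by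
    linarith [(γ s).cast_nonneg (α := ℝ)]
  have h3 : (binWeight s).wt (γ + Finsupp.single s 1) ≤ (binWeight s).wt γ := by
    refine inv_anti₀ (by exact_mod_cast h1) ?_
    rw [map_add, Finsupp.degree_single, Finsupp.add_apply, Finsupp.single_eq_same,
      Nat.choose_succ_succ]
    exact_mod_cast Nat.le_add_right _ _
  calc _ ≤ 1 * (binWeight s).wt (γ + Finsupp.single s 1) :=
        mul_le_mul_of_nonneg_right h2 ((binWeight s).pos _).le
    _ ≤ _ := by rwa [one_mul]

theorem binWeight_exchange_le {s i : σ} (hi : i ≠ s) (γ : σ →₀ ℕ) :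
    (((γ i : ℝ) + 1) * ((γ s : ℝ) + 1)⁻¹) * (binWeight s).wt (γ + Finsupp.single s 1) ≤
      (binWeight s).wt (γ + Finsupp.single i 1) := by
  have hle : γ i + γ s ≤ γ.degree := by
    have h : Finsupp.single i (γ i) + Finsupp.single s (γ s) ≤ γ := by
      intro j
      rw [Finsupp.add_apply, Finsupp.single_apply, Finsupp.single_apply]
      by_cases h1 : i = j
      · subst h1
        simp [Ne.symm hi]
      · by_cases h2 : s = j
        · subst h2
          simp [hi]
        · simp [h1, h2]
    simpa using Finsupp.degree_mono h
  simp only [binWeight, map_add, Finsupp.degree_single, Finsupp.add_apply, Finsupp.single_eq_same,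
    Finsupp.single_eq_of_ne (Ne.symm hi), add_zero]
  obtain ⟨c, hc⟩ := Nat.exists_eq_add_of_le hle
  set d := γ.degree
  have hk : 0 < (d + 1).choose (γ s) := Nat.choose_pos (by omega)
  have hk' : 0 < (d + 1).choose (γ s + 1) := Nat.choose_pos (by omega)
  have hrec := Nat.choose_succ_right_eq (d + 1) (γ s)
  have hsub : d + 1 - γ s = γ i + 1 + c := by omega
  rw [hsub] at hrec
  have hrec' : ((d + 1).choose (γ s + 1) : ℝ) * (γ s + 1) =
      (d + 1).choose (γ s) * (γ i + 1 + c) := by exact_mod_cast hrec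
  have h1 : (0 : ℝ) < (d + 1).choose (γ s) := by exact_mod_cast hk
  have h2 : (0 : ℝ) < (d + 1).choose (γ s + 1) := by exact_mod_cast hk'
  have h3 : (0 : ℝ) ≤ c := c.cast_nonneg
  rw [mul_assoc, ← mul_inv, ← div_eq_mul_inv, div_le_iff₀ (by positivity), ← div_eq_inv_mul,
    le_div_iff₀ h1, mul_comm ((γ s : ℝ) + 1), hrec']
  nlinarith [mul_nonneg h1.le h3]

end

section

open Filter Topology MvPowerSeries

variable {σ : Type*} [DecidableEq σ]

/-- A weighted shift operator whose factors are controlled by the weight restricts to a bounded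
operator on the algebra of weighted absolutely summable series. -/
theorem SeriesWeight.exists_restrict (w : SeriesWeight σ)
    (T : MvPowerSeries σ ℂ →ₗ[ℂ] MvPowerSeries σ ℂ) (s : σ) (ι : (σ →₀ ℕ) → (σ →₀ ℕ))
    (hι : Function.Injective ι) (a : (σ →₀ ℕ) → ℂ)
    (h0 : ∀ K α, α s = 0 → coeff α (T K) = 0)
    (h1 : ∀ K γ, coeff (γ + Finsupp.single s 1) (T K) = a γ * coeff (ι γ) K)
    (hb : ∀ γ, ‖a γ‖ * w.wt (γ + Finsupp.single s 1) ≤ w.wt (ι γ)) :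
    ∃ T' : w.algebra →L[ℂ] w.algebra, ∀ K, (T' K : MvPowerSeries σ ℂ) = T K := by
  have hinj : Function.Injective fun γ : σ →₀ ℕ => γ + Finsupp.single s 1 := add_left_injective _
  have hsupp : ∀ K : MvPowerSeries σ ℂ, ∀ α ∉ Set.range fun γ : σ →₀ ℕ => γ + Finsupp.single s 1,
      ‖coeff α (T K)‖ * w.wt α = 0 := by
    intro K α hα
    have : α s = 0 := by
      by_contra h
      obtain ⟨γ, rfl⟩ := exists_eq_add_single h
      exact hα ⟨γ, rfl⟩
    rw [h0 K α this, norm_zero, zero_mul]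
  have hle : ∀ (K : MvPowerSeries σ ℂ) γ,
      ‖coeff (γ + Finsupp.single s 1) (T K)‖ * w.wt (γ + Finsupp.single s 1) ≤
        ‖coeff (ι γ) K‖ * w.wt (ι γ) := by
    intro K γ
    rw [h1, norm_mul, mul_comm ‖a γ‖, mul_assoc]
    exact mul_le_mul_of_nonneg_left (hb γ) (norm_nonneg _)
  have hsum : ∀ K : w.algebra, Summable fun γ => ‖coeff (ι γ) K.1‖ * w.wt (ι γ) :=
    fun K => (w.summable_norm K).comp_injective hι
  have hsum' : ∀ K : w.algebra, Summable fun γ =>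
      ‖coeff (γ + Finsupp.single s 1) (T K.1)‖ * w.wt (γ + Finsupp.single s 1) := fun K =>
    Summable.of_nonneg_of_le (fun γ => mul_nonneg (norm_nonneg _) (w.pos _).le) (hle K.1) (hsum K)
  have hT : ∀ K : w.algebra, w.IsSummable (T K.1) := fun K =>
    (hinj.summable_iff (f := fun α => ‖coeff α (T K.1)‖ * w.wt α) (hsupp K.1)).1 (hsum' K)
  refine ⟨LinearMap.mkContinuous
    { toFun := fun K => ⟨T K.1, hT K⟩
      map_add' := fun K L => Subtype.ext (by simp)
      map_smul' := fun c K => Subtype.ext (by simp) } 1 fun K => ?_, fun K => rfl⟩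
  rw [one_mul, w.norm_def, w.norm_def]
  calc ∑' α, ‖coeff α (T K.1)‖ * w.wt α
      = ∑' γ, ‖coeff (γ + Finsupp.single s 1) (T K.1)‖ * w.wt (γ + Finsupp.single s 1) :=
        (hinj.tsum_eq (f := fun α => ‖coeff α (T K.1)‖ * w.wt α) (fun α hα => by
          by_contra h
          exact hα (hsupp K.1 α h))).symm
    _ ≤ ∑' γ, ‖coeff (ι γ) K.1‖ * w.wt (ι γ) := (hsum' K).tsum_le_tsum (hle K.1) (hsum K)
    _ ≤ _ := tsum_comp_le_tsum_of_inj (w.summable_norm K)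
        (fun α => mul_nonneg (norm_nonneg _) (w.pos _).le) hι

theorem exists_restrict_antideriv (s : σ) :
    ∃ T : (binWeight s).algebra →L[ℂ] (binWeight s).algebra,
      ∀ K, (T K : MvPowerSeries σ ℂ) = antideriv s K := by
  refine (binWeight s).exists_restrict (antideriv s) s id Function.injective_id
    (fun γ => ((γ s : ℂ) + 1)⁻¹) (fun K α h => coeff_antideriv_of_eq_zero h K)
    (fun K γ => by rw [coeff_antideriv_add, mul_comm]; rfl) fun γ => ?_
  have h := binWeight_add_single_le s γ
  have : ‖((γ s : ℂ) + 1)⁻¹‖ = ((γ s : ℝ) + 1)⁻¹ := by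
    rw [norm_inv]
    congr 1
    exact_mod_cast Complex.norm_natCast (γ s + 1)
  rwa [this]

theorem exists_restrict_antideriv_pderiv {s i : σ} (hi : i ≠ s) :
    ∃ T : (binWeight s).algebra →L[ℂ] (binWeight s).algebra,
      ∀ K, (T K : MvPowerSeries σ ℂ) = antideriv s (pderiv ℂ i K.1) := by
  refine (binWeight s).exists_restrict (antideriv s ∘ₗ (pderiv ℂ i).toLinearMap) s
    (fun γ => γ + Finsupp.single i 1) (add_left_injective _)
    (fun γ => ((γ i : ℂ) + 1) * ((γ s : ℂ) + 1)⁻¹)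
    (fun K α h => coeff_antideriv_of_eq_zero h _)
    (fun K γ => ?_) fun γ => ?_
  · change coeff _ (antideriv s (pderiv ℂ i K)) = _
    rw [coeff_antideriv_add, coeff_pderiv]
    ring
  · have h := binWeight_exchange_le hi γ
    have h1 : ∀ j, ‖((γ j : ℂ) + 1)‖ = (γ j : ℝ) + 1 := fun j => by
      exact_mod_cast Complex.norm_natCast (γ j + 1)
    rwa [norm_mul, norm_inv, h1, h1]

/-- The weight `ρ ^ |α|`. -/
def geomWeight (ρ : ℝ) (hρ : 0 < ρ) : SeriesWeight σ where
  wt α := ρ ^ α.degree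
  pos α := pow_pos hρ _
  add_le α β := by rw [map_add, pow_add]

/-- Absolute convergence of a power series on the closed polydisc of radius `ρ`. -/
def Conv (ρ : ℝ) (K : MvPowerSeries σ ℂ) : Prop :=
  Summable fun α => ‖coeff α K‖ * ρ ^ α.degree

theorem Conv.mem {ρ : ℝ} (hρ : 0 < ρ) {K : MvPowerSeries σ ℂ} (h : Conv ρ K) :
    K ∈ (geomWeight ρ hρ).algebra := h

theorem conv_of_mem {ρ : ℝ} (hρ : 0 < ρ) {K : MvPowerSeries σ ℂ}
    (h : K ∈ (geomWeight ρ hρ).algebra) : Conv ρ K := h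

theorem Conv.mono {ρ ρ' : ℝ} (hρ : 0 ≤ ρ) (hle : ρ ≤ ρ') {K : MvPowerSeries σ ℂ} (h : Conv ρ' K) :
    Conv ρ K := by
  refine Summable.of_nonneg_of_le (fun α => mul_nonneg (norm_nonneg _) (pow_nonneg hρ _))
    (fun α => ?_) h
  exact mul_le_mul_of_nonneg_left (pow_le_pow_left₀ hρ hle _) (norm_nonneg _)

theorem conv_of_binWeight {s : σ} (K : (binWeight s).algebra) : Conv (1 / 2) K.1 := by
  refine Summable.of_nonneg_of_le (fun α => by positivity) (fun α => ?_)
    ((binWeight s).summable_norm K)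
  refine mul_le_mul_of_nonneg_left ?_ (norm_nonneg _)
  rw [one_div, inv_pow]
  refine inv_anti₀ (by exact_mod_cast Nat.choose_pos (Finsupp.le_degree s α)) ?_
  exact_mod_cast Nat.choose_le_two_pow _ _

theorem binWeight_le_one (s : σ) (α : σ →₀ ℕ) : (binWeight s).wt α ≤ 1 :=
  inv_le_one_of_one_le₀ (by exact_mod_cast Nat.choose_pos (Finsupp.le_degree s α))

theorem prod_const_pow (r : ℂ) (α : σ →₀ ℕ) : (α.prod fun _ k => r ^ k) = r ^ α.degree := by
  rw [Finsupp.prod, Finset.prod_pow_eq_pow_sum, Finsupp.degree_apply]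

theorem coeff_rescale_const (r : ℂ) (K : MvPowerSeries σ ℂ) (α : σ →₀ ℕ) :
    coeff α (rescale (fun _ => r) K) = r ^ α.degree * coeff α K := by
  rw [coeff_rescale, prod_const_pow]

theorem Conv.rescale {ρ r : ℝ} {z : ℂ} (hz : ‖z‖ * r ≤ ρ) (hr : 0 ≤ r)
    {K : MvPowerSeries σ ℂ} (hK : Conv ρ K) : Conv r (MvPowerSeries.rescale (fun _ => z) K) := by
  refine Summable.of_nonneg_of_le (fun α => by positivity) (fun α => ?_) hK
  rw [coeff_rescale_const, norm_mul, norm_pow, mul_comm (‖z‖ ^ _), mul_assoc, ← mul_pow]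
  exact mul_le_mul_of_nonneg_left (pow_le_pow_left₀ (by positivity) hz _) (norm_nonneg _)

theorem Conv.mem_binWeight {K : MvPowerSeries σ ℂ} (hK : Conv 1 K) (s : σ) :
    K ∈ (binWeight s).algebra := by
  refine Summable.of_nonneg_of_le
    (fun α => mul_nonneg (norm_nonneg _) ((binWeight s).pos α).le) (fun α => ?_) hK
  rw [one_pow]
  exact mul_le_mul_of_nonneg_left (binWeight_le_one s α) (norm_nonneg _)

/-- Rescaling a convergent series brings it close to its constant coefficient. -/
theorem norm_rescale_sub_le {s : σ} {ρ : ℝ} (hρ : 0 < ρ) {K : MvPowerSeries σ ℂ} (hK : Conv ρ K)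
    {z : ℂ} (hz : ‖z‖ ≤ ρ) (L : (binWeight s).algebra)
    (hL : L.1 = MvPowerSeries.rescale (fun _ => z) K) :
    ‖L - algebraMap ℂ _ (coeff 0 K)‖ ≤ ‖z‖ * (ρ⁻¹ * ∑' α, ‖coeff α K‖ * ρ ^ α.degree) := by
  rw [(binWeight s).norm_def, ← mul_assoc, ← tsum_mul_left]
  refine ((binWeight s).summable_norm _).tsum_le_tsum (fun α => ?_) (hK.mul_left _)
  have hc : coeff α (L - algebraMap ℂ (binWeight s).algebra (coeff 0 K)).1 =
      if α = 0 then 0 else z ^ α.degree * coeff α K := by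
    have h : (L - algebraMap ℂ (binWeight s).algebra (coeff 0 K)).1 = L.1 - C (coeff 0 K) := rfl
    rw [h, hL, map_sub, coeff_rescale_const, coeff_C]
    by_cases hα : α = 0
    · simp [hα]
    · simp [hα]
  rw [hc]
  split_ifs with hα
  · simp only [norm_zero, zero_mul]
    positivity
  · have hd : α.degree ≠ 0 := fun h => hα ((Finsupp.degree_eq_zero_iff α).1 h)
    obtain ⟨k, hk⟩ := Nat.exists_eq_succ_of_ne_zero hd
    refine (mul_le_of_le_one_right (norm_nonneg _) (binWeight_le_one s α)).trans ?_
    rw [norm_mul, norm_pow, hk, Nat.succ_eq_add_one, pow_succ, pow_succ]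
    have h1 : ‖z‖ ^ k ≤ ρ ^ k := pow_le_pow_left₀ (norm_nonneg _) hz _
    calc ‖z‖ ^ k * ‖z‖ * ‖coeff α K‖ ≤ ρ ^ k * ‖z‖ * ‖coeff α K‖ := by gcongr
      _ = ‖z‖ * ρ⁻¹ * (‖coeff α K‖ * (ρ ^ k * ρ)) := by field_simp

theorem rescale_antideriv {z : ℂ} (s : σ) (K : MvPowerSeries σ ℂ) :
    rescale (fun _ => z) (antideriv s K) = z • antideriv s (rescale (fun _ => z) K) := by
  ext α
  rw [coeff_rescale_const, coeff_smul]
  by_cases h : α s = 0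
  · simp [coeff_antideriv_of_eq_zero h]
  · obtain ⟨γ, rfl⟩ := exists_eq_add_single h
    rw [coeff_antideriv_add, coeff_antideriv_add, coeff_rescale_const, map_add,
      Finsupp.degree_single]
    ring

theorem smul_rescale_pderiv {z : ℂ} (i : σ) (K : MvPowerSeries σ ℂ) :
    pderiv ℂ i (rescale (fun _ => z) K) = z • rescale (fun _ => z) (pderiv ℂ i K) := by
  ext α
  rw [coeff_smul, coeff_rescale_const, coeff_pderiv, coeff_pderiv,
    coeff_rescale_const, map_add, Finsupp.degree_single]
  ring

end

section

open Filter Topology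

section Words

variable {m n : ℕ} {R S : Type*} [CommRing R] [CommRing S]

/-- The matrix product associated with a word in the letters `C i` and `U`. -/
def wordMat (C : Fin m → Matrix (Fin n) (Fin n) R) (U : Matrix (Fin n) (Fin n) R)
    (L : List (Option (Fin m))) : Matrix (Fin n) (Fin n) R :=
  (L.map fun o => o.elim U C).prod

/-- The matrix whose columns are the `j₀`-th columns of the given word matrices. -/
def colMat (C : Fin m → Matrix (Fin n) (Fin n) R) (U : Matrix (Fin n) (Fin n) R)
    (w : Fin n → List (Option (Fin m))) (j₀ : Fin n) : Matrix (Fin n) (Fin n) R :=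
  Matrix.of fun k j => wordMat C U (w j) k j₀

/-- A linear combination of word matrices. -/
def wordSum (C : Fin m → Matrix (Fin n) (Fin n) R) (U : Matrix (Fin n) (Fin n) R)
    (w : Fin n → List (Option (Fin m))) (g : Fin n → R) : Matrix (Fin n) (Fin n) R :=
  ∑ j, g j • wordMat C U (w j)

theorem wordMat_map (θ : R →+* S) (C : Fin m → Matrix (Fin n) (Fin n) R)
    (U : Matrix (Fin n) (Fin n) R) (L : List (Option (Fin m))) :
    wordMat (fun i => (C i).map θ) (U.map θ) L = (wordMat C U L).map θ := by
  have h := map_list_prod (θ.mapMatrix (m := Fin n)) (L.map fun o => o.elim U C)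
  change _ = θ.mapMatrix _
  rw [wordMat, wordMat, h, List.map_map]
  congr 1
  refine List.map_congr_left fun o _ => ?_
  cases o <;> rfl

theorem colMat_map (θ : R →+* S) (C : Fin m → Matrix (Fin n) (Fin n) R)
    (U : Matrix (Fin n) (Fin n) R) (w : Fin n → List (Option (Fin m))) (j₀ : Fin n) :
    colMat (fun i => (C i).map θ) (U.map θ) w j₀ = (colMat C U w j₀).map θ := by
  ext k j
  simp [colMat, wordMat_map]

theorem wordSum_map (θ : R →+* S) (C : Fin m → Matrix (Fin n) (Fin n) R)
    (U : Matrix (Fin n) (Fin n) R) (w : Fin n → List (Option (Fin m))) (g : Fin n → R) :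
    wordSum (fun i => (C i).map θ) (U.map θ) w (fun j => θ (g j)) = (wordSum C U w g).map θ := by
  ext k j
  simp [wordSum, wordMat_map, Matrix.sum_apply]

theorem wordSum_apply_col (C : Fin m → Matrix (Fin n) (Fin n) R) (U : Matrix (Fin n) (Fin n) R)
    (w : Fin n → List (Option (Fin m))) (g : Fin n → R) (k j₀ : Fin n) :
    wordSum C U w g k j₀ = (colMat C U w j₀).mulVec g k := by
  simp [wordSum, Matrix.sum_apply, Matrix.mulVec, dotProduct, colMat, mul_comm]

end Words

section Smooth

variable {n m : ℕ} {A Y : Type*} [NormedCommRing A] [NormedAlgebra ℂ A]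
  [NormedAddCommGroup Y] [NormedSpace ℂ Y]

/-- Entrywise continuous differentiability of a matrix-valued map. -/
def EntryContDiff (B : Y → Matrix (Fin n) (Fin n) A) : Prop :=
  ∀ k j, ContDiff ℂ 1 fun y => B y k j

theorem EntryContDiff.mul {B B' : Y → Matrix (Fin n) (Fin n) A} (h : EntryContDiff B)
    (h' : EntryContDiff B') : EntryContDiff fun y => B y * B' y := fun k j => by
  simp only [Matrix.mul_apply]
  exact ContDiff.sum fun p _ => (h k p).mul (h' p j)

theorem EntryContDiff.sub {B B' : Y → Matrix (Fin n) (Fin n) A} (h : EntryContDiff B)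
    (h' : EntryContDiff B') : EntryContDiff fun y => B y - B' y := fun k j =>
  (h k j).sub (h' k j)

theorem EntryContDiff.wordMat {C : Fin m → Y → Matrix (Fin n) (Fin n) A}
    {U : Y → Matrix (Fin n) (Fin n) A} (hC : ∀ i, EntryContDiff (C i)) (hU : EntryContDiff U)
    (L : List (Option (Fin m))) : EntryContDiff fun y => wordMat (fun i => C i y) (U y) L := by
  induction L with
  | nil => exact fun k j => contDiff_const
  | cons o L ih =>
    have : EntryContDiff fun y => o.elim (U y) (fun i => C i y) := by
      cases o
      · exact hU
      · exact hC _
    exact this.mul ih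

theorem EntryContDiff.wordSum {C : Fin m → Y → Matrix (Fin n) (Fin n) A}
    {U : Y → Matrix (Fin n) (Fin n) A} {g : Y → Fin n → A}
    (hC : ∀ i, EntryContDiff (C i)) (hU : EntryContDiff U) (hg : ∀ j, ContDiff ℂ 1 fun y => g y j)
    (w : Fin n → List (Option (Fin m))) :
    EntryContDiff fun y => wordSum (fun i => C i y) (U y) w (g y) := fun k j => by
  simp only [_root_.wordSum, Matrix.sum_apply, Matrix.smul_apply, smul_eq_mul]
  exact ContDiff.sum fun p _ => (hg p).mul (EntryContDiff.wordMat hC hU (w p) k j)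

end Smooth

/-- Local solvability of a fixed point equation whose nonlinearity is small to first order. -/
theorem eventually_exists_fixedPoint {X : Type*} [NormedAddCommGroup X] [NormedSpace ℂ X]
    [CompleteSpace X] (P : ℂ × X → X) (hP : ContDiff ℂ 1 P) (Q : X → X) (u₀ : X) (hQ0 : Q u₀ = 0)
    (hQ : HasStrictFDerivAt Q (0 : X →L[ℂ] X) u₀) :
    ∀ᶠ q : ℂ × X in 𝓝 (0, u₀), ∃ u, u = q.2 + q.1 • P (q.1, u) + Q u := by
  have hP' : HasStrictFDerivAt P (fderiv ℂ P (0, u₀)) (0, u₀) :=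
    hP.contDiffAt.hasStrictFDerivAt (by simp)
  set G : ℂ × X → ℂ × X := fun q => (q.1, q.2 - q.1 • P q - Q q.2) with hG
  have hQ' : HasStrictFDerivAt (fun q : ℂ × X => Q q.2)
      ((0 : X →L[ℂ] X).comp (ContinuousLinearMap.snd ℂ ℂ X)) ((0 : ℂ), u₀) :=
    HasStrictFDerivAt.comp ((0 : ℂ), u₀) hQ hasStrictFDerivAt_snd
  have hd := (hasStrictFDerivAt_fst (𝕜 := ℂ) (p := ((0 : ℂ), u₀))).prodMk
    ((hasStrictFDerivAt_snd.sub (hasStrictFDerivAt_fst.smul hP')).sub hQ')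
  change HasStrictFDerivAt G _ _ at hd
  have hmap := hd.map_nhds_eq_of_surj (by
    refine LinearMap.range_eq_top.2 fun q => ⟨(q.1, q.2 + q.1 • P (0, u₀)), ?_⟩
    simp)
  have h0 : G (0, u₀) = (0, u₀) := by simp [hG, hQ0]
  rw [h0] at hmap
  rw [← hmap]
  refine eventually_map.2 (Eventually.of_forall fun q => ⟨q.2, ?_⟩)
  change q.2 = q.2 - q.1 • P q - Q q.2 + q.1 • P q + Q q.2
  abel

section Solve

variable {n m : ℕ} {A : Type*} [NormedCommRing A] [NormedAlgebra ℂ A] [CompleteSpace A]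

/-- The space of unknowns `(C, U, V, W, g)`. -/
abbrev Unknown (m n : ℕ) (A : Type*) :=
  (Fin m → Fin n → Fin n → A) × (Fin n → Fin n → A) × (Fin n → Fin n → A) ×
    (Fin n → Fin n → A) × (Fin n → A)

/-- The constant unknown. -/
def constUnknown (A : Type*) [NormedCommRing A] [NormedAlgebra ℂ A]
    (C : Fin m → Matrix (Fin n) (Fin n) ℂ) (U V W : Matrix (Fin n) (Fin n) ℂ) :
    Unknown m n A :=
  (fun i k j => algebraMap ℂ A (C i k j), fun k j => algebraMap ℂ A (U k j),
    fun k j => algebraMap ℂ A (V k j), fun k j => algebraMap ℂ A (W k j), 0)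

namespace Unknown

variable (u : Unknown m n A)

/-- The `C`-components. -/
def C (i : Fin m) : Matrix (Fin n) (Fin n) A := Matrix.of (u.1 i)
/-- The `U`-component. -/
def U : Matrix (Fin n) (Fin n) A := Matrix.of u.2.1
/-- The `V`-component. -/
def V : Matrix (Fin n) (Fin n) A := Matrix.of u.2.2.1
/-- The `W`-component. -/
def W : Matrix (Fin n) (Fin n) A := Matrix.of u.2.2.2.1
/-- The coefficient vector. -/
def g : Fin n → A := u.2.2.2.2

theorem C_apply (i : Fin m) (k j : Fin n) : u.C i k j = u.1 i k j := rfl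

theorem U_apply (k j : Fin n) : u.U k j = u.2.1 k j := rfl

theorem V_apply (k j : Fin n) : u.V k j = u.2.2.1 k j := rfl

theorem W_apply (k j : Fin n) : u.W k j = u.2.2.2.1 k j := rfl

theorem entryContDiff_C (i : Fin m) : EntryContDiff fun u : Unknown m n A => u.C i := fun k j => by
  change ContDiff ℂ 1 fun u : Unknown m n A => u.1 i k j
  fun_prop

theorem entryContDiff_U : EntryContDiff fun u : Unknown m n A => u.U := fun k j => by
  change ContDiff ℂ 1 fun u : Unknown m n A => u.2.1 k j
  fun_prop

theorem entryContDiff_V : EntryContDiff fun u : Unknown m n A => u.V := fun k j => by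
  change ContDiff ℂ 1 fun u : Unknown m n A => u.2.2.1 k j
  fun_prop

theorem entryContDiff_W : EntryContDiff fun u : Unknown m n A => u.W := fun k j => by
  change ContDiff ℂ 1 fun u : Unknown m n A => u.2.2.2.1 k j
  fun_prop

theorem contDiff_g (j : Fin n) : ContDiff ℂ 1 fun u : Unknown m n A => u.g j := by
  change ContDiff ℂ 1 fun u : Unknown m n A => u.2.2.2.2 j
  fun_prop

/-- The combination of words determined by the unknown. -/
def F (w : Fin n → List (Option (Fin m))) : Matrix (Fin n) (Fin n) A := wordSum u.C u.U w u.g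

theorem entryContDiff_F (w : Fin n → List (Option (Fin m))) :
    EntryContDiff fun u : Unknown m n A => u.F w :=
  EntryContDiff.wordSum (C := fun i (u : Unknown m n A) => u.C i) entryContDiff_C entryContDiff_U
    contDiff_g w

end Unknown

theorem EntryContDiff.clm {Y : Type*} [NormedAddCommGroup Y] [NormedSpace ℂ Y]
    {B : Y → Matrix (Fin n) (Fin n) A} (hB : EntryContDiff B) (T : A →L[ℂ] A) :
    ContDiff ℂ 1 fun y => fun k j => T (B y k j) :=
  contDiff_pi.2 fun k => contDiff_pi.2 fun j => T.contDiff.comp (hB k j)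

theorem eventually_exists_solution (J : A →L[ℂ] A) (D : Fin m → A →L[ℂ] A)
    (w : Fin n → List (Option (Fin m))) (j₀ : Fin n)
    (C₀ : Fin m → Matrix (Fin n) (Fin n) ℂ) (U₀ V₀ W₀ : Matrix (Fin n) (Fin n) ℂ)
    (Q₀ : Matrix (Fin n) (Fin n) ℂ) (hQ₀ : Q₀ * colMat C₀ U₀ w j₀ = 1) :
    ∀ᶠ q : ℂ × Unknown m n A in 𝓝 (0, constUnknown A C₀ U₀ V₀ W₀), ∃ u : Unknown m n A,
      (∀ i, u.C i = q.2.C i + q.1 • (u.F w).map (D i)) ∧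
      u.U = q.2.U + (q.1 * q.1 ^ 2) • (u.V * u.F w - u.F w * u.V - u.F w).map J ∧
      u.V = q.2.V - (q.1 * q.1 ^ 2) • (u.W * u.F w - u.F w * u.W).map J ∧
      u.W = q.2.W + (q.1 * q.1 ^ 2) • (u.W * u.F w - u.F w * u.W).map J ∧
      (Q₀.map (algebraMap ℂ A)).mulVec ((colMat u.C u.U w j₀).mulVec u.g) = q.2.g := by
  set u₀ := constUnknown A C₀ U₀ V₀ W₀ with hu₀
  set P : ℂ × Unknown m n A → Unknown m n A := fun q =>
    (fun i k j => D i (q.2.F w k j),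
      q.1 ^ 2 • fun k j => J ((q.2.V * q.2.F w - q.2.F w * q.2.V - q.2.F w) k j),
      -(q.1 ^ 2 • fun k j => J ((q.2.W * q.2.F w - q.2.F w * q.2.W) k j)),
      q.1 ^ 2 • fun k j => J ((q.2.W * q.2.F w - q.2.F w * q.2.W) k j), 0) with hPdef
  set b : Unknown m n A → Matrix (Fin n) (Fin n) A := fun u =>
    1 - Q₀.map (algebraMap ℂ A) * colMat u.C u.U w j₀ with hb
  set Q : Unknown m n A → Unknown m n A := fun u => (0, 0, 0, 0, (b u).mulVec u.g) with hQdef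
  have hP : ContDiff ℂ 1 P := by
    have hF := Unknown.entryContDiff_F (A := A) w
    have h1 : ∀ i, ContDiff ℂ 1 fun q : ℂ × Unknown m n A => fun k j => D i (q.2.F w k j) :=
      fun i => (hF.clm (D i)).comp contDiff_snd
    have h2 : ContDiff ℂ 1 fun q : ℂ × Unknown m n A => fun k j =>
        J ((q.2.V * q.2.F w - q.2.F w * q.2.V - q.2.F w) k j) :=
      ((((Unknown.entryContDiff_V.mul hF).sub (hF.mul Unknown.entryContDiff_V)).sub hF).clm J).comp
        contDiff_snd
    have h3 : ContDiff ℂ 1 fun q : ℂ × Unknown m n A => fun k j =>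
        J ((q.2.W * q.2.F w - q.2.F w * q.2.W) k j) :=
      (((Unknown.entryContDiff_W.mul hF).sub (hF.mul Unknown.entryContDiff_W)).clm J).comp
        contDiff_snd
    have h4 : ContDiff ℂ 1 fun q : ℂ × Unknown m n A => q.1 ^ 2 := contDiff_fst.pow 2
    exact (contDiff_pi.2 h1).prodMk ((h4.smul h2).prodMk ((h4.smul h3).neg.prodMk
      ((h4.smul h3).prodMk contDiff_const)))
  have hb0 : b u₀ = 0 := by
    have h1 : colMat u₀.C u₀.U w j₀ = (colMat C₀ U₀ w j₀).map (algebraMap ℂ A) :=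
      colMat_map (algebraMap ℂ A) C₀ U₀ w j₀
    rw [hb]
    simp only [h1]
    rw [← Matrix.map_mul, hQ₀]
    simp
  have hg0 : u₀.g = 0 := rfl
  have hQ0 : Q u₀ = 0 := by
    simp only [hQdef, hg0, Matrix.mulVec_zero]
    rfl
  have hbd : EntryContDiff b := by
    refine EntryContDiff.sub (fun k j => contDiff_const) (EntryContDiff.mul
      (fun k j => contDiff_const) fun k j => ?_)
    exact EntryContDiff.wordMat (C := fun i (u : Unknown m n A) => u.C i)
      Unknown.entryContDiff_C Unknown.entryContDiff_U (w j) k j₀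
  have hQ : HasStrictFDerivAt Q (0 : Unknown m n A →L[ℂ] Unknown m n A) u₀ := by
    have h1 : ∀ k, HasStrictFDerivAt (fun u => (b u).mulVec u.g k)
        (0 : Unknown m n A →L[ℂ] A) u₀ := by
      intro k
      have h2 : ∀ j, HasStrictFDerivAt (fun u : Unknown m n A => b u k j * u.g j)
          (0 : Unknown m n A →L[ℂ] A) u₀ := by
        intro j
        have h3 := ((hbd k j).contDiffAt.hasStrictFDerivAt (x := u₀) (by simp)).mul
          ((Unknown.contDiff_g j).contDiffAt.hasStrictFDerivAt (x := u₀) (by simp))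
        have e1 : b u₀ k j = 0 := by rw [hb0]; rfl
        have e2 : u₀.g j = 0 := rfl
        refine HasStrictFDerivAt.congr_fderiv h3 ?_
        refine ContinuousLinearMap.ext fun v => ?_
        change b u₀ k j * _ + u₀.g j * _ = (0 : A)
        rw [e1, e2]
        ring
      have := HasStrictFDerivAt.fun_sum (u := Finset.univ) fun j _ => h2 j
      simpa [Matrix.mulVec, dotProduct] using this
    have h2 : HasStrictFDerivAt (fun u => (b u).mulVec u.g)
        (0 : Unknown m n A →L[ℂ] (Fin n → A)) u₀ := hasStrictFDerivAt_pi'.2 h1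
    have hc : HasStrictFDerivAt (fun _ : Unknown m n A => (0 : Fin n → Fin n → A)) 
      (0 : Unknown m n A →L[ℂ] _) u₀ := hasStrictFDerivAt_const _ _
    have hc' : HasStrictFDerivAt (fun _ : Unknown m n A => (0 : Fin m → Fin n → Fin n → A)) 
      (0 : Unknown m n A →L[ℂ] _) u₀ := hasStrictFDerivAt_const _ _
    exact hc'.prodMk (hc.prodMk (hc.prodMk (hc.prodMk h2)))
  filter_upwards [eventually_exists_fixedPoint P hP Q u₀ hQ0 hQ] with q ⟨u, hu⟩
  refine ⟨u, fun i => ?_, ?_, ?_, ?_, ?_⟩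
  · ext k j
    have := congrFun (congrFun (congrFun (congrArg Prod.fst hu) i) k) j
    simpa [hPdef, hQdef, Unknown.C_apply] using this
  · ext k j
    have := congrFun (congrFun (congrArg (fun v => v.2.1) hu) k) j
    simpa [hPdef, hQdef, Unknown.U_apply, mul_smul] using this
  · ext k j
    have := congrFun (congrFun (congrArg (fun v => v.2.2.1) hu) k) j
    simpa [hPdef, hQdef, Unknown.V_apply, mul_smul, sub_eq_add_neg] using this
  · ext k j
    have := congrFun (congrFun (congrArg (fun v => v.2.2.2.1) hu) k) j
    simpa [hPdef, hQdef, Unknown.W_apply, mul_smul] using this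
  · have : u.g = q.2.g + q.1 • (0 : Fin n → A) + (b u).mulVec u.g :=
      congrArg (fun v => v.2.2.2.2) hu
    rw [smul_zero, add_zero, hb, Matrix.sub_mulVec, Matrix.one_mulVec] at this
    rw [Matrix.mulVec_mulVec]
    linear_combination this

end Solve

end

section

open Filter Topology MvPowerSeries

variable {σ : Type*} [DecidableEq σ]

open Classical in
/-- The rescaled series as an element of the weighted algebra (zero if it does not belong). -/
def rescaleElt (s : σ) (K : MvPowerSeries σ ℂ) (z : ℂ) : (binWeight s).algebra :=
  if h : rescale (fun _ => z) K ∈ (binWeight s).algebra then ⟨_, h⟩ else 0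

theorem rescaleElt_val (s : σ) {ρ : ℝ} {K : MvPowerSeries σ ℂ} (hK : Conv ρ K) {z : ℂ}
    (hz : ‖z‖ ≤ ρ) : (rescaleElt s K z).1 = rescale (fun _ => z) K := by
  have h : rescale (fun _ => z) K ∈ (binWeight s).algebra :=
    (hK.rescale (by simpa using hz) zero_le_one).mem_binWeight s
  rw [rescaleElt, dif_pos h]

theorem eventually_norm_sq_le {ρ : ℝ} (hρ : 0 < ρ) : ∀ᶠ ε : ℂ in 𝓝 0, ‖ε ^ 2‖ ≤ ρ := by
  have : Tendsto (fun ε : ℂ => ‖ε ^ 2‖) (𝓝 0) (𝓝 0) := by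
    have h : Continuous fun ε : ℂ => ‖ε ^ 2‖ := by fun_prop
    simpa using h.tendsto 0
  exact this.eventually_le_const hρ

theorem tendsto_rescaleElt (s : σ) {ρ : ℝ} (hρ : 0 < ρ) {K : MvPowerSeries σ ℂ} (hK : Conv ρ K) :
    Tendsto (fun ε : ℂ => rescaleElt s K (ε ^ 2)) (𝓝 0)
      (𝓝 (algebraMap ℂ (binWeight s).algebra (coeff 0 K))) := by
  rw [tendsto_iff_norm_sub_tendsto_zero]
  have h : Continuous fun ε : ℂ => ‖ε ^ 2‖ * (ρ⁻¹ * ∑' α, ‖coeff α K‖ * ρ ^ α.degree) := by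
    fun_prop
  refine squeeze_zero' (Eventually.of_forall fun _ => norm_nonneg _) ?_
    (by simpa using h.tendsto 0)
  filter_upwards [eventually_norm_sq_le hρ] with ε hε
  simpa using norm_rescale_sub_le hρ hK hε _ (rescaleElt_val s hK hε)

theorem tendsto_inv_smul_rescaleElt (s : σ) {ρ : ℝ} (hρ : 0 < ρ) {K : MvPowerSeries σ ℂ}
    (hK : Conv ρ K) (hK0 : coeff 0 K = 0) :
    Tendsto (fun ε : ℂ => ε⁻¹ • rescaleElt s K (ε ^ 2)) (𝓝 0) (𝓝 0) := by
  rw [tendsto_zero_iff_norm_tendsto_zero]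
  have h : Continuous fun ε : ℂ => ‖ε‖ * (ρ⁻¹ * ∑' α, ‖coeff α K‖ * ρ ^ α.degree) := by
    fun_prop
  refine squeeze_zero' (Eventually.of_forall fun _ => norm_nonneg _) ?_
    (by simpa using h.tendsto 0)
  filter_upwards [eventually_norm_sq_le hρ] with ε hε
  have h1 := norm_rescale_sub_le hρ hK hε _ (rescaleElt_val s hK hε)
  rw [hK0, map_zero, sub_zero] at h1
  rw [norm_smul, norm_inv]
  by_cases h0 : ε = 0
  · simp [h0]
  · have h2 : ‖ε‖ ≠ 0 := norm_ne_zero_iff.2 h0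
    calc ‖ε‖⁻¹ * ‖rescaleElt s K (ε ^ 2)‖
        ≤ ‖ε‖⁻¹ * (‖ε ^ 2‖ * (ρ⁻¹ * ∑' α, ‖coeff α K‖ * ρ ^ α.degree)) := by gcongr
      _ = _ := by rw [norm_pow]; field_simp

theorem exists_formal_solution {m n : ℕ} {s : σ} {e : Fin m → σ} (he : ∀ i, e i ≠ s)
    (w : Fin n → List (Option (Fin m))) (j₀ : Fin n)
    (C₀ : Fin m → Matrix (Fin n) (Fin n) (MvPowerSeries σ ℂ))
    (U₀ V₀ W₀ : Matrix (Fin n) (Fin n) (MvPowerSeries σ ℂ)) (φ : Fin n → MvPowerSeries σ ℂ)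
    {ρ : ℝ} (hρ : 0 < ρ) (hC₀ : ∀ i k j, Conv ρ (C₀ i k j)) (hU₀ : ∀ k j, Conv ρ (U₀ k j))
    (hV₀ : ∀ k j, Conv ρ (V₀ k j)) (hW₀ : ∀ k j, Conv ρ (W₀ k j)) (hφ : ∀ k, Conv ρ (φ k))
    (hφ0 : ∀ k, coeff 0 (φ k) = 0) (Q₀ : Matrix (Fin n) (Fin n) ℂ)
    (hQ₀ : Q₀ * colMat (fun i => (C₀ i).map (coeff 0)) (U₀.map (coeff 0)) w j₀ = 1) :
    ∃ (ρ' : ℝ) (_ : 0 < ρ') (C : Fin m → Matrix (Fin n) (Fin n) (MvPowerSeries σ ℂ))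
      (U V W : Matrix (Fin n) (Fin n) (MvPowerSeries σ ℂ)) (g : Fin n → MvPowerSeries σ ℂ),
      (∀ i k j, Conv ρ' (C i k j)) ∧ (∀ k j, Conv ρ' (U k j)) ∧ (∀ k j, Conv ρ' (V k j)) ∧
      (∀ k j, Conv ρ' (W k j)) ∧ (∀ k, Conv ρ' (g k)) ∧
      (∀ i, C i = C₀ i + (wordSum C U w g).map fun K => antideriv s (pderiv ℂ (e i) K)) ∧
      U = U₀ + (V * wordSum C U w g - wordSum C U w g * V - wordSum C U w g).map (antideriv s) ∧
      V = V₀ - (W * wordSum C U w g - wordSum C U w g * W).map (antideriv s) ∧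
      W = W₀ + (W * wordSum C U w g - wordSum C U w g * W).map (antideriv s) ∧
      (colMat C U w j₀).mulVec g = φ := by
  obtain ⟨J, hJ⟩ := exists_restrict_antideriv s
  choose D hD using fun i => exists_restrict_antideriv_pderiv (he i)
  set c₀ := fun i => (C₀ i).map (coeff 0)
  set x : ℂ → Unknown m n (binWeight s).algebra := fun ε =>
    (fun i k j => rescaleElt s (C₀ i k j) (ε ^ 2), fun k j => rescaleElt s (U₀ k j) (ε ^ 2),
      fun k j => rescaleElt s (V₀ k j) (ε ^ 2), fun k j => rescaleElt s (W₀ k j) (ε ^ 2),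
      fun k => ∑ p, algebraMap ℂ _ (Q₀ k p) * ε⁻¹ • rescaleElt s (φ p) (ε ^ 2)) with hx
  have hlim : Tendsto (fun ε : ℂ => (ε, x ε)) (𝓝 0) (𝓝 (0, constUnknown (binWeight s).algebra
      c₀ (U₀.map (coeff 0)) (V₀.map (coeff 0)) (W₀.map (coeff 0)))) := by
    refine tendsto_id.prodMk_nhds (Tendsto.prodMk_nhds ?_ (Tendsto.prodMk_nhds ?_
      (Tendsto.prodMk_nhds ?_ (Tendsto.prodMk_nhds ?_ ?_))))
    · exact tendsto_pi_nhds.2 fun i => tendsto_pi_nhds.2 fun k => tendsto_pi_nhds.2 fun j =>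
        tendsto_rescaleElt s hρ (hC₀ i k j)
    · exact tendsto_pi_nhds.2 fun k => tendsto_pi_nhds.2 fun j =>
        tendsto_rescaleElt s hρ (hU₀ k j)
    · exact tendsto_pi_nhds.2 fun k => tendsto_pi_nhds.2 fun j =>
        tendsto_rescaleElt s hρ (hV₀ k j)
    · exact tendsto_pi_nhds.2 fun k => tendsto_pi_nhds.2 fun j =>
        tendsto_rescaleElt s hρ (hW₀ k j)
    · refine tendsto_pi_nhds.2 fun k => ?_
      have h := tendsto_finsetSum Finset.univ fun p _ =>
        (tendsto_inv_smul_rescaleElt s hρ (hφ p) (hφ0 p)).const_mul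
          (algebraMap ℂ (binWeight s).algebra (Q₀ k p))
      simp only [mul_zero, Finset.sum_const_zero] at h
      exact h
  have hev := hlim.eventually (eventually_exists_solution J D w j₀ c₀ (U₀.map (coeff 0))
    (V₀.map (coeff 0)) (W₀.map (coeff 0)) Q₀ hQ₀)
  obtain ⟨ε, ⟨⟨u, huC, huU, huV, huW, hug⟩, hερ⟩, hε⟩ :=
    (((hev.and (eventually_norm_sq_le hρ)).filter_mono nhdsWithin_le_nhds).and
      (eventually_mem_nhdsWithin (a := (0 : ℂ)) (s := {0}ᶜ))).exists
  simp only [Set.mem_compl_iff, Set.mem_singleton_iff] at hε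
  set z := ε ^ 2 with hz
  have hz0 : z ≠ 0 := pow_ne_zero _ hε
  set θ : (binWeight s).algebra →+* MvPowerSeries σ ℂ :=
    (rescale fun _ => z⁻¹).comp (binWeight s).algebra.val.toRingHom with hθ
  have hθv : ∀ K, θ K = rescale (fun _ => z⁻¹) K.1 := fun K => rfl
  have hθr : ∀ K, Conv ρ K → θ (rescaleElt s K z) = K := by
    intro K hK
    rw [hθv, rescaleElt_val s hK hερ]
    ext α
    rw [coeff_rescale_const, coeff_rescale_const, ← mul_assoc, ← mul_pow, inv_mul_cancel₀ hz0,
      one_pow, one_mul]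
  have hθs : ∀ (c : ℂ) K, θ (c • K) = c • θ K := by
    intro c K
    ext α
    rw [coeff_smul, hθv, hθv, coeff_rescale_const, coeff_rescale_const]
    simp only [SetLike.val_smul, coeff_smul]
    ring
  have hθJ : ∀ K, z • θ (J K) = antideriv s (θ K) := by
    intro K
    rw [hθv, hJ, rescale_antideriv, smul_smul, mul_inv_cancel₀ hz0, one_smul, hθv]
  have hθD : ∀ i K, θ (D i K) = antideriv s (pderiv ℂ (e i) (θ K)) := by
    intro i K
    rw [hθv, hD, rescale_antideriv, hθv, smul_rescale_pderiv, map_smul]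
  have hconv : ∀ K, Conv (‖z‖ / 2) (θ K) := by
    intro K
    refine (conv_of_binWeight K).rescale ?_ (by positivity)
    rw [norm_inv]
    have := norm_ne_zero_iff.2 hz0
    exact le_of_eq (by field_simp)
  set C := fun i => (u.C i).map θ with hC
  set U := u.U.map θ with hU
  set V := u.V.map θ with hV
  set W := u.W.map θ with hW
  have hF : wordSum C U w (fun j => ε • θ (u.g j)) = ε • (u.F w).map θ := by
    rw [Unknown.F, ← wordSum_map]
    simp only [wordSum, Finset.smul_sum, smul_assoc]
    rfl
  have hvg : ∀ (B : Matrix (Fin n) (Fin n) (binWeight s).algebra),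
      B.map θ * (ε • (u.F w).map θ) = ε • (B * u.F w).map θ := fun B => by
    rw [Matrix.mul_smul, Matrix.map_mul]
  have hgv : ∀ (B : Matrix (Fin n) (Fin n) (binWeight s).algebra),
      (ε • (u.F w).map θ) * B.map θ = ε • (u.F w * B).map θ := fun B => by
    rw [Matrix.smul_mul, Matrix.map_mul]
  refine ⟨‖z‖ / 2, by positivity, C, U, V, W, fun j => ε • θ (u.g j), fun i k j => hconv _,
    fun k j => hconv _, fun k j => hconv _, fun k j => hconv _, fun k => ?_, fun i => ?_, ?_, ?_,
    ?_, ?_⟩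
  · have := hconv (ε • u.g k)
    rwa [hθs] at this
  · rw [hF]
    ext1 k j
    have h := congrArg θ (congrFun (congrFun (huC i) k) j)
    refine h.trans ?_
    simp only [Matrix.add_apply, Matrix.smul_apply, Matrix.map_apply, map_add, hθs, hθD]
    congr 1
    · exact hθr _ (hC₀ i k j)
    · simp
  · rw [hF, hvg, hgv, ← smul_sub, ← smul_sub]
    ext1 k j
    have h := congrArg θ (congrFun (congrFun huU k) j)
    refine h.trans ?_
    simp only [Matrix.add_apply, Matrix.smul_apply, Matrix.map_apply, map_add, hθs, mul_smul,
      map_smul, Matrix.sub_apply, map_sub, smul_sub, hθJ]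
    congr 1
    exact hθr _ (hU₀ k j)
  · rw [hF, hvg, hgv, ← smul_sub]
    ext1 k j
    have h := congrArg θ (congrFun (congrFun huV k) j)
    refine h.trans ?_
    simp only [Matrix.smul_apply, Matrix.map_apply, hθs, mul_smul,
      map_smul, Matrix.sub_apply, map_sub, smul_sub, hθJ]
    congr 1
    exact hθr _ (hV₀ k j)
  · rw [hF, hvg, hgv, ← smul_sub]
    ext1 k j
    have h := congrArg θ (congrFun (congrFun huW k) j)
    refine h.trans ?_
    simp only [Matrix.add_apply, Matrix.smul_apply, Matrix.map_apply, map_add, hθs, mul_smul,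
      map_smul, Matrix.sub_apply, map_sub, smul_sub, hθJ]
    congr 1
    exact hθr _ (hW₀ k j)
  · have hQ' : colMat c₀ (U₀.map (coeff 0)) w j₀ * Q₀ = 1 := mul_eq_one_comm.1 hQ₀
    have h1 : (x ε).g = (Q₀.map (algebraMap ℂ (binWeight s).algebra)).mulVec
        fun p => ε⁻¹ • rescaleElt s (φ p) z := rfl
    rw [h1] at hug
    have h2 := congrArg ((colMat c₀ (U₀.map (coeff 0)) w j₀).map
      (algebraMap ℂ (binWeight s).algebra)).mulVec hug
    rw [Matrix.mulVec_mulVec, Matrix.mulVec_mulVec, Matrix.mulVec_mulVec, ← Matrix.map_mul, hQ',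
      Matrix.map_one _ (map_zero _) (map_one _), Matrix.one_mul, Matrix.one_mulVec] at h2
    funext k
    have h3 := congrArg θ (congrFun h2 k)
    rw [hθs, hθr _ (hφ k)] at h3
    have h4 : (colMat C U w j₀).mulVec (fun j => θ (u.g j)) k =
        θ ((colMat u.C u.U w j₀).mulVec u.g k) := by
      rw [hC, hU, colMat_map, RingHom.map_mulVec]
      rfl
    have h5 : (fun j => ε • θ (u.g j)) = ε • fun j => θ (u.g j) := rfl
    rw [h5, Matrix.mulVec_smul, Pi.smul_apply, h4, h3, smul_smul, mul_inv_cancel₀ hε, one_smul]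

end

section

open Filter Topology MvPowerSeries

section Propagation

variable {S τ : Type*} [Ring S]

/-- An additive subgroup stable under multiplication from both sides. -/
structure IsBiideal (I : AddSubgroup S) : Prop where
  mul_left : ∀ x {y}, y ∈ I → x * y ∈ I
  mul_right : ∀ {x} y, x ∈ I → x * y ∈ I

theorem IsBiideal.bracket_right {I : AddSubgroup S} (hI : IsBiideal I) (x : S) {y : S}
    (hy : y ∈ I) : ⁅x, y⁆ ∈ I := by
  rw [Ring.lie_def]
  exact I.sub_mem (hI.mul_left x hy) (hI.mul_right x hy)

theorem IsBiideal.bracket_left {I : AddSubgroup S} (hI : IsBiideal I) {x : S} (y : S)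
    (hx : x ∈ I) : ⁅x, y⁆ ∈ I := by
  rw [Ring.lie_def]
  exact I.sub_mem (hI.mul_right y hx) (hI.mul_left y hx)

/-- The flatness constraints modulo a subgroup `I`. -/
structure Constraints (d : τ → S →+ S) (C : τ → S) (U V W : S) (I : AddSubgroup S) : Prop where
  comm : ∀ a b, ⁅C a, C b⁆ ∈ I
  commU : ∀ a, ⁅C a, U⁆ ∈ I
  closed : ∀ a b, d b (C a) - d a (C b) ∈ I
  derivU : ∀ a, d a U - ⁅V, C a⁆ + C a ∈ I
  derivW : ∀ a, d a W - ⁅W, C a⁆ ∈ I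
  derivV : ∀ a, d a V + ⁅W, C a⁆ ∈ I

variable {D : S →+ S} {d : τ → S →+ S} {C : τ → S} {U V W F : S}

theorem map_bracket_of_leibniz {D : S →+ S} (hD : ∀ x y, D (x * y) = D x * y + x * D y) (x y : S) :
    D ⁅x, y⁆ = ⁅D x, y⁆ + ⁅x, D y⁆ := by
  simp only [Ring.lie_def, map_sub, hD]
  abel

/-- If the constraints hold modulo `I`, then their derivatives along the flow vanish modulo `I`,
so the constraints hold modulo any `I'` obtained from `I` by integration. -/
theorem Constraints.step (hD : ∀ x y, D (x * y) = D x * y + x * D y)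
    (hd : ∀ a x y, d a (x * y) = d a x * y + x * d a y)
    (hDd : ∀ a x, D (d a x) = d a (D x)) (hdd : ∀ a b x, d a (d b x) = d b (d a x))
    (hC : ∀ a, D (C a) = d a F) (hU : D U = ⁅V, F⁆ - F) (hV : D V = -⁅W, F⁆) (hW : D W = ⁅W, F⁆)
    {I I₁ I' : AddSubgroup S} (hI : IsBiideal I) (hId : ∀ a x, x ∈ I → d a x ∈ I)
    (hint : ∀ x, x ∈ I₁ → D x ∈ I → x ∈ I')
    (hFC : ∀ a, ⁅F, C a⁆ ∈ I) (hFU : ⁅F, U⁆ ∈ I)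
    (h : Constraints d C U V W I) (h₁ : Constraints d C U V W I₁) :
    Constraints d C U V W I' := by
  have hQ : ∀ a, D (d a W - ⁅W, C a⁆) ∈ I := by
    intro a
    have : D (d a W - ⁅W, C a⁆) = ⁅d a W - ⁅W, C a⁆, F⁆ - ⁅W, ⁅F, C a⁆⁆ := by
      rw [map_sub, hDd, hW, map_bracket_of_leibniz hD, map_bracket_of_leibniz (hd a), hW, hC]
      simp only [Ring.lie_def]
      noncomm_ring
    rw [this]
    exact I.sub_mem (hI.bracket_left F (h.derivW a)) (hI.bracket_right W (hFC a))
  refine ⟨fun a b => hint _ (h₁.comm a b) ?_, fun a => hint _ (h₁.commU a) ?_,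
    fun a b => hint _ (h₁.closed a b) ?_, fun a => hint _ (h₁.derivU a) ?_,
    fun a => hint _ (h₁.derivW a) (hQ a), fun a => hint _ (h₁.derivV a) ?_⟩
  · have : D ⁅C a, C b⁆ = d a ⁅F, C b⁆ - d b ⁅F, C a⁆ + ⁅F, d b (C a) - d a (C b)⁆ := by
      rw [map_bracket_of_leibniz hD, map_bracket_of_leibniz (hd a), map_bracket_of_leibniz (hd b),
        hC, hC]
      simp only [Ring.lie_def]
      noncomm_ring
    rw [this]
    exact I.add_mem (I.sub_mem (hId _ _ (hFC b)) (hId _ _ (hFC a)))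
      (hI.bracket_right F (h.closed a b))
  · have : D ⁅C a, U⁆ = d a ⁅F, U⁆ - ⁅F, d a U - ⁅V, C a⁆ + C a⁆ + (⁅F, C a⁆ + ⁅F, C a⁆)
        - ⁅V, ⁅F, C a⁆⁆ := by
      rw [map_bracket_of_leibniz hD, map_bracket_of_leibniz (hd a), hC, hU]
      simp only [Ring.lie_def]
      noncomm_ring
    rw [this]
    exact I.sub_mem (I.add_mem (I.sub_mem (hId _ _ hFU) (hI.bracket_right F (h.derivU a)))
      (I.add_mem (hFC a) (hFC a))) (hI.bracket_right V (hFC a))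
  · rw [map_sub, hDd, hDd, hC, hC, hdd a b, sub_self]
    exact I.zero_mem
  · have : D (d a U - ⁅V, C a⁆ + C a) = ⁅d a V + ⁅W, C a⁆, F⁆ + ⁅W, ⁅F, C a⁆⁆ := by
      rw [map_add, map_sub, hDd, hU, map_bracket_of_leibniz hD, map_sub,
        map_bracket_of_leibniz (hd a), hV, hC]
      simp only [Ring.lie_def]
      noncomm_ring
    rw [this]
    exact I.add_mem (hI.bracket_left F (h.derivV a)) (hI.bracket_right W (hFC a))
  · have : D (d a V + ⁅W, C a⁆) = -D (d a W - ⁅W, C a⁆) := by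
      rw [map_add, map_sub, hDd, hDd, hV, hW, map_neg]
      abel
    rw [this]
    exact I.neg_mem (hQ a)

theorem constraints_bot (hD : ∀ x y, D (x * y) = D x * y + x * D y)
    (hd : ∀ a x y, d a (x * y) = d a x * y + x * d a y)
    (hDd : ∀ a x, D (d a x) = d a (D x)) (hdd : ∀ a b x, d a (d b x) = d b (d a x))
    (hC : ∀ a, D (C a) = d a F) (hU : D U = ⁅V, F⁆ - F) (hV : D V = -⁅W, F⁆) (hW : D W = ⁅W, F⁆)
    (I : ℕ → AddSubgroup S) (hI : ∀ k, IsBiideal (I k)) (hId : ∀ k a x, x ∈ I k → d a x ∈ I k)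
    (hint : ∀ k x, x ∈ I 1 → D x ∈ I k → x ∈ I (k + 1)) (hbot : ∀ x, (∀ k, x ∈ I (k + 1)) → x = 0)
    (hF : ∀ J : AddSubgroup S, IsBiideal J → ∀ x, (∀ a, ⁅C a, x⁆ ∈ J) → ⁅U, x⁆ ∈ J → ⁅F, x⁆ ∈ J)
    (h₁ : Constraints d C U V W (I 1)) : Constraints d C U V W ⊥ := by
  have hall : ∀ k, Constraints d C U V W (I (k + 1)) := by
    intro k
    induction k with
    | zero => exact h₁
    | succ k ih =>
      have hUC : ∀ a, ⁅U, C a⁆ ∈ I (k + 1) := fun a => by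
        have := (I _).neg_mem (ih.commU a)
        rwa [Ring.lie_def, neg_sub, ← Ring.lie_def] at this
      exact ih.step hD hd hDd hdd hC hU hV hW (hI _) (hId _) (hint _)
        (fun a => hF _ (hI _) _ (fun b => ih.comm b a) (hUC a))
        (hF _ (hI _) _ ih.commU (by rw [Ring.lie_def, sub_self]; exact (I _).zero_mem)) h₁
  exact ⟨fun a b => hbot _ fun k => (hall k).comm a b, fun a => hbot _ fun k => (hall k).commU a,
    fun a b => hbot _ fun k => (hall k).closed a b, fun a => hbot _ fun k => (hall k).derivU a,
    fun a => hbot _ fun k => (hall k).derivW a, fun a => hbot _ fun k => (hall k).derivV a⟩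

end Propagation

theorem wordMat_bracket_mem {m n : ℕ} {R : Type*} [CommRing R]
    {C : Fin m → Matrix (Fin n) (Fin n) R} {U : Matrix (Fin n) (Fin n) R}
    {J : AddSubgroup (Matrix (Fin n) (Fin n) R)} (hJ : IsBiideal J) {x : Matrix (Fin n) (Fin n) R}
    (hC : ∀ i, ⁅C i, x⁆ ∈ J) (hU : ⁅U, x⁆ ∈ J) (L : List (Option (Fin m))) :
    ⁅wordMat C U L, x⁆ ∈ J := by
  induction L with
  | nil =>
    have : ⁅wordMat C U [], x⁆ = 0 := by simp [wordMat, Ring.lie_def]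
    rw [this]
    exact J.zero_mem
  | cons o L ih =>
    have h1 : ⁅o.elim U C, x⁆ ∈ J := by
      cases o
      · exact hU
      · exact hC _
    have h2 : ⁅wordMat C U (o :: L), x⁆ =
        o.elim U C * ⁅wordMat C U L, x⁆ + ⁅o.elim U C, x⁆ * wordMat C U L := by
      simp only [wordMat, List.map_cons, List.prod_cons, Ring.lie_def]
      noncomm_ring
    rw [h2]
    exact J.add_mem (hJ.mul_left _ ih) (hJ.mul_right _ h1)

theorem wordSum_bracket_mem {m n : ℕ} {R : Type*} [CommRing R]
    {C : Fin m → Matrix (Fin n) (Fin n) R} {U : Matrix (Fin n) (Fin n) R}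
    {J : AddSubgroup (Matrix (Fin n) (Fin n) R)} (hJ : IsBiideal J) {x : Matrix (Fin n) (Fin n) R}
    (hC : ∀ i, ⁅C i, x⁆ ∈ J) (hU : ⁅U, x⁆ ∈ J) (w : Fin n → List (Option (Fin m)))
    (g : Fin n → R) : ⁅wordSum C U w g, x⁆ ∈ J := by
  have : ⁅wordSum C U w g, x⁆ = ∑ j, (g j • (1 : Matrix (Fin n) (Fin n) R)) *
      ⁅wordMat C U (w j), x⁆ := by
    simp [wordSum, Ring.lie_def, Finset.sum_mul, Finset.mul_sum, smul_sub]
  rw [this]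
  exact J.sum_mem fun j _ => hJ.mul_left _ (wordMat_bracket_mem hJ hC hU _)

section Ideals

variable {σ : Type*} [DecidableEq σ]

/-- The ideal of power series whose coefficients vanish on a lower set of exponents. -/
def coeffIdeal (P : LowerSet (σ →₀ ℕ)) : Ideal (MvPowerSeries σ ℂ) where
  carrier := {K | ∀ α ∈ P, coeff α K = 0}
  add_mem' hK hL α hα := by rw [map_add, hK α hα, hL α hα, add_zero]
  zero_mem' α _ := by simp
  smul_mem' L K hK α hα := by
    rw [smul_eq_mul, coeff_mul]
    refine Finset.sum_eq_zero fun p hp => ?_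
    have hle : p.2 ≤ α := by
      rw [← Finset.HasAntidiagonal.mem_antidiagonal.1 hp]
      exact le_add_self
    rw [hK _ (P.lower hle hα), mul_zero]

/-- Exponents with `s`-component less than `k`. -/
def expLT (s : σ) (k : ℕ) : LowerSet (σ →₀ ℕ) where
  carrier := {α | α s < k}
  lower' _ _ h hα := lt_of_le_of_lt (h s) hα

/-- Exponents whose components in `T` vanish. -/
def expZero (T : Set σ) : LowerSet (σ →₀ ℕ) where
  carrier := {α | ∀ i ∈ T, α i = 0}
  lower' _ _ h hα i hi := Nat.le_zero.1 ((h i).trans (hα i hi).le)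

theorem mem_expLT {s : σ} {k : ℕ} {α : σ →₀ ℕ} : α ∈ expLT s k ↔ α s < k := Iff.rfl

theorem mem_expZero {T : Set σ} {α : σ →₀ ℕ} : α ∈ expZero T ↔ ∀ i ∈ T, α i = 0 := Iff.rfl

theorem pderiv_mem_expLT {s i : σ} (hi : i ≠ s) {k : ℕ} {K : MvPowerSeries σ ℂ}
    (hK : K ∈ coeffIdeal (expLT s k)) : pderiv ℂ i K ∈ coeffIdeal (expLT s k) := fun α hα => by
  rw [coeff_pderiv, hK _ (by simpa [mem_expLT, Finsupp.single_eq_of_ne (Ne.symm hi)] using hα),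
    zero_mul]

theorem mem_expLT_succ {s : σ} {k : ℕ} {K : MvPowerSeries σ ℂ} (h1 : K ∈ coeffIdeal (expLT s 1))
    (hK : pderiv ℂ s K ∈ coeffIdeal (expLT s k)) : K ∈ coeffIdeal (expLT s (k + 1)) := by
  intro α hα
  by_cases h : α s = 0
  · exact h1 α (by rw [mem_expLT, h]; exact one_pos)
  · obtain ⟨γ, rfl⟩ := exists_eq_add_single h
    have h2 := hK γ (by simpa [mem_expLT] using hα)
    rw [coeff_pderiv] at h2
    have h3 : (γ s : ℂ) + 1 ≠ 0 := by exact_mod_cast Nat.succ_ne_zero (γ s)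
    exact (mul_eq_zero.1 h2).resolve_right h3

theorem eq_zero_of_mem_expLT {s : σ} {K : MvPowerSeries σ ℂ}
    (h : ∀ k, K ∈ coeffIdeal (expLT s (k + 1))) : K = 0 := by
  ext α
  exact h (α s) α (Nat.lt_succ_self _)

theorem eq_zero_of_pderiv_eq_zero {s : σ} {K : MvPowerSeries σ ℂ}
    (h1 : K ∈ coeffIdeal (expLT s 1)) (hK : pderiv ℂ s K = 0) : K = 0 :=
  eq_zero_of_mem_expLT fun _ => mem_expLT_succ h1 (by rw [hK]; exact Ideal.zero_mem _)

theorem antideriv_mem_expLT_one (s : σ) (K : MvPowerSeries σ ℂ) :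
    antideriv s K ∈ coeffIdeal (expLT s 1) := fun α hα =>
  coeff_antideriv_of_eq_zero (by simpa [mem_expLT] using hα) K

theorem pderiv_mem_expZero {T : Set σ} {i : σ} (hi : i ∉ T) {K : MvPowerSeries σ ℂ}
    (hK : K ∈ coeffIdeal (expZero T)) : pderiv ℂ i K ∈ coeffIdeal (expZero T) := fun α hα => by
  rw [coeff_pderiv, hK _ (fun j hj => ?_), zero_mul]
  rw [Finsupp.add_apply, hα j hj, Finsupp.single_eq_of_ne (by rintro rfl; exact hi hj), add_zero]

theorem antideriv_mem_expZero {T : Set σ} {s : σ} {K : MvPowerSeries σ ℂ}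
    (hK : K ∈ coeffIdeal (expZero T)) : antideriv s K ∈ coeffIdeal (expZero T) := fun α hα => by
  by_cases h : α s = 0
  · exact coeff_antideriv_of_eq_zero h K
  · obtain ⟨γ, rfl⟩ := exists_eq_add_single h
    rw [coeff_antideriv_add, hK γ ((expZero T).lower le_self_add hα), zero_mul]

variable {n : ℕ}

/-- Matrices with entries in an ideal. -/
def matIdeal (n : ℕ) {R : Type*} [CommRing R] (I : Ideal R) :
    AddSubgroup (Matrix (Fin n) (Fin n) R) where
  carrier := {A | ∀ k j, A k j ∈ I}
  add_mem' hA hB k j := I.add_mem (hA k j) (hB k j)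
  zero_mem' _ _ := I.zero_mem
  neg_mem' hA k j := I.neg_mem (hA k j)

theorem isBiideal_matIdeal {R : Type*} [CommRing R] (I : Ideal R) : IsBiideal (matIdeal n I) where
  mul_left _ _ hy k j := by
    rw [Matrix.mul_apply]
    exact I.sum_mem fun p _ => I.mul_mem_left _ (hy p j)
  mul_right _ hx k j := by
    rw [Matrix.mul_apply]
    exact I.sum_mem fun p _ => I.mul_mem_right _ (hx k p)

/-- The entrywise partial derivative. -/
def mpd (n : ℕ) (i : σ) :
    Matrix (Fin n) (Fin n) (MvPowerSeries σ ℂ) →+ Matrix (Fin n) (Fin n) (MvPowerSeries σ ℂ) :=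
  (pderiv ℂ i).toLinearMap.toAddMonoidHom.mapMatrix

theorem mpd_apply (i : σ) (A : Matrix (Fin n) (Fin n) (MvPowerSeries σ ℂ)) (k j : Fin n) :
    mpd n i A k j = pderiv ℂ i (A k j) := rfl

theorem mpd_mul (i : σ) (A B : Matrix (Fin n) (Fin n) (MvPowerSeries σ ℂ)) :
    mpd n i (A * B) = mpd n i A * B + A * mpd n i B := by
  ext1 k j
  simp only [mpd_apply, Matrix.mul_apply, Matrix.add_apply, map_sum, Derivation.leibniz,
    smul_eq_mul, ← Finset.sum_add_distrib]
  exact Finset.sum_congr rfl fun p _ => by ring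

theorem mpd_comm (a b : σ) (A : Matrix (Fin n) (Fin n) (MvPowerSeries σ ℂ)) :
    mpd n a (mpd n b A) = mpd n b (mpd n a A) := by
  ext1 k j
  exact pderiv_comm a b _

theorem mpd_antideriv (s : σ) (A : Matrix (Fin n) (Fin n) (MvPowerSeries σ ℂ)) :
    mpd n s (A.map (antideriv s)) = A := by
  ext1 k j
  exact pderiv_antideriv s _

/-- Propagation of the flatness constraints along the variable `s`. -/
theorem constraints_of_initial {m l : ℕ} {s : σ} {e : Fin m ⊕ Fin l → σ} (he : ∀ a, e a ≠ s)
    {C : Fin m ⊕ Fin l → Matrix (Fin n) (Fin n) (MvPowerSeries σ ℂ)}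
    {U V W F : Matrix (Fin n) (Fin n) (MvPowerSeries σ ℂ)}
    {w : Fin n → List (Option (Fin m))} {g : Fin n → MvPowerSeries σ ℂ}
    (hF : F = wordSum (fun i => C (Sum.inl i)) U w g)
    (hC : ∀ a, mpd n s (C a) = mpd n (e a) F) (hU : mpd n s U = ⁅V, F⁆ - F)
    (hV : mpd n s V = -⁅W, F⁆) (hW : mpd n s W = ⁅W, F⁆)
    (h₁ : Constraints (fun a => mpd n (e a)) C U V W (matIdeal n (coeffIdeal (expLT s 1)))) :
    Constraints (fun a => mpd n (e a)) C U V W ⊥ := by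
  refine constraints_bot (F := F) (mpd_mul s) (fun a => mpd_mul (e a)) (fun a => mpd_comm s (e a))
    (fun a b => mpd_comm _ _) hC hU hV hW
    (fun k => matIdeal n (coeffIdeal (expLT s k))) (fun k => isBiideal_matIdeal _)
    (fun k a x hx i j => pderiv_mem_expLT (he a) (hx i j))
    (fun k x h1 h2 i j => mem_expLT_succ (h1 i j) (h2 i j))
    (fun x hx => by
      ext1 i j
      exact eq_zero_of_mem_expLT fun k => hx k i j)
    (fun J hJ x hx hUx => ?_) h₁
  rw [hF]
  exact wordSum_bracket_mem hJ (fun i => hx (Sum.inl i)) hUx w g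

end Ideals

end

section

open Filter Topology MvPowerSeries

section ConvDeriv

variable {σ : Type*} [DecidableEq σ]

theorem Conv.pderiv {ρ : ℝ} (hρ : 0 < ρ) {K : MvPowerSeries σ ℂ} (hK : Conv ρ K) (i : σ) :
    Conv (ρ / 2) (MvPowerSeries.pderiv ℂ i K) := by
  have hinj : Function.Injective fun γ : σ →₀ ℕ => γ + Finsupp.single i 1 := add_left_injective _
  refine Summable.of_nonneg_of_le (fun α => by positivity) (fun γ => ?_)
    ((Summable.comp_injective hK hinj).mul_left ρ⁻¹)
  have h1 : ‖((γ i : ℂ) + 1)‖ = (γ i : ℝ) + 1 := by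
    exact_mod_cast Complex.norm_natCast (γ i + 1)
  have h2 : (γ i : ℝ) + 1 ≤ 2 ^ γ.degree := by
    have h : γ i + 1 ≤ 2 ^ γ.degree :=
      (Nat.succ_le_succ (Finsupp.le_degree i γ)).trans Nat.lt_two_pow_self
    exact_mod_cast h
  simp only [Function.comp_apply]
  rw [coeff_pderiv, norm_mul, h1, map_add, Finsupp.degree_single, pow_succ, div_pow]
  calc ‖coeff (γ + Finsupp.single i 1) K‖ * ((γ i : ℝ) + 1) * (ρ ^ γ.degree / 2 ^ γ.degree)
      ≤ ‖coeff (γ + Finsupp.single i 1) K‖ * 2 ^ γ.degree * (ρ ^ γ.degree / 2 ^ γ.degree) := by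
        gcongr
    _ = _ := by field_simp

theorem Conv.antideriv {ρ : ℝ} (hρ : 0 < ρ) {K : MvPowerSeries σ ℂ} (hK : Conv ρ K) (s : σ) :
    Conv ρ (antideriv s K) := by
  have hinj : Function.Injective fun γ : σ →₀ ℕ => γ + Finsupp.single s 1 := add_left_injective _
  refine (hinj.summable_iff (f := fun α => ‖coeff α (_root_.antideriv s K)‖ * ρ ^ α.degree)
    (fun α hα => ?_)).1 ?_
  · have : α s = 0 := by
      by_contra h
      obtain ⟨γ, rfl⟩ := exists_eq_add_single h
      exact hα ⟨γ, rfl⟩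
    rw [coeff_antideriv_of_eq_zero this, norm_zero, zero_mul]
  · refine Summable.of_nonneg_of_le
      (fun α => mul_nonneg (norm_nonneg _) (pow_nonneg hρ.le _)) (fun γ => ?_)
      (Summable.mul_left ρ hK)
    have h1 : ‖((γ s : ℂ) + 1)⁻¹‖ ≤ 1 := by
      rw [norm_inv]
      refine inv_le_one_of_one_le₀ ?_
      have : ‖((γ s : ℂ) + 1)‖ = (γ s : ℝ) + 1 := by
        exact_mod_cast Complex.norm_natCast (γ s + 1)
      rw [this]
      linarith [(Nat.cast_nonneg (γ s) : (0 : ℝ) ≤ γ s)]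
    simp only [Function.comp_apply]
    rw [coeff_antideriv_add, norm_mul, map_add, Finsupp.degree_single, pow_succ]
    calc ‖coeff γ K‖ * ‖((γ s : ℂ) + 1)⁻¹‖ * (ρ ^ γ.degree * ρ)
        ≤ ‖coeff γ K‖ * 1 * (ρ ^ γ.degree * ρ) := by gcongr
      _ = _ := by ring

theorem conv_zero (ρ : ℝ) : Conv ρ (0 : MvPowerSeries σ ℂ) := by
  simp [Conv, summable_zero]

theorem Conv.add {ρ : ℝ} (hρ : 0 < ρ) {K L : MvPowerSeries σ ℂ} (hK : Conv ρ K) (hL : Conv ρ L) :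
    Conv ρ (K + L) :=
  conv_of_mem hρ (add_mem (hK.mem hρ) (hL.mem hρ))

theorem Conv.sub {ρ : ℝ} (hρ : 0 < ρ) {K L : MvPowerSeries σ ℂ} (hK : Conv ρ K) (hL : Conv ρ L) :
    Conv ρ (K - L) :=
  conv_of_mem hρ (sub_mem (hK.mem hρ) (hL.mem hρ))

theorem Conv.mul {ρ : ℝ} (hρ : 0 < ρ) {K L : MvPowerSeries σ ℂ} (hK : Conv ρ K) (hL : Conv ρ L) :
    Conv ρ (K * L) :=
  conv_of_mem hρ (mul_mem (hK.mem hρ) (hL.mem hρ))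

theorem Conv.sum {ρ : ℝ} (hρ : 0 < ρ) {ι : Type*} {s : Finset ι} {K : ι → MvPowerSeries σ ℂ}
    (hK : ∀ i ∈ s, Conv ρ (K i)) : Conv ρ (∑ i ∈ s, K i) :=
  conv_of_mem hρ (sum_mem fun i hi => (hK i hi).mem hρ)

variable {n m : ℕ}

theorem conv_matrix_mul {ρ : ℝ} (hρ : 0 < ρ) {A B : Matrix (Fin n) (Fin n) (MvPowerSeries σ ℂ)}
    (hA : ∀ k j, Conv ρ (A k j)) (hB : ∀ k j, Conv ρ (B k j)) (k j : Fin n) :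
    Conv ρ ((A * B) k j) := by
  rw [Matrix.mul_apply]
  exact Conv.sum hρ fun p _ => (hA k p).mul hρ (hB p j)

theorem conv_wordSum {ρ : ℝ} (hρ : 0 < ρ)
    {C : Fin m → Matrix (Fin n) (Fin n) (MvPowerSeries σ ℂ)}
    {U : Matrix (Fin n) (Fin n) (MvPowerSeries σ ℂ)} {w : Fin n → List (Option (Fin m))}
    {g : Fin n → MvPowerSeries σ ℂ} (hC : ∀ i k j, Conv ρ (C i k j)) (hU : ∀ k j, Conv ρ (U k j))
    (hg : ∀ j, Conv ρ (g j)) (k j : Fin n) : Conv ρ (wordSum C U w g k j) := by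
  have hword : ∀ (L : List (Option (Fin m))) k j, Conv ρ (wordMat C U L k j) := by
    intro L
    induction L with
    | nil =>
      intro k j
      have h1 : Conv ρ (1 : MvPowerSeries σ ℂ) := conv_of_mem hρ (one_mem _)
      by_cases h : k = j
      · subst h
        simpa [wordMat] using h1
      · simpa [wordMat, Matrix.one_apply_ne h] using conv_zero ρ
    | cons o L ih =>
      have : wordMat C U (o :: L) = o.elim U C * wordMat C U L := by simp [wordMat]
      rw [this]
      refine conv_matrix_mul hρ ?_ ih
      cases o with
      | none => exact hU
      | some i => exact hC i
  rw [wordSum, Matrix.sum_apply]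
  exact Conv.sum hρ fun p _ => (hg p).mul hρ (hword _ k j)

end ConvDeriv

section Consequences

variable {S τ : Type*} [Ring S]

theorem IsBiideal.bracket_sub {I : AddSubgroup S} (hI : IsBiideal I) {x x' y y' : S}
    (hx : x - x' ∈ I) (hy : y - y' ∈ I) : ⁅x, y⁆ - ⁅x', y'⁆ ∈ I := by
  have : ⁅x, y⁆ - ⁅x', y'⁆ = ⁅x - x', y⁆ + ⁅x', y - y'⁆ := by
    simp only [Ring.lie_def]
    noncomm_ring
  rw [this]
  exact I.add_mem (hI.bracket_left _ hx) (hI.bracket_right _ hy)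

/-- The constraints modulo `I` depend only on the residue classes of the unknowns. -/
theorem Constraints.congr {d : τ → S →+ S} {C C' : τ → S} {U U' V V' W W' : S} {I : AddSubgroup S}
    (hI : IsBiideal I) (hd : ∀ a x, x ∈ I → d a x ∈ I) (h : Constraints d C' U' V' W' I)
    (hC : ∀ a, C a - C' a ∈ I) (hU : U - U' ∈ I) (hV : V - V' ∈ I) (hW : W - W' ∈ I) :
    Constraints d C U V W I := by
  have hdd : ∀ a {x y}, x - y ∈ I → d a x - d a y ∈ I := fun a x y hxy => by
    rw [← map_sub]
    exact hd a _ hxy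
  have key : ∀ {x y : S}, x - y ∈ I → y ∈ I → x ∈ I := fun {x y} h h' => by
    simpa using I.add_mem h h'
  refine ⟨fun a b => key (hI.bracket_sub (hC a) (hC b)) (h.comm a b),
    fun a => key (hI.bracket_sub (hC a) hU) (h.commU a), fun a b => key ?_ (h.closed a b),
    fun a => key ?_ (h.derivU a), fun a => key ?_ (h.derivW a), fun a => key ?_ (h.derivV a)⟩
  · rw [sub_sub_sub_comm]
    exact I.sub_mem (hdd b (hC a)) (hdd a (hC b))
  · rw [add_sub_add_comm, sub_sub_sub_comm]
    exact I.add_mem (I.sub_mem (hdd a hU) (hI.bracket_sub hV (hC a))) (hC a)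
  · rw [sub_sub_sub_comm]
    exact I.sub_mem (hdd a hW) (hI.bracket_sub hW (hC a))
  · rw [add_sub_add_comm]
    exact I.add_mem (hdd a hV) (hI.bracket_sub hW (hC a))

theorem Constraints.mono {d : τ → S →+ S} {C : τ → S} {U V W : S} {I J : AddSubgroup S}
    (h : Constraints d C U V W I) (hIJ : I ≤ J) : Constraints d C U V W J :=
  ⟨fun a b => hIJ (h.comm a b), fun a => hIJ (h.commU a), fun a b => hIJ (h.closed a b),
    fun a => hIJ (h.derivU a), fun a => hIJ (h.derivW a), fun a => hIJ (h.derivV a)⟩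

/-- The solution of an invertible linear system with right-hand side in an ideal lies in it. -/
theorem mem_of_mulVec_mem {R : Type*} [CommRing R] {n : ℕ} {M : Matrix (Fin n) (Fin n) R}
    (hM : IsUnit M.det) {I : Ideal R} {g : Fin n → R} (h : ∀ k, M.mulVec g k ∈ I) (j : Fin n) :
    g j ∈ I := by
  have : g = M⁻¹.mulVec (M.mulVec g) := by
    rw [Matrix.mulVec_mulVec, Matrix.nonsing_inv_mul M hM, Matrix.one_mulVec]
  rw [this]
  change ∑ p, M⁻¹ j p * M.mulVec g p ∈ I
  exact I.sum_mem fun p _ => I.mul_mem_left _ (h p)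

end Consequences

end

section

open Filter Topology MvPowerSeries

section FormalUnfolding

variable {m l n : ℕ}

theorem coeff_zero_antideriv {σ : Type*} [DecidableEq σ] (s : σ) (K : MvPowerSeries σ ℂ) :
    coeff 0 (antideriv s K) = 0 :=
  coeff_antideriv_of_eq_zero rfl K

theorem map_sub_mem_expLT {σ : Type*} [DecidableEq σ] {s : σ}
    {A A₀ B : Matrix (Fin n) (Fin n) (MvPowerSeries σ ℂ)} (h : A = A₀ + B.map (antideriv s)) :
    A - A₀ ∈ matIdeal n (coeffIdeal (expLT s 1)) := by
  rw [h, add_sub_cancel_left]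
  exact fun k j => antideriv_mem_expLT_one s _

/-- Existence of a formal, convergent one-parameter unfolding of the flat connection. -/
theorem exists_convergent_unfolding
    {C₀ : Fin m → Matrix (Fin n) (Fin n) (MvPowerSeries (Option (Fin m ⊕ Fin l)) ℂ)}
    {U₀ V₀ W₀ : Matrix (Fin n) (Fin n) (MvPowerSeries (Option (Fin m ⊕ Fin l)) ℂ)}
    {h : Fin n → MvPowerSeries (Option (Fin m ⊕ Fin l)) ℂ} {ρ : ℝ} (hρ : 0 < ρ)
    (hC₀ : ∀ i k j, Conv ρ (C₀ i k j)) (hU₀ : ∀ k j, Conv ρ (U₀ k j))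
    (hV₀ : ∀ k j, Conv ρ (V₀ k j)) (hW₀ : ∀ k j, Conv ρ (W₀ k j)) (hh : ∀ k, Conv ρ (h k))
    (hsC : ∀ i, mpd n none (C₀ i) = 0) (hsU : mpd n none U₀ = 0)
    (hsV : mpd n none V₀ = 0) (hsW : mpd n none W₀ = 0)
    (h₀ : Constraints (fun a : Fin m ⊕ Fin l => mpd n (some a)) (Sum.elim C₀ 0) U₀ V₀ W₀ ⊥)
    (w : Fin n → List (Option (Fin m))) (j₀ : Fin n) (Q₀ : Matrix (Fin n) (Fin n) ℂ)
    (hQ₀ : Q₀ * colMat (fun i => (C₀ i).map (coeff 0)) (U₀.map (coeff 0)) w j₀ = 1)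
    (hhs : ∀ k, h k ∈ coeffIdeal (expLT none 1))
    (hhy : ∀ k, h k ∈ coeffIdeal (expZero (Set.range fun α : Fin l => some (Sum.inr α)))) :
    ∃ (r : ℝ) (_ : 0 < r)
      (C : Fin m ⊕ Fin l → Matrix (Fin n) (Fin n) (MvPowerSeries (Option (Fin m ⊕ Fin l)) ℂ))
      (U V W : Matrix (Fin n) (Fin n) (MvPowerSeries (Option (Fin m ⊕ Fin l)) ℂ)),
      (∀ a k j, Conv r (C a k j)) ∧ (∀ k j, Conv r (U k j)) ∧ (∀ k j, Conv r (V k j)) ∧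
      (∀ k j, Conv r (W k j)) ∧
      Constraints (fun a => mpd n (some a)) C U V W ⊥ ∧
      (∀ i, C (Sum.inl i) - C₀ i ∈
        matIdeal n (coeffIdeal (expZero (Set.range fun α : Fin l => some (Sum.inr α))))) ∧
      U - U₀ ∈ matIdeal n (coeffIdeal (expZero (Set.range fun α : Fin l => some (Sum.inr α)))) ∧
      V - V₀ ∈ matIdeal n (coeffIdeal (expZero (Set.range fun α : Fin l => some (Sum.inr α)))) ∧
      W - W₀ ∈ matIdeal n (coeffIdeal (expZero (Set.range fun α : Fin l => some (Sum.inr α)))) ∧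
      ∀ α k, C (Sum.inr α) k j₀ = pderiv ℂ (some (Sum.inr α)) (h k) := by
  set T : Set (Option (Fin m ⊕ Fin l)) := Set.range fun α : Fin l => some (Sum.inr α) with hT
  have hnT : (none : Option (Fin m ⊕ Fin l)) ∉ T := by simp [hT]
  have hlT : ∀ i, (some (Sum.inl i) : Option (Fin m ⊕ Fin l)) ∉ T := by simp [hT]
  have hφT : ∀ k, pderiv ℂ none (h k) ∈ coeffIdeal (expZero T) := fun k =>
    pderiv_mem_expZero hnT (hhy k)
  obtain ⟨ρ', hρ', C, U, V, W, g, hcC, hcU, hcV, hcW, hcg, eC, eU, eV, eW, eφ⟩ :=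
    exists_formal_solution (s := none) (e := fun i : Fin m => some (Sum.inl i)) (by simp) w j₀
      C₀ U₀ V₀ W₀ (fun k => pderiv ℂ none (h k)) (half_pos hρ)
      (fun i k j => (hC₀ i k j).mono (half_pos hρ).le (half_le_self hρ.le))
      (fun k j => (hU₀ k j).mono (half_pos hρ).le (half_le_self hρ.le))
      (fun k j => (hV₀ k j).mono (half_pos hρ).le (half_le_self hρ.le))
      (fun k j => (hW₀ k j).mono (half_pos hρ).le (half_le_self hρ.le))
      (fun k => (hh k).pderiv hρ none)
      (fun k => hφT k 0 (by simp [mem_expZero])) Q₀ hQ₀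
  set F := wordSum C U w g with hF
  set D : Fin m ⊕ Fin l → Matrix (Fin n) (Fin n) (MvPowerSeries (Option (Fin m ⊕ Fin l)) ℂ) :=
    Sum.elim C fun α => (mpd n (some (Sum.inr α)) F).map (antideriv none) with hD
  have hcF : ∀ k j, Conv ρ' (F k j) := conv_wordSum hρ' hcC hcU hcg
  have eV' : V = V₀ + (-(W * F - F * W)).map (antideriv none) := by
    rw [eV, sub_eq_add_neg]
    congr 1
    ext1 k j
    simp
  have hCD : ∀ i, C i = C₀ i + (mpd n (some (Sum.inl i)) F).map (antideriv none) := fun i => by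
    rw [eC i]
    rfl
  have hdC : ∀ a, mpd n none (D a) = mpd n (some a) F := by
    rintro (i | α)
    · rw [hD, Sum.elim_inl, hCD i, map_add, hsC, mpd_antideriv, zero_add]
    · exact mpd_antideriv _ _
  have hdU : mpd n none U = ⁅V, F⁆ - F := by
    conv_lhs => rw [eU]
    rw [map_add, hsU, mpd_antideriv, zero_add, Ring.lie_def]
  have hdV : mpd n none V = -⁅W, F⁆ := by
    rw [eV', map_add, hsV, mpd_antideriv, zero_add, Ring.lie_def]
  have hdW : mpd n none W = ⁅W, F⁆ := by
    conv_lhs => rw [eW]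
    rw [map_add, hsW, mpd_antideriv, zero_add, Ring.lie_def]
  have hinit : Constraints (fun a => mpd n (some a)) D U V W
      (matIdeal n (coeffIdeal (expLT none 1))) := by
    refine (h₀.mono bot_le).congr (isBiideal_matIdeal _)
      (fun a x hx k j => pderiv_mem_expLT (by simp) (hx k j)) ?_ (map_sub_mem_expLT eU)
      (map_sub_mem_expLT eV') (map_sub_mem_expLT eW)
    rintro (i | α)
    · exact map_sub_mem_expLT (hCD i)
    · simp only [hD, Sum.elim_inr, Pi.zero_apply, sub_zero]
      exact fun k j => antideriv_mem_expLT_one _ _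
  have hne : ∀ a : Fin m ⊕ Fin l, some a ≠ none := fun a => Option.some_ne_none a
  have hcon : Constraints (fun a => mpd n (some a)) D U V W ⊥ :=
    constraints_of_initial (s := none) (e := some) (w := w) (g := g) hne hF hdC hdU hdV hdW hinit
  have hC0 : ∀ i, (C i).map (coeff 0) = (C₀ i).map (coeff 0) := fun i => by
    ext1 k j
    rw [eC i]
    simp only [Matrix.map_apply, Matrix.add_apply, map_add, coeff_zero_antideriv, add_zero]
  have hU0 : U.map (coeff 0) = U₀.map (coeff 0) := by
    ext1 k j
    rw [eU]
    simp only [Matrix.map_apply, Matrix.add_apply, map_add, coeff_zero_antideriv, add_zero]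
  have hdet : IsUnit (colMat C U w j₀).det := by
    rw [isUnit_iff_constantCoeff]
    have h1 : (colMat C U w j₀).map (constantCoeff (R := ℂ)) =
        colMat (fun i => (C₀ i).map (coeff 0)) (U₀.map (coeff 0)) w j₀ := by
      rw [← colMat_map, ← hU0, ← funext hC0]
      rfl
    have h2 : constantCoeff (colMat C U w j₀).det =
        ((colMat C U w j₀).map (constantCoeff (R := ℂ))).det := RingHom.map_det _ _
    rw [h2, h1]
    exact (Matrix.isUnit_iff_isUnit_det _).1 (IsUnit.of_mul_eq_one_right _ hQ₀)
  have hg : ∀ j, g j ∈ coeffIdeal (expZero T) := mem_of_mulVec_mem hdet fun k => by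
    rw [eφ]
    exact hφT k
  have hFT : F ∈ matIdeal n (coeffIdeal (expZero T)) := fun k j => by
    rw [hF, wordSum, Matrix.sum_apply]
    exact Ideal.sum_mem _ fun p _ => Ideal.mul_mem_right _ _ (hg p)
  have hb := isBiideal_matIdeal (n := n) (coeffIdeal (expZero T))
  have hA : ∀ {A A₀ B : Matrix (Fin n) (Fin n) (MvPowerSeries (Option (Fin m ⊕ Fin l)) ℂ)},
      A = A₀ + B.map (antideriv none) → B ∈ matIdeal n (coeffIdeal (expZero T)) →
      A - A₀ ∈ matIdeal n (coeffIdeal (expZero T)) := by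
    intro A A₀ B h hB
    rw [h, add_sub_cancel_left]
    exact fun k j => antideriv_mem_expZero (hB k j)
  have hWF : W * F - F * W ∈ matIdeal n (coeffIdeal (expZero T)) :=
    AddSubgroup.sub_mem _ (hb.mul_left _ hFT) (hb.mul_right _ hFT)
  refine ⟨ρ' / 2, half_pos hρ', D, U, V, W, ?_,
    fun k j => (hcU k j).mono (half_pos hρ').le (half_le_self hρ'.le),
    fun k j => (hcV k j).mono (half_pos hρ').le (half_le_self hρ'.le),
    fun k j => (hcW k j).mono (half_pos hρ').le (half_le_self hρ'.le), hcon,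
    fun i => hA (hCD i) fun k j => pderiv_mem_expZero (hlT i) (hFT k j),
    hA eU (AddSubgroup.sub_mem _ (AddSubgroup.sub_mem _ (hb.mul_left _ hFT) (hb.mul_right _ hFT))
      hFT), hA eV' (AddSubgroup.neg_mem _ hWF), hA eW hWF, fun α k => ?_⟩
  · rintro (i | α) k j
    · exact (hcC i k j).mono (half_pos hρ').le (half_le_self hρ'.le)
    · exact ((hcF k j).pderiv hρ' _).antideriv (half_pos hρ') _
  · rw [← sub_eq_zero]
    refine eq_zero_of_pderiv_eq_zero (s := none) (Ideal.sub_mem _ (antideriv_mem_expLT_one _ _)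
      (pderiv_mem_expLT (by simp) (hhs k))) ?_
    have h1 : pderiv ℂ none (h k) = F k j₀ := by
      rw [hF, wordSum_apply_col, eφ]
    rw [map_sub, pderiv_comm none, h1]
    exact sub_eq_zero.2 (pderiv_antideriv _ _)

end FormalUnfolding

end

section

open Filter Topology

section Expansion

/-- Iterated difference quotients at the origin. -/
def iterSlope (g : ℂ → ℂ) : ℕ → ℂ → ℂ
  | 0 => g
  | k + 1 => dslope (iterSlope g k) 0

theorem differentiableOn_iterSlope {g : ℂ → ℂ} {R : ℝ} (hR : 0 < R)
    (hg : DifferentiableOn ℂ g (Metric.ball 0 R)) (k : ℕ) :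
    DifferentiableOn ℂ (iterSlope g k) (Metric.ball 0 R) := by
  induction k with
  | zero => exact hg
  | succ k ih => exact (Complex.differentiableOn_dslope (Metric.ball_mem_nhds _ hR)).2 ih

theorem norm_iterSlope_le {g : ℂ → ℂ} {M R : ℝ} (hR : 0 < R)
    (hg : DifferentiableOn ℂ g (Metric.ball 0 R)) (hM : ∀ w ∈ Metric.ball (0 : ℂ) R, ‖g w‖ ≤ M)
    (k : ℕ) : ∀ w ∈ Metric.ball (0 : ℂ) R, ‖iterSlope g k w‖ ≤ M * (2 / R) ^ k := by
  induction k with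
  | zero => simpa [iterSlope] using hM
  | succ k ih =>
    intro w hw
    have h := Complex.norm_dslope_le_div_of_mapsTo_ball (R₂ := 2 * (M * (2 / R) ^ k))
      (differentiableOn_iterSlope hR hg k) (fun u hu => ?_) hw
    · rw [iterSlope]
      refine h.trans_eq ?_
      rw [pow_succ]
      ring
    · rw [Metric.mem_closedBall, dist_eq_norm, two_mul]
      exact (norm_sub_le _ _).trans (add_le_add (ih u hu) (ih 0 (Metric.mem_ball_self hR)))

theorem iterSlope_eq (g : ℂ → ℂ) (k : ℕ) (w : ℂ) :
    iterSlope g k w = iterSlope g k 0 + w * iterSlope g (k + 1) w := by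
  have h := sub_smul_dslope (iterSlope g k) 0 w
  rw [sub_zero, smul_eq_mul] at h
  rw [iterSlope, h, add_sub_cancel]

theorem eq_sum_iterSlope (g : ℂ → ℂ) (k : ℕ) (w : ℂ) :
    g w = ∑ j ∈ Finset.range k, iterSlope g j 0 * w ^ j + w ^ k * iterSlope g k w := by
  induction k with
  | zero => simp [iterSlope]
  | succ k ih =>
    rw [ih, iterSlope_eq g k w, Finset.sum_range_succ]
    ring

theorem hasSum_iterSlope {g : ℂ → ℂ} {M R : ℝ} (hR : 0 < R)
    (hg : DifferentiableOn ℂ g (Metric.ball 0 R)) (hM : ∀ w ∈ Metric.ball (0 : ℂ) R, ‖g w‖ ≤ M)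
    {w : ℂ} (hw : ‖w‖ < R / 2) : HasSum (fun k => iterSlope g k 0 * w ^ k) (g w) := by
  have h0 : (0 : ℂ) ∈ Metric.ball (0 : ℂ) R := Metric.mem_ball_self hR
  have hwR : w ∈ Metric.ball (0 : ℂ) R := by
    rw [mem_ball_zero_iff]
    linarith
  have hq0 : 0 ≤ 2 / R * ‖w‖ := by positivity
  have hq1 : 2 / R * ‖w‖ < 1 := by
    rw [div_mul_eq_mul_div, div_lt_one hR]
    linarith
  have hb : ∀ u ∈ Metric.ball (0 : ℂ) R, ∀ k,
      ‖iterSlope g k u * w ^ k‖ ≤ M * (2 / R * ‖w‖) ^ k := fun u hu k => by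
    rw [norm_mul, norm_pow, mul_pow, ← mul_assoc]
    exact mul_le_mul_of_nonneg_right (norm_iterSlope_le hR hg hM k u hu) (by positivity)
  have hs := (summable_geometric_of_lt_one hq0 hq1).mul_left M
  rw [hasSum_iff_tendsto_nat_of_summable_norm
    (Summable.of_nonneg_of_le (fun k => norm_nonneg _) (hb 0 h0) hs)]
  have h1 : Tendsto (fun k => iterSlope g k w * w ^ k) atTop (𝓝 0) :=
    squeeze_zero_norm (hb w hwR) hs.tendsto_atTop_zero
  have h2 := h1.const_sub (g w)
  rw [sub_zero] at h2
  refine h2.congr fun k => ?_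
  rw [sub_eq_iff_eq_add, mul_comm (iterSlope g k w)]
  exact eq_sum_iterSlope g k w

theorem differentiableOn_iterSlope_param {g : ℂ → ℂ → ℂ} {M R : ℝ} (hR : 0 < R)
    (hg : ∀ u ∈ Metric.ball (0 : ℂ) R, DifferentiableOn ℂ (g u) (Metric.ball 0 R))
    (hM : ∀ u ∈ Metric.ball (0 : ℂ) R, ∀ w ∈ Metric.ball (0 : ℂ) R, ‖g u w‖ ≤ M)
    (hgu : ∀ w ∈ Metric.ball (0 : ℂ) R, DifferentiableOn ℂ (fun u => g u w) (Metric.ball 0 R))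
    (k : ℕ) : ∀ w ∈ Metric.ball (0 : ℂ) R,
      DifferentiableOn ℂ (fun u => iterSlope (g u) k w) (Metric.ball 0 R) := by
  induction k with
  | zero => exact hgu
  | succ k ih =>
    have hne : ∀ w ∈ Metric.ball (0 : ℂ) R, w ≠ 0 →
        DifferentiableOn ℂ (fun u => iterSlope (g u) (k + 1) w) (Metric.ball 0 R) := by
      intro w hw hw0
      have : (fun u => iterSlope (g u) (k + 1) w) =
          fun u => w⁻¹ * (iterSlope (g u) k w - iterSlope (g u) k 0) := by
        funext u
        rw [iterSlope_eq (g u) k w, add_sub_cancel_left, inv_mul_cancel_left₀ hw0]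
      rw [this]
      exact ((ih w hw).sub (ih 0 (Metric.mem_ball_self hR))).const_mul _
    intro w hw
    by_cases hw0 : w = 0
    · subst hw0
      have hev : ∀ᶠ w in 𝓝[≠] (0 : ℂ), w ∈ Metric.ball (0 : ℂ) R :=
        eventually_nhdsWithin_of_eventually_nhds (Metric.ball_mem_nhds _ hR)
      refine TendstoLocallyUniformlyOn.differentiableOn (φ := 𝓝[≠] (0 : ℂ))
        (F := fun w u => iterSlope (g u) (k + 1) w)
        (TendstoUniformlyOn.tendstoLocallyUniformlyOn ?_) ?_ Metric.isOpen_ball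
      · rw [Metric.tendstoUniformlyOn_iff]
        intro ε hε
        have hlim : Tendsto (fun w : ℂ => ‖w‖ * (M * (2 / R) ^ (k + 2))) (𝓝[≠] 0) (𝓝 0) := by
          refine Tendsto.mono_left ?_ nhdsWithin_le_nhds
          have : Continuous fun w : ℂ => ‖w‖ * (M * (2 / R) ^ (k + 2)) := by fun_prop
          simpa using this.tendsto 0
        filter_upwards [hev, hlim.eventually (gt_mem_nhds hε)] with w hw hlt u hu
        refine lt_of_le_of_lt ?_ hlt
        rw [dist_comm, dist_eq_norm, iterSlope_eq (g u) (k + 1) w, add_sub_cancel_left, norm_mul]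
        exact mul_le_mul_of_nonneg_left
          (norm_iterSlope_le hR (hg u hu) (hM u hu) (k + 2) w hw) (norm_nonneg _)
      · filter_upwards [hev, self_mem_nhdsWithin] with w hw hw0 using hne w hw hw0
    · exact hne w hw hw0

theorem summable_prod_pow {d : ℕ} (q : Fin d → ℝ) (h0 : ∀ i, 0 ≤ q i) (h1 : ∀ i, q i < 1) :
    Summable fun α : Fin d → ℕ => ∏ i, q i ^ α i := by
  induction d with
  | zero => exact Summable.of_finite
  | succ d ih =>
    rw [← (Fin.consEquiv fun _ => ℕ).summable_iff]
    have h := (summable_geometric_of_lt_one (h0 0) (h1 0)).mul_of_nonneg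
      (ih (fun i => q i.succ) (fun i => h0 _) (fun i => h1 _)) (fun k => pow_nonneg (h0 0) k)
      (fun α => Finset.prod_nonneg fun i _ => pow_nonneg (h0 _) _)
    refine h.congr fun p => ?_
    rw [Function.comp_apply, Fin.prod_univ_succ]
    simp [Fin.consEquiv]

/-- A bounded separately holomorphic function on a polydisc has a power series expansion. -/
theorem exists_hasSum_fin {d : ℕ} {R : ℝ} (hR : 0 < R) {M : ℝ} {f : (Fin d → ℂ) → ℂ}
    (hM : ∀ z, (∀ i, ‖z i‖ < R) → ‖f z‖ ≤ M)
    (hf : ∀ z, (∀ i, ‖z i‖ < R) → ∀ i,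
      DifferentiableOn ℂ (fun u => f (Function.update z i u)) (Metric.ball 0 R)) :
    ∃ c : (Fin d → ℕ) → ℂ, (∀ α, ‖c α‖ ≤ M * (2 / R) ^ ∑ i, α i) ∧
      ∀ z, (∀ i, ‖z i‖ < R / 2) → HasSum (fun α => c α * ∏ i, z i ^ α i) (f z) := by
  induction d generalizing M with
  | zero =>
    refine ⟨fun _ => f 0, fun α => by simpa using hM 0 (fun i => i.elim0), fun z _ => ?_⟩
    have hz : z = 0 := Subsingleton.elim _ _
    subst hz
    simp
  | succ d ih =>
    have hcons : ∀ (z : Fin d → ℂ), (∀ i, ‖z i‖ < R) → ∀ w ∈ Metric.ball (0 : ℂ) R,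
        ∀ i, ‖(Fin.cons w z : Fin (d + 1) → ℂ) i‖ < R := by
      intro z hz w hw i
      refine Fin.cases ?_ (fun i => ?_) i
      · simpa using hw
      · simpa using hz i
    have hg : ∀ z : Fin d → ℂ, (∀ i, ‖z i‖ < R) →
        DifferentiableOn ℂ (fun w => f (Fin.cons w z)) (Metric.ball 0 R) := fun z hz => by
      simpa using hf _ (hcons z hz 0 (Metric.mem_ball_self hR)) 0
    have hgM : ∀ z : Fin d → ℂ, (∀ i, ‖z i‖ < R) → ∀ w ∈ Metric.ball (0 : ℂ) R,
        ‖f (Fin.cons w z)‖ ≤ M := fun z hz w hw => hM _ (hcons z hz w hw)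
    have hup : ∀ (z : Fin d → ℂ), (∀ i, ‖z i‖ < R) → ∀ i, ∀ u ∈ Metric.ball (0 : ℂ) R,
        ∀ j, ‖Function.update z i u j‖ < R := by
      intro z hz i u hu j
      by_cases h : j = i
      · subst h
        simpa using hu
      · simpa [Function.update_of_ne h] using hz j
    have hstep := fun k : ℕ => ih (M := M * (2 / R) ^ k)
      (f := fun z => iterSlope (fun w => f (Fin.cons w z)) k 0)
      (fun z hz => norm_iterSlope_le hR (hg z hz) (hgM z hz) k 0 (Metric.mem_ball_self hR))
      (fun z hz i => differentiableOn_iterSlope_param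
        (g := fun u w => f (Fin.cons w (Function.update z i u))) hR
        (fun u hu => hg _ (hup z hz i u hu)) (fun u hu => hgM _ (hup z hz i u hu))
        (fun w hw => by
          simpa [Fin.cons_update] using hf _ (hcons z hz w hw) i.succ) k 0
        (Metric.mem_ball_self hR))
    choose c hc hcs using hstep
    have hcb : ∀ α : Fin (d + 1) → ℕ,
        ‖c (α 0) (fun i => α i.succ)‖ ≤ M * (2 / R) ^ ∑ i, α i := fun α => by
      refine (hc _ _).trans_eq ?_
      rw [Fin.sum_univ_succ, pow_add, mul_assoc]
    refine ⟨fun α => c (α 0) fun i => α i.succ, hcb, fun z hz => ?_⟩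
    have hq0 : ∀ i, 0 ≤ 2 / R * ‖z i‖ := fun i => by positivity
    have hq1 : ∀ i, 2 / R * ‖z i‖ < 1 := fun i => by
      rw [div_mul_eq_mul_div, div_lt_one hR]
      linarith [hz i]
    have hs : Summable fun α : Fin (d + 1) → ℕ =>
        c (α 0) (fun i => α i.succ) * ∏ i, z i ^ α i := by
      refine Summable.of_norm_bounded ((summable_prod_pow _ hq0 hq1).mul_left M) fun α => ?_
      rw [norm_mul, norm_prod]
      simp only [mul_pow, norm_pow, Finset.prod_mul_distrib, Finset.prod_pow_eq_pow_sum,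
        ← mul_assoc]
      exact mul_le_mul_of_nonneg_right (hcb α)
        (Finset.prod_nonneg fun i _ => pow_nonneg (norm_nonneg _) _)
    have hs' := (Fin.consEquiv fun _ => ℕ).hasSum_iff.2 hs.hasSum
    have hz' : ∀ i : Fin d, ‖z i.succ‖ < R := fun i => by linarith [hz i.succ]
    have hfib := hs'.prod_fiberwise
      (g := fun k => iterSlope (fun w => f (Fin.cons w fun i => z i.succ)) k 0 * z 0 ^ k)
      fun k => by
        convert! (hcs k (fun i => z i.succ) fun i => hz _).mul_right (z 0 ^ k) using 1
        funext α
        simp only [Function.comp_apply, Fin.prod_univ_succ, Fin.consEquiv, Equiv.coe_fn_mk,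
          Fin.cons_zero, Fin.cons_succ]
        ring
    have h1 := hfib.unique (hasSum_iterSlope hR (hg _ hz') (hgM _ hz') (hz 0))
    have h2 : (Fin.cons (z 0) fun i => z i.succ : Fin (d + 1) → ℂ) = z := Fin.cons_self_tail z
    have h3 := hs.hasSum
    rwa [h1, h2] at h3

end Expansion

end

section

open Filter Topology MvPowerSeries

section Evaluation

variable {σ : Type*} [DecidableEq σ] [Fintype σ]

/-- The value of a power series at a point. -/
def evalF (K : MvPowerSeries σ ℂ) (z : σ → ℂ) : ℂ :=
  ∑' α, coeff α K * ∏ i, z i ^ α i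

theorem prod_pow_add (z : σ → ℂ) (α β : σ →₀ ℕ) :
    ∏ i, z i ^ (α + β) i = (∏ i, z i ^ α i) * ∏ i, z i ^ β i := by
  simp [pow_add, Finset.prod_mul_distrib]

theorem norm_prod_pow_le {ρ : ℝ} {z : σ → ℂ} (hz : ‖z‖ ≤ ρ) (α : σ →₀ ℕ) :
    ‖∏ i, z i ^ α i‖ ≤ ρ ^ α.degree := by
  rw [norm_prod, Finsupp.degree_eq_sum, ← Finset.prod_pow_eq_pow_sum]
  refine Finset.prod_le_prod (fun _ _ => norm_nonneg _) fun i _ => ?_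
  rw [norm_pow]
  exact pow_le_pow_left₀ (norm_nonneg _) ((norm_le_pi_norm z i).trans hz) _

theorem Conv.summable_norm {ρ : ℝ} {K : MvPowerSeries σ ℂ} (hK : Conv ρ K) {z : σ → ℂ}
    (hz : ‖z‖ ≤ ρ) : Summable fun α => ‖coeff α K * ∏ i, z i ^ α i‖ := by
  refine Summable.of_nonneg_of_le (fun α => norm_nonneg _) (fun α => ?_) hK
  rw [norm_mul]
  exact mul_le_mul_of_nonneg_left (norm_prod_pow_le hz α) (norm_nonneg _)

theorem Conv.summable {ρ : ℝ} {K : MvPowerSeries σ ℂ} (hK : Conv ρ K) {z : σ → ℂ}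
    (hz : ‖z‖ ≤ ρ) : Summable fun α => coeff α K * ∏ i, z i ^ α i :=
  (hK.summable_norm hz).of_norm

theorem evalF_add {ρ : ℝ} {K L : MvPowerSeries σ ℂ} (hK : Conv ρ K) (hL : Conv ρ L) {z : σ → ℂ}
    (hz : ‖z‖ ≤ ρ) : evalF (K + L) z = evalF K z + evalF L z := by
  rw [evalF, evalF, evalF, ← (hK.summable hz).tsum_add (hL.summable hz)]
  simp only [map_add, add_mul]

theorem evalF_sub {ρ : ℝ} {K L : MvPowerSeries σ ℂ} (hK : Conv ρ K) (hL : Conv ρ L) {z : σ → ℂ}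
    (hz : ‖z‖ ≤ ρ) : evalF (K - L) z = evalF K z - evalF L z := by
  rw [evalF, evalF, evalF, ← (hK.summable hz).tsum_sub (hL.summable hz)]
  simp only [map_sub, sub_mul]

theorem evalF_zero_left (z : σ → ℂ) : evalF (0 : MvPowerSeries σ ℂ) z = 0 := by
  simp [evalF]

theorem evalF_neg (K : MvPowerSeries σ ℂ) (z : σ → ℂ) : evalF (-K) z = -evalF K z := by
  simp only [evalF, map_neg, neg_mul, tsum_neg]

theorem evalF_mul {ρ : ℝ} {K L : MvPowerSeries σ ℂ} (hK : Conv ρ K) (hL : Conv ρ L) {z : σ → ℂ}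
    (hz : ‖z‖ ≤ ρ) : evalF (K * L) z = evalF K z * evalF L z := by
  have hp := summable_mul_of_summable_norm (hK.summable_norm hz) (hL.summable_norm hz)
  rw [evalF, evalF, evalF,
    (hK.summable hz).tsum_mul_tsum_eq_tsum_sum_antidiagonal (hL.summable hz) hp]
  refine tsum_congr fun α => ?_
  rw [coeff_mul, Finset.sum_mul]
  refine Finset.sum_congr rfl fun p hp => ?_
  rw [← Finset.HasAntidiagonal.mem_antidiagonal.1 hp, prod_pow_add]
  ring

theorem evalF_sum {ρ : ℝ} (hρ : 0 < ρ) {ι : Type*} (s : Finset ι) {K : ι → MvPowerSeries σ ℂ}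
    (hK : ∀ i ∈ s, Conv ρ (K i)) {z : σ → ℂ} (hz : ‖z‖ ≤ ρ) :
    evalF (∑ i ∈ s, K i) z = ∑ i ∈ s, evalF (K i) z := by
  classical
  induction s using Finset.induction_on with
  | empty => simp [evalF_zero_left]
  | insert a s ha ih =>
    have hs : ∀ i ∈ s, Conv ρ (K i) := fun i hi => hK i (Finset.mem_insert_of_mem hi)
    rw [Finset.sum_insert ha, Finset.sum_insert ha,
      evalF_add (hK a (Finset.mem_insert_self _ _)) (Conv.sum hρ hs) hz, ih hs]

theorem evalF_zero (K : MvPowerSeries σ ℂ) : evalF K 0 = coeff 0 K := by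
  rw [evalF, tsum_eq_single 0]
  · simp
  · intro α hα
    obtain ⟨i, hi⟩ : ∃ i, α i ≠ 0 := by
      by_contra! h
      exact hα (Finsupp.ext h)
    rw [Finset.prod_eq_zero (Finset.mem_univ i) (by simp [hi]), mul_zero]

theorem hasFDerivAt_prod_pow (z : σ → ℂ) (α : σ →₀ ℕ) :
    HasFDerivAt (fun z : σ → ℂ => ∏ i, z i ^ α i)
      (∑ i, ((α i : ℂ) * ∏ j, z j ^ (α - Finsupp.single i 1 : σ →₀ ℕ) j) •
        (ContinuousLinearMap.proj i : (σ → ℂ) →L[ℂ] ℂ)) z := by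
  have h := HasFDerivAt.finsetProd (u := Finset.univ) (x := z)
    (g := fun i (z : σ → ℂ) => z i ^ α i)
    (g' := fun i => ((α i : ℂ) * z i ^ (α i - 1)) • (ContinuousLinearMap.proj i : (σ → ℂ) →L[ℂ] ℂ))
    fun i _ => (hasFDerivAt_apply i z).pow (α i) |>.congr_fderiv (by simp [mul_comm])
  refine h.congr_fderiv (Finset.sum_congr rfl fun i _ => ?_)
  rw [smul_smul]
  congr 1
  rw [← Finset.mul_prod_erase Finset.univ _ (Finset.mem_univ i)]
  have : ∀ j ∈ Finset.univ.erase i, z j ^ (α - Finsupp.single i 1 : σ →₀ ℕ) j = z j ^ α j := by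
    intro j hj
    rw [Finsupp.tsub_apply, Finsupp.single_eq_of_ne (Finset.ne_of_mem_erase hj), tsub_zero]
  rw [Finset.prod_congr rfl this]
  simp only [Finsupp.tsub_apply, Finsupp.single_eq_same]
  ring

theorem hasFDerivAt_evalF {ρ : ℝ} (hρ : 0 < ρ) {K : MvPowerSeries σ ℂ} (hK : Conv ρ K)
    {z : σ → ℂ} (hz : ‖z‖ < ρ / 2) :
    ∃ K' : (σ → ℂ) →L[ℂ] ℂ, HasFDerivAt (evalF K) K' z ∧
      ∀ i, K' (Pi.single i 1) = evalF (MvPowerSeries.pderiv ℂ i K) z := by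
  have hu : Summable fun α : σ →₀ ℕ => ρ⁻¹ * (‖coeff α K‖ * ρ ^ α.degree) := hK.mul_left _
  set L : (σ →₀ ℕ) → (σ → ℂ) → (σ → ℂ) →L[ℂ] ℂ := fun α z =>
    coeff α K • ∑ i, ((α i : ℂ) * ∏ j, z j ^ (α - Finsupp.single i 1 : σ →₀ ℕ) j) •
      (ContinuousLinearMap.proj i : (σ → ℂ) →L[ℂ] ℂ) with hL
  have hb : ∀ α, ∀ z ∈ Metric.ball (0 : σ → ℂ) (ρ / 2),
      ‖L α z‖ ≤ ρ⁻¹ * (‖coeff α K‖ * ρ ^ α.degree) := by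
    intro α z hz
    rw [mem_ball_zero_iff] at hz
    have h1 : ∀ i, ‖((α i : ℂ) * ∏ j, z j ^ (α - Finsupp.single i 1 : σ →₀ ℕ) j) •
        (ContinuousLinearMap.proj i : (σ → ℂ) →L[ℂ] ℂ)‖ ≤ α i * (ρ / 2) ^ (α.degree - 1) := by
      intro i
      by_cases hi : α i = 0
      · rw [norm_smul, hi, Nat.cast_zero, zero_mul, norm_zero, zero_mul, Nat.cast_zero, zero_mul]
      obtain ⟨γ, rfl⟩ := exists_eq_add_single hi
      have hp : ‖(ContinuousLinearMap.proj i : (σ → ℂ) →L[ℂ] ℂ)‖ ≤ 1 :=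
        ContinuousLinearMap.opNorm_le_bound _ zero_le_one fun v => by
          rw [one_mul]
          exact norm_le_pi_norm v i
      rw [norm_smul, norm_mul, Complex.norm_natCast, add_tsub_cancel_right, map_add,
        Finsupp.degree_single, add_tsub_cancel_right]
      calc _ ≤ ((γ + Finsupp.single i 1 : σ →₀ ℕ) i : ℝ) * (ρ / 2) ^ γ.degree * 1 := by
            gcongr
            exact norm_prod_pow_le hz.le γ
        _ = _ := mul_one _
    have h2 : (α.degree : ℝ) * (ρ / 2) ^ (α.degree - 1) ≤ ρ⁻¹ * ρ ^ α.degree := by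
      cases hd : α.degree with
      | zero => simpa using hρ.le
      | succ k =>
        have h3 : ((k + 1 : ℕ) : ℝ) ≤ 2 ^ k := by exact_mod_cast Nat.lt_two_pow_self
        rw [add_tsub_cancel_right, div_pow, pow_succ ρ k]
        calc ((k + 1 : ℕ) : ℝ) * (ρ ^ k / 2 ^ k) ≤ 2 ^ k * (ρ ^ k / 2 ^ k) := by gcongr
          _ = ρ⁻¹ * (ρ ^ k * ρ) := by field_simp
    rw [hL, norm_smul]
    calc _ ≤ ‖coeff α K‖ * ∑ i, (α i : ℝ) * (ρ / 2) ^ (α.degree - 1) := by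
          gcongr
          exact norm_sum_le_of_le _ fun i _ => h1 i
      _ = ‖coeff α K‖ * ((α.degree : ℝ) * (ρ / 2) ^ (α.degree - 1)) := by
          rw [← Finset.sum_mul, Finsupp.degree_eq_sum, Nat.cast_sum]
      _ ≤ ‖coeff α K‖ * (ρ⁻¹ * ρ ^ α.degree) := by gcongr
      _ = _ := by ring
  have hzb : z ∈ Metric.ball (0 : σ → ℂ) (ρ / 2) := mem_ball_zero_iff.2 hz
  have hzρ : ‖z‖ ≤ ρ := by linarith
  refine ⟨∑' α, L α z, hasFDerivAt_tsum_of_isPreconnected hu Metric.isOpen_ball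
    (convex_ball _ _).isPreconnected (fun α x _ => (hasFDerivAt_prod_pow x α).const_mul _) hb hzb
    (hK.summable hzρ) hzb, fun i => ?_⟩
  have hsL : Summable fun α => L α z := Summable.of_norm_bounded hu fun α => hb α z hzb
  have happ : (∑' α, L α z) (Pi.single i 1) = ∑' α, L α z (Pi.single i 1) :=
    (ContinuousLinearMap.apply ℂ ℂ (Pi.single i 1 : σ → ℂ)).map_tsum hsL
  have hval : ∀ α, L α z (Pi.single i 1) =
      coeff α K * ((α i : ℂ) * ∏ j, z j ^ (α - Finsupp.single i 1 : σ →₀ ℕ) j) := by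
    intro α
    simp only [hL, smul_apply, sum_apply,
      ContinuousLinearMap.proj_apply, smul_eq_mul]
    rw [Finset.sum_eq_single i]
    · simp
    · intro j _ hj
      rw [Pi.single_eq_of_ne hj, mul_zero]
    · simp
  have hinj : Function.Injective fun γ : σ →₀ ℕ => γ + Finsupp.single i 1 := add_left_injective _
  rw [happ, evalF, ← hinj.tsum_eq (f := fun α => L α z (Pi.single i 1))]
  · refine tsum_congr fun γ => ?_
    rw [hval, coeff_pderiv, add_tsub_cancel_right]
    simp only [Finsupp.add_apply, Finsupp.single_eq_same, Nat.cast_add, Nat.cast_one]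
    ring
  · intro α hα
    by_contra h
    refine hα ?_
    have : α i = 0 := by
      by_contra h'
      obtain ⟨γ, rfl⟩ := exists_eq_add_single h'
      exact h ⟨γ, rfl⟩
    simp [hval, this]

/-- A convergent power series vanishing on a germ of a coordinate subspace has vanishing
coefficients there. -/
theorem mem_expZero_of_eventually {T : Set σ} {K : MvPowerSeries σ ℂ} {ρ : ℝ} (hρ : 0 < ρ)
    (hK : Conv ρ K) (h : ∀ᶠ z in 𝓝 (0 : σ → ℂ), (∀ i ∈ T, z i = 0) → evalF K z = 0) :
    K ∈ coeffIdeal (expZero T) := by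
  intro α hα
  induction hd : α.degree generalizing α K ρ with
  | zero =>
    rw [(Finsupp.degree_eq_zero_iff α).1 hd, ← evalF_zero]
    exact h.self_of_nhds fun _ _ => rfl
  | succ k ih =>
    obtain ⟨i, hi⟩ : ∃ i, α i ≠ 0 := by
      by_contra! h'
      rw [show α = 0 from Finsupp.ext h', map_zero] at hd
      exact absurd hd (Nat.succ_ne_zero k).symm
    have hiT : i ∉ T := fun hiT => hi (hα i hiT)
    obtain ⟨γ, rfl⟩ := exists_eq_add_single hi
    have hγ : coeff γ (MvPowerSeries.pderiv ℂ i K) = 0 := by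
      refine ih (half_pos hρ) (hK.pderiv hρ i) ?_ γ ((expZero T).lower le_self_add hα) ?_
      · have hball : ∀ᶠ z in 𝓝 (0 : σ → ℂ), ‖z‖ < ρ / 2 := by
          filter_upwards [Metric.ball_mem_nhds (0 : σ → ℂ) (half_pos hρ)] with z hz
          exact mem_ball_zero_iff.1 hz
        filter_upwards [eventually_eventually_nhds.2 h, hball] with z hz hzρ hzT
        obtain ⟨K', hK', hK'i⟩ := hasFDerivAt_evalF hρ hK hzρ
        have hline : HasDerivAt (fun u : ℂ => z + u • (Pi.single i 1 : σ → ℂ))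
            (Pi.single i 1) 0 := by
          simpa using ((hasDerivAt_id (0 : ℂ)).smul_const (Pi.single i 1 : σ → ℂ)).const_add z
        have h0 : z + (0 : ℂ) • (Pi.single i 1 : σ → ℂ) = z := by simp
        have hcomp := HasFDerivAt.comp_hasDerivAt (0 : ℂ) (by rwa [h0]) hline
          (l := evalF K) (l' := K')
        have hzero : (evalF K ∘ fun u : ℂ => z + u • (Pi.single i 1 : σ → ℂ)) =ᶠ[𝓝 0]
            fun _ => (0 : ℂ) := by
          have ht : Tendsto (fun u : ℂ => z + u • (Pi.single i 1 : σ → ℂ)) (𝓝 0) (𝓝 z) := by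
            simpa [h0] using hline.continuousAt.tendsto
          filter_upwards [ht.eventually hz] with u hu
          refine hu fun j hj => ?_
          have hji : j ≠ i := by
            rintro rfl
            exact hiT hj
          simp [hzT j hj, Pi.single_eq_of_ne hji]
        rw [← hK'i]
        exact hcomp.unique ((hasDerivAt_const (0 : ℂ) (0 : ℂ)).congr_of_eventuallyEq hzero)
      · simpa using hd
    rw [coeff_pderiv] at hγ
    have h3 : (γ i : ℂ) + 1 ≠ 0 := by exact_mod_cast Nat.succ_ne_zero (γ i)
    exact (mul_eq_zero.1 hγ).resolve_right h3

theorem eq_zero_of_eventually {K : MvPowerSeries σ ℂ} {ρ : ℝ} (hρ : 0 < ρ)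
    (hK : Conv ρ K) (h : ∀ᶠ z in 𝓝 (0 : σ → ℂ), evalF K z = 0) : K = 0 := by
  ext α
  exact mem_expZero_of_eventually (T := ∅) hρ hK (h.mono fun z hz _ => hz) α
    (by simp [mem_expZero])

theorem evalF_eq_zero_of_mem {T : Set σ} {K : MvPowerSeries σ ℂ}
    (hK : K ∈ coeffIdeal (expZero T)) {z : σ → ℂ} (hz : ∀ i ∈ T, z i = 0) : evalF K z = 0 := by
  rw [evalF]
  refine (tsum_congr fun α => ?_).trans tsum_zero
  by_cases hα : ∀ i ∈ T, α i = 0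
  · rw [hK α hα, zero_mul]
  · push Not at hα
    obtain ⟨i, hi, hαi⟩ := hα
    rw [Finset.prod_eq_zero (Finset.mem_univ i) (by simp [hz i hi, hαi]), mul_zero]

/-- Holomorphic germs are given by convergent power series. -/
theorem exists_evalF {f : (σ → ℂ) → ℂ} (hf : ∀ᶠ z in 𝓝 0, DifferentiableAt ℂ f z) :
    ∃ (ρ : ℝ) (_ : 0 < ρ) (K : MvPowerSeries σ ℂ), Conv ρ K ∧
      ∀ᶠ z in 𝓝 0, f z = evalF K z := by
  have hcont : ∀ᶠ z in 𝓝 (0 : σ → ℂ), ‖f z‖ < ‖f 0‖ + 1 :=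
    hf.self_of_nhds.continuousAt.norm.eventually (gt_mem_nhds (lt_add_one _))
  obtain ⟨R, hR, hball⟩ := Metric.eventually_nhds_iff_ball.1 (hf.and hcont)
  set M := ‖f 0‖ + 1
  have hM : 0 ≤ M := by positivity
  let e := Fintype.equivFin σ
  have hmem : ∀ z : Fin (Fintype.card σ) → ℂ, (∀ i, ‖z i‖ < R) →
      (fun i => z (e i)) ∈ Metric.ball (0 : σ → ℂ) R := fun z hz => by
    rw [mem_ball_zero_iff, pi_norm_lt_iff hR]
    exact fun i => hz _
  obtain ⟨c, hc, hs⟩ := exists_hasSum_fin (f := fun z => f fun i => z (e i)) hR (M := M)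
    (fun z hz => (hball _ (hmem z hz)).2.le) (fun z hz i u hu => by
      have hz' : ∀ j, ‖Function.update z i u j‖ < R := by
        intro j
        by_cases h : j = i
        · subst h
          simpa using hu
        · simpa [Function.update_of_ne h] using hz j
      have hd : DifferentiableAt ℂ (fun u (j : σ) => Function.update z i u (e j)) u := by
        rw [differentiableAt_pi]
        intro j
        by_cases h : e j = i
        · subst h
          simp
        · simp [Function.update_of_ne h]
      exact ((hball _ (hmem _ hz')).1.comp u hd).differentiableWithinAt)
  let E : (σ →₀ ℕ) ≃ (Fin (Fintype.card σ) → ℕ) :=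
    Finsupp.equivFunOnFinite.trans (e.arrowCongr (Equiv.refl ℕ))
  have hE : ∀ α i, E α (e i) = α i := fun α i => by simp [E]
  have hsum : ∀ α, ∑ i, E α i = α.degree := fun α => by
    rw [Finsupp.degree_eq_sum, ← e.sum_comp]
    exact Finset.sum_congr rfl fun i _ => hE α i
  have hsumm : Summable fun α : σ →₀ ℕ => ((1 : ℝ) / 2) ^ α.degree := by
    rw [← E.symm.summable_iff]
    refine (summable_prod_pow (fun _ : Fin (Fintype.card σ) => (1 : ℝ) / 2) (fun _ => by norm_num)
      fun _ => by norm_num).congr fun α => ?_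
    rw [Function.comp_apply, ← hsum, Equiv.apply_symm_apply, Finset.prod_pow_eq_pow_sum]
  refine ⟨R / 4, by positivity, seriesOf fun α => c (E α), ?_, ?_⟩
  · refine Summable.of_nonneg_of_le (fun α => by positivity) (fun α => ?_) (hsumm.mul_left M)
    rw [coeff_seriesOf]
    calc ‖c (E α)‖ * (R / 4) ^ α.degree ≤ M * (2 / R) ^ α.degree * (R / 4) ^ α.degree := by
          gcongr
          exact (hc _).trans_eq (by rw [hsum])
      _ = M * (1 / 2) ^ α.degree := by
          rw [mul_assoc, ← mul_pow]
          congr 2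
          field_simp
          norm_num
  · filter_upwards [Metric.ball_mem_nhds (0 : σ → ℂ) (half_pos hR)] with z hz
    rw [mem_ball_zero_iff] at hz
    have h := hs (fun i => z (e.symm i)) fun i => (norm_le_pi_norm z _).trans_lt hz
    simp only [Equiv.symm_apply_apply] at h
    rw [evalF, ← h.tsum_eq, ← E.tsum_eq]
    refine tsum_congr fun α => ?_
    rw [coeff_seriesOf, ← e.prod_comp]
    simp [hE]

end Evaluation

end

section

open Filter Topology MvPowerSeries

section MatrixEvaluation

variable {σ τ : Type*} [DecidableEq σ] [Fintype σ] {n : ℕ}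
  {E : Type*} [NormedAddCommGroup E] [NormedSpace ℂ E]

/-- The entrywise value of a matrix of power series at a point. -/
def evalM (A : Matrix (Fin n) (Fin n) (MvPowerSeries σ ℂ)) (z : σ → ℂ) : Mat n :=
  A.map fun K => evalF K z

theorem evalM_apply (A : Matrix (Fin n) (Fin n) (MvPowerSeries σ ℂ)) (z : σ → ℂ) (k j : Fin n) :
    evalM A z k j = evalF (A k j) z := rfl

theorem evalM_zero_left (z : σ → ℂ) :
    evalM (0 : Matrix (Fin n) (Fin n) (MvPowerSeries σ ℂ)) z = 0 := by
  ext k j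
  exact evalF_zero_left z

variable {ρ : ℝ} {A B : Matrix (Fin n) (Fin n) (MvPowerSeries σ ℂ)} {z : σ → ℂ}

theorem evalM_add (hA : ∀ k j, Conv ρ (A k j)) (hB : ∀ k j, Conv ρ (B k j)) (hz : ‖z‖ ≤ ρ) :
    evalM (A + B) z = evalM A z + evalM B z := by
  ext k j
  exact evalF_add (hA k j) (hB k j) hz

theorem evalM_sub (hA : ∀ k j, Conv ρ (A k j)) (hB : ∀ k j, Conv ρ (B k j)) (hz : ‖z‖ ≤ ρ) :
    evalM (A - B) z = evalM A z - evalM B z := by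
  ext k j
  exact evalF_sub (hA k j) (hB k j) hz

theorem evalM_mul (hρ : 0 < ρ) (hA : ∀ k j, Conv ρ (A k j)) (hB : ∀ k j, Conv ρ (B k j))
    (hz : ‖z‖ ≤ ρ) : evalM (A * B) z = evalM A z * evalM B z := by
  ext k j
  rw [evalM_apply, Matrix.mul_apply, Matrix.mul_apply,
    evalF_sum hρ _ (fun p _ => (hA k p).mul hρ (hB p j)) hz]
  exact Finset.sum_congr rfl fun p _ => evalF_mul (hA k p) (hB p j) hz

theorem conv_bracket (hρ : 0 < ρ) (hA : ∀ k j, Conv ρ (A k j)) (hB : ∀ k j, Conv ρ (B k j))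
    (k j : Fin n) : Conv ρ (⁅A, B⁆ k j) := by
  rw [Ring.lie_def]
  exact (conv_matrix_mul hρ hA hB k j).sub hρ (conv_matrix_mul hρ hB hA k j)

theorem evalM_bracket (hρ : 0 < ρ) (hA : ∀ k j, Conv ρ (A k j)) (hB : ∀ k j, Conv ρ (B k j))
    (hz : ‖z‖ ≤ ρ) : evalM ⁅A, B⁆ z = matComm (evalM A z) (evalM B z) := by
  rw [Ring.lie_def, evalM_sub (conv_matrix_mul hρ hA hB) (conv_matrix_mul hρ hB hA) hz,
    evalM_mul hρ hA hB hz, evalM_mul hρ hB hA hz, matComm]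

theorem eq_zero_of_eventually_evalM (hρ : 0 < ρ) (hA : ∀ k j, Conv ρ (A k j))
    (h : ∀ᶠ z in 𝓝 (0 : σ → ℂ), evalM A z = 0) : A = 0 := by
  ext1 k j
  exact eq_zero_of_eventually hρ (hA k j) (h.mono fun z hz => congrFun (congrFun hz k) j)

theorem mpderiv_evalM (hρ : 0 < ρ) (hA : ∀ k j, Conv ρ (A k j)) {ι : E → σ → ℂ} {p : E}
    {J : E →L[ℂ] σ → ℂ} (hι : HasFDerivAt ι J p) (hp : ‖ι p‖ < ρ / 2) {v : E} {b : σ} {c : ℂ}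
    (hv : J v = c • Pi.single b 1) (c' : ℂ) :
    mpderiv (fun q => c' • evalM A (ι q)) p v = (c' * c) • evalM (mpd n b A) (ι p) := by
  ext k j
  obtain ⟨K', hK', hKv⟩ := hasFDerivAt_evalF hρ (hA k j) hp
  have h : HasFDerivAt (fun q => (c' • evalM A (ι q)) k j) (c' • K'.comp J) p :=
    (hK'.comp p hι).const_smul c'
  rw [mpderiv, Matrix.of_apply, h.fderiv]
  simp only [smul_apply, ContinuousLinearMap.comp_apply, hv, map_smul, hKv, Matrix.smul_apply,
    evalM_apply, mpd_apply, smul_eq_mul]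
  ring

theorem differentiableAt_evalM (hρ : 0 < ρ) (hA : ∀ k j, Conv ρ (A k j)) {ι : E → σ → ℂ} {p : E}
    (hι : DifferentiableAt ℂ ι p) (hp : ‖ι p‖ < ρ / 2) (c : ℂ) (k j : Fin n) :
    DifferentiableAt ℂ (fun q => (c • evalM A (ι q)) k j) p := by
  obtain ⟨K', hK', -⟩ := hasFDerivAt_evalF hρ (hA k j) hp
  exact ((hK'.comp p hι.hasFDerivAt).const_smul c).differentiableAt

theorem eventually_norm_lt {ρ : ℝ} (hρ : 0 < ρ) : ∀ᶠ z in 𝓝 (0 : σ → ℂ), ‖z‖ < ρ :=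
  (continuous_norm.tendsto' 0 0 norm_zero).eventually (gt_mem_nhds hρ)

theorem eventually_evalM_mpd (hρ : 0 < ρ) (hA : ∀ k j, Conv ρ (A k j)) (T : (σ → ℂ) →L[ℂ] E)
    {M : E → Mat n} (hM : ∀ᶠ x in 𝓝 (0 : E), ∀ k j, DifferentiableAt ℂ (fun q => M q k j) x)
    (h : ∀ᶠ z in 𝓝 (0 : σ → ℂ), M (T z) = evalM A z) (b : σ) :
    ∀ᶠ z in 𝓝 (0 : σ → ℂ), evalM (mpd n b A) z = mpderiv M (T z) (T (Pi.single b 1)) := by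
  filter_upwards [h.eventually_nhds, (T.continuous.tendsto' 0 0 (map_zero T)).eventually hM,
    eventually_norm_lt (half_pos hρ)] with z hz hd hn
  ext k j
  obtain ⟨K', hK', hKv⟩ := hasFDerivAt_evalF hρ (hA k j) hn
  have h1 : HasFDerivAt (fun z => M (T z) k j)
      ((fderiv ℂ (fun q => M q k j) (T z)).comp T) z :=
    (hd k j).hasFDerivAt.comp z T.hasFDerivAt
  have h2 : HasFDerivAt (fun z => M (T z) k j) K' z :=
    hK'.congr_of_eventuallyEq (hz.mono fun x hx => congrFun (congrFun hx k) j)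
  rw [evalM_apply, mpd_apply, ← hKv, h2.unique h1]
  rfl

theorem exists_evalF_family {ι : Type*} [Finite ι] {f : ι → (σ → ℂ) → ℂ}
    (hf : ∀ i, ∀ᶠ z in 𝓝 0, DifferentiableAt ℂ (f i) z) :
    ∃ (ρ : ℝ) (_ : 0 < ρ) (K : ι → MvPowerSeries σ ℂ), (∀ i, Conv ρ (K i)) ∧
      ∀ᶠ z in 𝓝 0, ∀ i, f i z = evalF (K i) z := by
  choose ρ hρ K hK hf using fun i => exists_evalF (hf i)
  have h : ∀ᶠ ε in 𝓝[>] (0 : ℝ), ∀ i, ε ≤ ρ i :=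
    eventually_all.2 fun i => nhdsWithin_le_nhds (Iic_mem_nhds (hρ i))
  obtain ⟨ε, hε, hε0⟩ := (h.and self_mem_nhdsWithin).exists
  exact ⟨ε, hε0, K, fun i => (hK i).mono (le_of_lt hε0) (hε i), eventually_all.2 hf⟩

theorem exists_evalM_family {ι : Type*} [Finite ι] (T : (σ → ℂ) →L[ℂ] E) {M : ι → E → Mat n}
    (hM : ∀ i, ∀ᶠ x in 𝓝 (0 : E), ∀ k j, DifferentiableAt ℂ (fun q => M i q k j) x) :
    ∃ (ρ : ℝ) (_ : 0 < ρ) (A : ι → Matrix (Fin n) (Fin n) (MvPowerSeries σ ℂ)),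
      (∀ i k j, Conv ρ (A i k j)) ∧ ∀ᶠ z in 𝓝 0, ∀ i, M i (T z) = evalM (A i) z := by
  obtain ⟨ρ, hρ, K, hK, h⟩ := exists_evalF_family
    (f := fun (x : ι × Fin n × Fin n) z => M x.1 (T z) x.2.1 x.2.2) fun x => by
      filter_upwards [(T.continuous.tendsto' 0 0 (map_zero T)).eventually (hM x.1)] with z hz
      exact (hz x.2.1 x.2.2).comp z T.differentiableAt
  refine ⟨ρ, hρ, fun i => Matrix.of fun k j => K (i, k, j), fun i k j => hK (i, k, j), ?_⟩
  filter_upwards [h] with z hz i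
  ext k j
  exact hz (i, k, j)

section Constraints

variable {C : τ → Matrix (Fin n) (Fin n) (MvPowerSeries σ ℂ)}
  {U V W : Matrix (Fin n) (Fin n) (MvPowerSeries σ ℂ)} {e : τ → σ}

theorem conv_mpd (hρ : 0 < ρ) (hA : ∀ k j, Conv ρ (A k j)) (b : σ) (k j : Fin n) :
    Conv (ρ / 2) (mpd n b A k j) := (hA k j).pderiv hρ b

/-- Formal flatness constraints follow from the corresponding identities of germs. -/
theorem constraints_bot_of_eventually (hρ : 0 < ρ)
    (hC : ∀ a k j, Conv ρ (C a k j)) (hU : ∀ k j, Conv ρ (U k j)) (hV : ∀ k j, Conv ρ (V k j))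
    (hW : ∀ k j, Conv ρ (W k j))
    (h1 : ∀ a b, ∀ᶠ z in 𝓝 (0 : σ → ℂ), matComm (evalM (C a) z) (evalM (C b) z) = 0)
    (h2 : ∀ a, ∀ᶠ z in 𝓝 (0 : σ → ℂ), matComm (evalM (C a) z) (evalM U z) = 0)
    (h3 : ∀ a b, ∀ᶠ z in 𝓝 (0 : σ → ℂ),
      evalM (mpd n (e b) (C a)) z = evalM (mpd n (e a) (C b)) z)
    (h4 : ∀ a, ∀ᶠ z in 𝓝 (0 : σ → ℂ),
      evalM (mpd n (e a) U) z = matComm (evalM V z) (evalM (C a) z) - evalM (C a) z)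
    (h5 : ∀ a, ∀ᶠ z in 𝓝 (0 : σ → ℂ),
      evalM (mpd n (e a) W) z = matComm (evalM W z) (evalM (C a) z))
    (h6 : ∀ a, ∀ᶠ z in 𝓝 (0 : σ → ℂ),
      evalM (mpd n (e a) V) z = -matComm (evalM W z) (evalM (C a) z)) :
    Constraints (fun a => mpd n (e a)) C U V W ⊥ := by
  have hρ2 := half_pos hρ
  have hle := half_le_self hρ.le
  have half : ∀ {A : Matrix (Fin n) (Fin n) (MvPowerSeries σ ℂ)}, (∀ k j, Conv ρ (A k j)) →
      ∀ k j, Conv (ρ / 2) (A k j) := fun hA k j => (hA k j).mono hρ2.le hle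
  have hsmall := eventually_norm_lt (σ := σ) hρ2
  refine ⟨fun a b => ?_, fun a => ?_, fun a b => ?_, fun a => ?_, fun a => ?_, fun a => ?_⟩ <;>
    rw [AddSubgroup.mem_bot]
  · refine eq_zero_of_eventually_evalM hρ (conv_bracket hρ (hC a) (hC b)) ?_
    filter_upwards [h1 a b, hsmall] with z hz hn
    rw [evalM_bracket hρ (hC a) (hC b) (hn.le.trans hle), hz]
  · refine eq_zero_of_eventually_evalM hρ (conv_bracket hρ (hC a) hU) ?_
    filter_upwards [h2 a, hsmall] with z hz hn
    rw [evalM_bracket hρ (hC a) hU (hn.le.trans hle), hz]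
  · refine eq_zero_of_eventually_evalM hρ2
      (fun k j => (conv_mpd hρ (hC a) _ k j).sub hρ2 (conv_mpd hρ (hC b) _ k j)) ?_
    filter_upwards [h3 a b, hsmall] with z hz hn
    rw [evalM_sub (conv_mpd hρ (hC a) _) (conv_mpd hρ (hC b) _) hn.le, hz, sub_self]
  · have hb := conv_bracket hρ2 (half hV) (half (hC a))
    have hs : ∀ k j, Conv (ρ / 2) ((mpd n (e a) U - ⁅V, C a⁆) k j) :=
      fun k j => (conv_mpd hρ hU _ k j).sub hρ2 (hb k j)
    refine eq_zero_of_eventually_evalM hρ2 (fun k j => (hs k j).add hρ2 (half (hC a) k j)) ?_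
    filter_upwards [h4 a, hsmall] with z hz hn
    rw [evalM_add hs (half (hC a)) hn.le, evalM_sub (conv_mpd hρ hU _) hb hn.le, hz,
      evalM_bracket hρ2 (half hV) (half (hC a)) hn.le]
    abel
  · have hb := conv_bracket hρ2 (half hW) (half (hC a))
    refine eq_zero_of_eventually_evalM hρ2
      (fun k j => (conv_mpd hρ hW _ k j).sub hρ2 (hb k j)) ?_
    filter_upwards [h5 a, hsmall] with z hz hn
    rw [evalM_sub (conv_mpd hρ hW _) hb hn.le, hz,
      evalM_bracket hρ2 (half hW) (half (hC a)) hn.le, sub_self]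
  · have hb := conv_bracket hρ2 (half hW) (half (hC a))
    refine eq_zero_of_eventually_evalM hρ2
      (fun k j => (conv_mpd hρ hV _ k j).add hρ2 (hb k j)) ?_
    filter_upwards [h6 a, hsmall] with z hz hn
    rw [evalM_add (conv_mpd hρ hV _) hb hn.le, hz,
      evalM_bracket hρ2 (half hW) (half (hC a)) hn.le, neg_add_cancel]

/-- Values of power series satisfying the formal flatness constraints satisfy them pointwise. -/
theorem Constraints.pointwise (hρ : 0 < ρ) (h : Constraints (fun a => mpd n (e a)) C U V W ⊥)
    (hC : ∀ a k j, Conv ρ (C a k j)) (hU : ∀ k j, Conv ρ (U k j)) (hV : ∀ k j, Conv ρ (V k j))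
    (hW : ∀ k j, Conv ρ (W k j)) (hz : ‖z‖ ≤ ρ) :
    (∀ a b, matComm (evalM (C a) z) (evalM (C b) z) = 0) ∧
    (∀ a, matComm (evalM (C a) z) (evalM U z) = 0) ∧
    (∀ a b, evalM (mpd n (e b) (C a)) z = evalM (mpd n (e a) (C b)) z) ∧
    (∀ a, evalM (mpd n (e a) U) z =
      matComm (evalM V z) (evalM (C a) z) - evalM (C a) z) ∧
    (∀ a, evalM (mpd n (e a) W) z = matComm (evalM W z) (evalM (C a) z)) ∧
    (∀ a, evalM (mpd n (e a) V) z = -matComm (evalM W z) (evalM (C a) z)) := by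
  refine ⟨fun a b => ?_, fun a => ?_, fun a b => ?_, fun a => ?_, fun a => ?_, fun a => ?_⟩
  · rw [← evalM_bracket hρ (hC a) (hC b) hz, AddSubgroup.mem_bot.1 (h.comm a b), evalM_zero_left]
  · rw [← evalM_bracket hρ (hC a) hU hz, AddSubgroup.mem_bot.1 (h.commU a), evalM_zero_left]
  · rw [sub_eq_zero.1 (AddSubgroup.mem_bot.1 (h.closed a b))]
  · have h1 := AddSubgroup.mem_bot.1 (h.derivU a)
    rw [sub_add, sub_eq_zero] at h1
    rw [h1, evalM_sub (conv_bracket hρ hV (hC a)) (hC a) hz, evalM_bracket hρ hV (hC a) hz]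
  · rw [sub_eq_zero.1 (AddSubgroup.mem_bot.1 (h.derivW a)), evalM_bracket hρ hW (hC a) hz]
  · have h1 := eq_neg_of_add_eq_zero_left (AddSubgroup.mem_bot.1 (h.derivV a))
    have h2 : evalM (-⁅W, C a⁆) z = -evalM ⁅W, C a⁆ z := by
      ext k j
      exact evalF_neg _ _
    rw [h1, h2, evalM_bracket hρ hW (hC a) hz]

end Constraints

end MatrixEvaluation

end

section

open Filter Topology MvPowerSeries

section Assembly

variable {m l n : ℕ} {E : Type*} [NormedAddCommGroup E] [NormedSpace ℂ E]

theorem exists_words {C : Fin m → Mat n} {U : Mat n} {j₀ : Fin n}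
    (h : GenCond (Fin.snoc C U) (Pi.single j₀ 1)) :
    ∃ (w : Fin n → List (Option (Fin m))) (Q : Mat n), Q * colMat C U w j₀ = 1 := by
  set b₀ := Module.Basis.ofSpan h.ge with hb₀
  let b := b₀.reindex (b₀.indexEquiv (Pi.basisFun ℂ (Fin n)))
  have hmem : ∀ j, ∃ L : List (Fin (m + 1)),
      b j = Matrix.mulVec (L.map (Fin.snoc C U : Fin (m + 1) → Mat n)).prod (Pi.single j₀ 1) := by
    intro j
    have : b j ∈ Set.range b₀ := by
      rw [Module.Basis.reindex_apply]
      exact Set.mem_range_self _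
    exact Module.Basis.ofSpan_subset h.ge this
  choose L hL using hmem
  let φ : Fin (m + 1) → Option (Fin m) := Fin.lastCases none some
  have hφ : ∀ i, (φ i).elim U C = (Fin.snoc C U : Fin (m + 1) → Mat n) i := by
    intro i
    induction i using Fin.lastCases with
    | last => simp [φ]
    | cast i => simp [φ]
  refine ⟨fun j => (L j).map φ, b.toMatrix (Pi.basisFun ℂ (Fin n)), ?_⟩
  convert! b.toMatrix_mul_toMatrix_flip (Pi.basisFun ℂ (Fin n)) using 2
  ext k j
  rw [Module.Basis.toMatrix_apply, Pi.basisFun_repr, hL j, Matrix.mulVec_single_one, colMat,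
    Matrix.of_apply, wordMat, List.map_map, Matrix.col_apply]
  exact congrArg (fun X : List (Mat n) => X.prod k j₀) (List.map_congr_left fun i _ => hφ i)

theorem mpderiv_zero_right (M : E → Mat n) (p : E) : mpderiv M p 0 = 0 := by
  ext k j
  simp [mpderiv]

theorem mpderiv_zero_left (p v : E) : mpderiv (0 : E → Mat n) p v = 0 := by
  ext k j
  simp [mpderiv]

theorem MDiffOn.eventually {M : E → Mat n} {s : Set E} (h : MDiffOn M s) (hs : s ∈ 𝓝 (0 : E)) :
    ∀ᶠ x in 𝓝 (0 : E), ∀ k j, DifferentiableAt ℂ (fun q => M q k j) x := by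
  filter_upwards [eventually_eventually_nhds.2 hs] with x hx k j
  exact (h k j).differentiableAt hx

/-- Projection to the parameters `t`. -/
def projT (m l : ℕ) : (Option (Fin m ⊕ Fin l) → ℂ) →L[ℂ] Fin m → ℂ :=
  ContinuousLinearMap.pi fun i => ContinuousLinearMap.proj (some (Sum.inl i))

theorem projT_apply (z : Option (Fin m ⊕ Fin l) → ℂ) (i : Fin m) :
    projT m l z i = z (some (Sum.inl i)) := rfl

theorem projT_single_none : projT m l (Pi.single none 1) = 0 := by
  ext i
  rw [projT_apply, Pi.single_eq_of_ne (by simp)]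
  rfl

theorem projT_single_some (a : Fin m ⊕ Fin l) :
    projT m l (Pi.single (some a) 1) = Sum.elim (fun i => Pi.single i 1) (fun _ => 0) a := by
  ext i
  rw [projT_apply]
  rcases a with j | α
  · by_cases h : i = j
    · subst h
      simp
    · rw [Pi.single_eq_of_ne (by simpa using h), Sum.elim_inl, Pi.single_eq_of_ne h]
  · rw [Pi.single_eq_of_ne (by simp)]
    rfl

/-- The blow-up `(s, t, y) ↦ (t, s y)`. -/
def scaleMap (m l : ℕ) (z : Option (Fin m ⊕ Fin l) → ℂ) : Pt m l :=
  (projT m l z, fun α => z none * z (some (Sum.inr α)))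

theorem differentiable_scaleMap : Differentiable ℂ (scaleMap m l) := by
  refine (projT m l).differentiable.prodMk (differentiable_pi.2 fun α => ?_)
  exact (differentiable_apply _).mul (differentiable_apply _)

theorem scaleMap_zero : scaleMap m l 0 = 0 := by
  rw [scaleMap, map_zero]
  ext <;> simp

/-- The linear part of the section `(t, y) ↦ (c, t, c⁻¹ y)` of the blow-up. -/
def sectionLin (m l : ℕ) (c : ℂ) : Pt m l →L[ℂ] Option (Fin m ⊕ Fin l) → ℂ :=
  ContinuousLinearMap.pi fun o => o.elim 0 <| Sum.elim
    (fun i => (ContinuousLinearMap.proj i : (Fin m → ℂ) →L[ℂ] ℂ).comp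
      (ContinuousLinearMap.fst ℂ (Fin m → ℂ) (Fin l → ℂ)))
    (fun α => c⁻¹ • (ContinuousLinearMap.proj α : (Fin l → ℂ) →L[ℂ] ℂ).comp
      (ContinuousLinearMap.snd ℂ (Fin m → ℂ) (Fin l → ℂ)))

/-- The section `(t, y) ↦ (c, t, c⁻¹ y)` of the blow-up. -/
def sectionMap (m l : ℕ) (c : ℂ) (p : Pt m l) : Option (Fin m ⊕ Fin l) → ℂ :=
  Pi.single none c + sectionLin m l c p

theorem hasFDerivAt_sectionMap (c : ℂ) (p : Pt m l) :
    HasFDerivAt (sectionMap m l c) (sectionLin m l c) p :=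
  (sectionLin m l c).hasFDerivAt.const_add _

theorem sectionMap_none (c : ℂ) (p : Pt m l) : sectionMap m l c p none = c := by
  simp [sectionMap, sectionLin]

theorem sectionMap_inl (c : ℂ) (p : Pt m l) (i : Fin m) :
    sectionMap m l c p (some (Sum.inl i)) = p.1 i := by
  simp [sectionMap, sectionLin]

theorem sectionMap_inr (c : ℂ) (p : Pt m l) (α : Fin l) :
    sectionMap m l c p (some (Sum.inr α)) = c⁻¹ * p.2 α := by
  simp [sectionMap, sectionLin]

theorem projT_sectionMap (c : ℂ) (p : Pt m l) : projT m l (sectionMap m l c p) = p.1 := by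
  ext i
  rw [projT_apply, sectionMap_inl]

theorem scaleMap_sectionMap {c : ℂ} (hc : c ≠ 0) (p : Pt m l) :
    scaleMap m l (sectionMap m l c p) = p := by
  refine Prod.ext (projT_sectionMap c p) (funext fun α => ?_)
  simp only [scaleMap, sectionMap_none, sectionMap_inr, mul_inv_cancel_left₀ hc]

theorem norm_sectionMap_zero (c : ℂ) : ‖sectionMap m l c 0‖ = ‖c‖ := by
  rw [sectionMap, map_zero, add_zero, Pi.norm_single]

theorem sectionLin_apply_direction (c : ℂ) (a : Fin m ⊕ Fin l) :
    sectionLin m l c (Sum.elim (fun i => (Pi.single i 1, 0)) (fun α => (0, Pi.single α 1)) a) =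
      (Sum.elim (fun _ => 1) (fun _ => c⁻¹) a : ℂ) • Pi.single (some a) 1 := by
  ext o
  rcases o with _ | b
  · simp [sectionLin]
  · rcases a with j | β <;> rcases b with i | α <;> simp [sectionLin, Pi.single_apply]

theorem matComm_smul (x y : ℂ) (A B : Mat n) :
    matComm (x • A) (y • B) = (x * y) • matComm A B := by
  simp only [matComm, smul_mul_smul_comm, smul_sub, mul_comm y x]

theorem matComm_smul_left (x : ℂ) (A B : Mat n) : matComm (x • A) B = x • matComm A B := by
  simp only [matComm, smul_mul_assoc, mul_smul_comm, smul_sub]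

theorem matComm_smul_right (x : ℂ) (A B : Mat n) : matComm A (x • B) = x • matComm A B := by
  simp only [matComm, smul_mul_assoc, mul_smul_comm, smul_sub]

/-- A germ of a flat connection is given by convergent power series satisfying the formal
constraints. -/
theorem exists_initial_series {N₀ : Set (Fin m → ℂ)} (hN₀ : N₀ ∈ 𝓝 (0 : Fin m → ℂ)) (l : ℕ)
    {C₀ : Fin m → (Fin m → ℂ) → Mat n} {U₀ V₀ W₀ : (Fin m → ℂ) → Mat n}
    (hC₀d : ∀ i, MDiffOn (C₀ i) N₀)
    (hU₀d : MDiffOn U₀ N₀) (hV₀d : MDiffOn V₀ N₀) (hW₀d : MDiffOn W₀ N₀)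
    (h1 : ∀ t ∈ N₀, ∀ i j, matComm (C₀ i t) (C₀ j t) = 0)
    (h2 : ∀ t ∈ N₀, ∀ i j,
      mpderiv (C₀ i) t (Pi.single j 1) = mpderiv (C₀ j) t (Pi.single i 1))
    (h3 : ∀ t ∈ N₀, ∀ i, matComm (C₀ i t) (U₀ t) = 0)
    (h4 : ∀ t ∈ N₀, ∀ i,
      mpderiv U₀ t (Pi.single i 1) = matComm (V₀ t) (C₀ i t) - C₀ i t)
    (h5 : ∀ t ∈ N₀, ∀ i, mpderiv W₀ t (Pi.single i 1) = matComm (W₀ t) (C₀ i t))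
    (h6 : ∀ t ∈ N₀, ∀ i, mpderiv V₀ t (Pi.single i 1) = - matComm (W₀ t) (C₀ i t)) :
    ∃ (ρ : ℝ) (_ : 0 < ρ)
      (C : Fin m → Matrix (Fin n) (Fin n) (MvPowerSeries (Option (Fin m ⊕ Fin l)) ℂ))
      (U V W : Matrix (Fin n) (Fin n) (MvPowerSeries (Option (Fin m ⊕ Fin l)) ℂ)),
      (∀ i k j, Conv ρ (C i k j)) ∧ (∀ k j, Conv ρ (U k j)) ∧ (∀ k j, Conv ρ (V k j)) ∧
      (∀ k j, Conv ρ (W k j)) ∧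
      (∀ i, mpd n none (C i) = 0) ∧ mpd n none U = 0 ∧ mpd n none V = 0 ∧ mpd n none W = 0 ∧
      Constraints (fun a : Fin m ⊕ Fin l => mpd n (some a)) (Sum.elim C 0) U V W ⊥ ∧
      ∀ᶠ z in 𝓝 0, (∀ i, C₀ i (projT m l z) = evalM (C i) z) ∧ U₀ (projT m l z) = evalM U z ∧
        V₀ (projT m l z) = evalM V z ∧ W₀ (projT m l z) = evalM W z := by
  have hdC := fun i => (hC₀d i).eventually hN₀
  have hdU := hU₀d.eventually hN₀
  have hdV := hV₀d.eventually hN₀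
  have hdW := hW₀d.eventually hN₀
  obtain ⟨ρ, hρ, A, hA, hAe⟩ := exists_evalM_family (projT m l)
    (M := (Sum.elim C₀ ![U₀, V₀, W₀] : Fin m ⊕ Fin 3 → (Fin m → ℂ) → Mat n)) (by
      rintro (i | x)
      · exact hdC i
      · fin_cases x
        exacts [hdU, hdV, hdW])
  set T := projT m l with hT
  have hTt : Tendsto T (𝓝 0) (𝓝 0) := T.continuous.tendsto' 0 0 (map_zero T)
  have hN : ∀ᶠ z in 𝓝 0, T z ∈ N₀ := hTt.eventually hN₀
  set C := fun i => A (Sum.inl i) with hC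
  set U := A (Sum.inr 0) with hU
  set V := A (Sum.inr 1) with hV
  set W := A (Sum.inr 2) with hW
  have heC : ∀ i, ∀ᶠ z in 𝓝 0, C₀ i (T z) = evalM (C i) z := fun i =>
    hAe.mono fun z hz => hz (Sum.inl i)
  have heU : ∀ᶠ z in 𝓝 0, U₀ (T z) = evalM U z := hAe.mono fun z hz => hz (Sum.inr 0)
  have heV : ∀ᶠ z in 𝓝 0, V₀ (T z) = evalM V z := hAe.mono fun z hz => hz (Sum.inr 1)
  have heW : ∀ᶠ z in 𝓝 0, W₀ (T z) = evalM W z := hAe.mono fun z hz => hz (Sum.inr 2)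
  have hnone : ∀ {M : (Fin m → ℂ) → Mat n}
      {B : Matrix (Fin n) (Fin n) (MvPowerSeries (Option (Fin m ⊕ Fin l)) ℂ)},
      (∀ k j, Conv ρ (B k j)) →
      (∀ᶠ x in 𝓝 (0 : Fin m → ℂ), ∀ k j, DifferentiableAt ℂ (fun q => M q k j) x) →
      (∀ᶠ z in 𝓝 0, M (T z) = evalM B z) → mpd n none B = 0 := by
    intro M B hB hM he
    refine eq_zero_of_eventually_evalM (half_pos hρ) (conv_mpd hρ hB none) ?_
    filter_upwards [eventually_evalM_mpd hρ hB T hM he none] with z hz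
    rw [hz, projT_single_none, mpderiv_zero_right]
  set c : Fin m ⊕ Fin l → (Fin m → ℂ) → Mat n := Sum.elim C₀ 0 with hc
  set v : Fin m ⊕ Fin l → Fin m → ℂ := Sum.elim (fun i => Pi.single i 1) (fun _ => 0) with hv
  have hcC : ∀ a k j, Conv ρ ((Sum.elim C 0 : Fin m ⊕ Fin l → _) a k j) := by
    rintro (i | α) k j
    · exact hA _ k j
    · exact conv_zero ρ
  have hce : ∀ a, ∀ᶠ z in 𝓝 0, c a (T z) = evalM ((Sum.elim C 0 : Fin m ⊕ Fin l → _) a) z := by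
    rintro (i | α)
    · exact heC i
    · exact Eventually.of_forall fun z => (evalM_zero_left z).symm
  have hcd : ∀ a, ∀ᶠ x in 𝓝 (0 : Fin m → ℂ), ∀ k j,
      DifferentiableAt ℂ (fun q => c a q k j) x := by
    rintro (i | α)
    · exact hdC i
    · exact Eventually.of_forall fun x k j => differentiableAt_const _
  have z1 : ∀ B : Mat n, matComm 0 B = 0 := fun B => by simp [matComm]
  have z2 : ∀ B : Mat n, matComm B 0 = 0 := fun B => by simp [matComm]
  have hD : ∀ {M : (Fin m → ℂ) → Mat n}
      {B : Matrix (Fin n) (Fin n) (MvPowerSeries (Option (Fin m ⊕ Fin l)) ℂ)},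
      (∀ k j, Conv ρ (B k j)) →
      (∀ᶠ x in 𝓝 (0 : Fin m → ℂ), ∀ k j, DifferentiableAt ℂ (fun q => M q k j) x) →
      (∀ᶠ z in 𝓝 0, M (T z) = evalM B z) → ∀ a : Fin m ⊕ Fin l,
      ∀ᶠ z in 𝓝 0, evalM (mpd n (some a) B) z = mpderiv M (T z) (v a) := by
    intro M B hB hM he a
    filter_upwards [eventually_evalM_mpd hρ hB T hM he (some a)] with z hz
    rw [hz, projT_single_some]
  refine ⟨ρ, hρ, C, U, V, W, fun i => hA _, hA _, hA _, hA _,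
    fun i => hnone (hA _) (hdC i) (heC i), hnone (hA _) hdU heU, hnone (hA _) hdV heV,
    hnone (hA _) hdW heW, ?_, ?_⟩
  · refine constraints_bot_of_eventually hρ hcC (hA _) (hA _) (hA _) (fun a b => ?_) (fun a => ?_)
      (fun a b => ?_) (fun a => ?_) (fun a => ?_) (fun a => ?_)
    · filter_upwards [hce a, hce b, hN] with z ha hb hz
      rw [← ha, ← hb]
      rcases a with i | α
      · rcases b with j | β
        · exact h1 _ hz i j
        · exact z2 _
      · exact z1 _
    · filter_upwards [hce a, heU, hN] with z ha hb hz
      rw [← ha, ← hb]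
      rcases a with i | α
      · exact h3 _ hz i
      · exact z1 _
    · filter_upwards [hD (hcC a) (hcd a) (hce a) b, hD (hcC b) (hcd b) (hce b) a, hN]
        with z ha hb hz
      rw [ha, hb]
      rcases a with i | α
      · rcases b with j | β
        · exact h2 _ hz i j
        · exact (mpderiv_zero_right _ _).trans (mpderiv_zero_left _ _).symm
      · exact (mpderiv_zero_left _ _).trans (mpderiv_zero_right _ _).symm
    · filter_upwards [hD (hA _) hdU heU a, hce a, heV, hN] with z ha hb hc hz
      rw [ha, ← hb, ← hc]
      rcases a with i | α
      · exact h4 _ hz i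
      · refine (mpderiv_zero_right _ _).trans ?_
        change 0 = matComm _ 0 - 0
        rw [z2, sub_zero]
    · filter_upwards [hD (hA _) hdW heW a, hce a, heW, hN] with z ha hb hc hz
      rw [ha, ← hb, ← hc]
      rcases a with i | α
      · exact h5 _ hz i
      · exact (mpderiv_zero_right _ _).trans (z2 _).symm
    · filter_upwards [hD (hA _) hdV heV a, hce a, heW, hN] with z ha hb hc hz
      rw [ha, ← hb, ← hc]
      rcases a with i | α
      · exact h6 _ hz i
      · refine (mpderiv_zero_right _ _).trans ?_
        change 0 = -matComm _ 0
        rw [z2, neg_zero]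
  · filter_upwards [hAe] with z hz
    exact ⟨fun i => hz (Sum.inl i), hz (Sum.inr 0), hz (Sum.inr 1), hz (Sum.inr 2)⟩

end Assembly

end

open Filter Topology MvPowerSeries

theorem stmt_0
    (n m l : ℕ) (hn : 0 < n) (hl : 0 < l)
    (N₀ : Set (Fin m → ℂ)) (hN₀open : IsOpen N₀) (hN₀0 : (0 : Fin m → ℂ) ∈ N₀)
    (C₀ : Fin m → (Fin m → ℂ) → Mat n)
    (U₀ V₀ W₀ : (Fin m → ℂ) → Mat n)
    (hC₀d : ∀ i, MDiffOn (C₀ i) N₀)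
    (hU₀d : MDiffOn U₀ N₀) (hV₀d : MDiffOn V₀ N₀) (hW₀d : MDiffOn W₀ N₀)
    (h1 : ∀ t ∈ N₀, ∀ i j, matComm (C₀ i t) (C₀ j t) = 0)
    (h2 : ∀ t ∈ N₀, ∀ i j,
      mpderiv (C₀ i) t (Pi.single j 1) = mpderiv (C₀ j) t (Pi.single i 1))
    (h3 : ∀ t ∈ N₀, ∀ i, matComm (C₀ i t) (U₀ t) = 0)
    (h4 : ∀ t ∈ N₀, ∀ i,
      mpderiv U₀ t (Pi.single i 1) = matComm (V₀ t) (C₀ i t) - C₀ i t)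
    (h5 : ∀ t ∈ N₀, ∀ i, mpderiv W₀ t (Pi.single i 1) = matComm (W₀ t) (C₀ i t))
    (h6 : ∀ t ∈ N₀, ∀ i, mpderiv V₀ t (Pi.single i 1) = - matComm (W₀ t) (C₀ i t))
    (hGC : GenCond (Fin.snoc (fun i => C₀ i 0) (U₀ 0))
      (Pi.single (⟨0, hn⟩ : Fin n) 1))
    (Nf : Set (Pt m l)) (hNfopen : IsOpen Nf) (hNf0 : (0 : Pt m l) ∈ Nf)
    (f : Fin n → Pt m l → ℂ)
    (hfd : ∀ i, DifferentiableOn ℂ (f i) Nf)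
    (hf0 : ∀ (i) (t : Fin m → ℂ), ((t, 0) : Pt m l) ∈ Nf → f i (t, 0) = 0) :
    ∃ N : Set (Pt m l), IsOpen N ∧ (0 : Pt m l) ∈ N ∧ N ⊆ Nf ∧
      (∀ p ∈ N, p.1 ∈ N₀) ∧
      ∃ (C : Fin m → Pt m l → Mat n) (F : Fin l → Pt m l → Mat n)
        (U V W : Pt m l → Mat n),
        (∀ i, MDiffOn (C i) N) ∧ (∀ α, MDiffOn (F α) N) ∧
        MDiffOn U N ∧ MDiffOn V N ∧ MDiffOn W N ∧
        -- (i) restriction to y = 0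
        (∀ t : Fin m → ℂ, ((t, 0) : Pt m l) ∈ N →
          (∀ i, C i (t, 0) = C₀ i t) ∧ U (t, 0) = U₀ t ∧
            V (t, 0) = V₀ t ∧ W (t, 0) = W₀ t) ∧
        -- (ii) the first column of F_α consists of the ∂f_i/∂y_α
        (∀ p ∈ N, ∀ α i,
          F α p i (⟨0, hn⟩ : Fin n) =
            fderiv ℂ (f i) p ((0 : Fin m → ℂ), Pi.single α 1)) ∧
        -- (iii) the full flatness system
        (∀ p ∈ N, FullSystemAt C F U V W p) := by
  have hN₀n : N₀ ∈ 𝓝 (0 : Fin m → ℂ) := hN₀open.mem_nhds hN₀0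
  obtain ⟨ρ₁, hρ₁, A, AU, AV, AW, cA, cAU, cAV, cAW, sA, sU, sV, sW, hA, hAe⟩ :=
    exists_initial_series hN₀n l hC₀d hU₀d hV₀d hW₀d h1 h2 h3 h4 h5 h6
  have hSt : Tendsto (scaleMap m l) (𝓝 0) (𝓝 0) :=
    differentiable_scaleMap.continuous.tendsto' 0 0 scaleMap_zero
  have hNfS : ∀ᶠ z in 𝓝 0, scaleMap m l z ∈ Nf := hSt.eventually (hNfopen.mem_nhds hNf0)
  obtain ⟨ρ₂, hρ₂, h, hh, hhe⟩ := exists_evalF_family (f := fun k z => f k (scaleMap m l z))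
    fun k => hNfS.mono fun z hz =>
      ((hfd k).differentiableAt (hNfopen.mem_nhds hz)).comp z (differentiable_scaleMap z)
  obtain ⟨w, Q, hQ⟩ := exists_words hGC
  have hA0 := hAe.self_of_nhds
  simp only [map_zero] at hA0
  have hmap0 : ∀ B : Matrix (Fin n) (Fin n) (MvPowerSeries (Option (Fin m ⊕ Fin l)) ℂ),
      evalM B 0 = B.map (coeff 0) := by
    intro B
    ext k j
    exact evalF_zero _
  have hC0 : (fun i => C₀ i 0) = fun i => (A i).map (coeff 0) :=
    funext fun i => (hA0.1 i).trans (hmap0 _)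
  rw [hC0, hA0.2.1, hmap0] at hQ
  have hvan : ∀ k (z : Option (Fin m ⊕ Fin l) → ℂ), scaleMap m l z ∈ Nf →
      (∀ α, z none * z (some (Sum.inr α)) = 0) → f k (scaleMap m l z) = 0 := by
    intro k z hz h0
    have hS : scaleMap m l z = (projT m l z, 0) := Prod.ext rfl (funext h0)
    rw [hS] at hz ⊢
    exact hf0 k _ hz
  have hhs : ∀ k, h k ∈ coeffIdeal (expLT none 1) := by
    intro k α hα
    refine mem_expZero_of_eventually (T := {none}) hρ₂ (hh k) ?_ α ?_
    · filter_upwards [hhe, hNfS] with z hz hzN h0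
      rw [← hz k]
      exact hvan k z hzN fun α => by rw [h0 none rfl, zero_mul]
    · rintro i rfl
      exact Nat.lt_one_iff.1 hα
  have hhy : ∀ k, h k ∈ coeffIdeal (expZero (Set.range fun α : Fin l => some (Sum.inr α))) := by
    intro k
    refine mem_expZero_of_eventually hρ₂ (hh k) ?_
    filter_upwards [hhe, hNfS] with z hz hzN h0
    rw [← hz k]
    exact hvan k z hzN fun α => by rw [h0 _ ⟨α, rfl⟩, mul_zero]
  have hρ := lt_min hρ₁ hρ₂
  obtain ⟨r₁, hr₁, X, U, V, W, cX, cU, cV, cW, hX, iX, iU, iV, iW, hcol⟩ :=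
    exists_convergent_unfolding hρ (fun i k j => (cA i k j).mono hρ.le (min_le_left _ _))
      (fun k j => (cAU k j).mono hρ.le (min_le_left _ _))
      (fun k j => (cAV k j).mono hρ.le (min_le_left _ _))
      (fun k j => (cAW k j).mono hρ.le (min_le_left _ _))
      (fun k => (hh k).mono hρ.le (min_le_right _ _)) sA sU sV sW hA w ⟨0, hn⟩ Q hQ hhs hhy
  set r := min r₁ (min ρ₁ ρ₂) with hr_def
  have hr : 0 < r := lt_min hr₁ hρ
  have hrr : r ≤ r₁ := min_le_left _ _
  have hrρ₁ : r ≤ ρ₁ := (min_le_right _ _).trans (min_le_left _ _)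
  have hrρ₂ : r ≤ ρ₂ := (min_le_right _ _).trans (min_le_right _ _)
  replace cX := fun a k j => (cX a k j).mono hr.le hrr
  replace cU := fun k j => (cU k j).mono hr.le hrr
  replace cV := fun k j => (cV k j).mono hr.le hrr
  replace cW := fun k j => (cW k j).mono hr.le hrr
  replace cA := fun a k j => (cA a k j).mono hr.le hrρ₁
  replace cAU := fun k j => (cAU k j).mono hr.le hrρ₁
  replace cAV := fun k j => (cAV k j).mono hr.le hrρ₁
  replace cAW := fun k j => (cAW k j).mono hr.le hrρ₁
  replace hh := fun k => (hh k).mono hr.le hrρ₂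
  obtain ⟨R, hR, hball⟩ := Metric.eventually_nhds_iff_ball.1
    ((hAe.and hhe).and (eventually_norm_lt (half_pos hr)))
  set c : ℂ := ((R / 2 : ℝ) : ℂ) with hc_def
  have hc : c ≠ 0 := Complex.ofReal_ne_zero.2 (half_pos hR).ne'
  have hcR : ‖c‖ < R := by
    rw [hc_def, Complex.norm_real, Real.norm_of_nonneg (half_pos hR).le]
    exact half_lt_self hR
  set ι := sectionMap m l c with hι
  have hιd : Differentiable ℂ ι := fun p => (hasFDerivAt_sectionMap c p).differentiableAt
  set N : Set (Pt m l) := ι ⁻¹' Metric.ball 0 R ∩ Nf ∩ Prod.fst ⁻¹' N₀ with hN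
  have hNopen : IsOpen N := ((Metric.isOpen_ball.preimage hιd.continuous).inter hNfopen).inter
    (hN₀open.preimage continuous_fst)
  have hsmall : ∀ p ∈ N, ‖ι p‖ < r / 2 := fun p hp => (hball _ hp.1.1).2
  have hsmall' : ∀ p ∈ N, ‖ι p‖ ≤ r := fun p hp =>
    (hsmall p hp).le.trans (half_le_self hr.le)
  set γ : Fin m ⊕ Fin l → ℂ := Sum.elim (fun _ => 1) fun _ => c⁻¹ with hγ
  set D : Fin m ⊕ Fin l → Pt m l → Mat n := fun a p => γ a • evalM (X a) (ι p) with hD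
  set v : Fin m ⊕ Fin l → Pt m l :=
    Sum.elim (fun i => (Pi.single i 1, 0)) (fun α => (0, Pi.single α 1)) with hv
  have hlin : ∀ a, sectionLin m l c (v a) = γ a • Pi.single (some a) 1 :=
    sectionLin_apply_direction c
  have hdiff : ∀ {B : Matrix (Fin n) (Fin n) (MvPowerSeries (Option (Fin m ⊕ Fin l)) ℂ)},
      (∀ k j, Conv r (B k j)) → ∀ x : ℂ, MDiffOn (fun p => x • evalM B (ι p)) N :=
    fun hB x k j p hp =>
      (differentiableAt_evalM hr hB (hιd p) (hsmall p hp) x k j).differentiableWithinAt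
  have hdiff1 : ∀ {B : Matrix (Fin n) (Fin n) (MvPowerSeries (Option (Fin m ⊕ Fin l)) ℂ)},
      (∀ k j, Conv r (B k j)) → MDiffOn (fun p => evalM B (ι p)) N := fun hB => by
    simpa only [one_smul] using hdiff hB 1
  have hder : ∀ {B : Matrix (Fin n) (Fin n) (MvPowerSeries (Option (Fin m ⊕ Fin l)) ℂ)},
      (∀ k j, Conv r (B k j)) → ∀ (x : ℂ), ∀ p ∈ N, ∀ a,
      mpderiv (fun p => x • evalM B (ι p)) p (v a) =
        (x * γ a) • evalM (mpd n (some a) B) (ι p) :=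
    fun hB x p hp a =>
      mpderiv_evalM hr hB (hasFDerivAt_sectionMap c p) (hsmall p hp) (hlin a) x
  have hder1 : ∀ {B : Matrix (Fin n) (Fin n) (MvPowerSeries (Option (Fin m ⊕ Fin l)) ℂ)},
      (∀ k j, Conv r (B k j)) → ∀ p ∈ N, ∀ a,
      mpderiv (fun p => evalM B (ι p)) p (v a) = γ a • evalM (mpd n (some a) B) (ι p) :=
    fun hB p hp a => by simpa only [one_smul, one_mul] using hder hB 1 p hp a
  have hinit : ∀ {B B₀ : Matrix (Fin n) (Fin n) (MvPowerSeries (Option (Fin m ⊕ Fin l)) ℂ)},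
      (∀ k j, Conv r (B k j)) → (∀ k j, Conv r (B₀ k j)) →
      B - B₀ ∈ matIdeal n (coeffIdeal (expZero (Set.range fun α : Fin l => some (Sum.inr α)))) →
      ∀ t : Fin m → ℂ, ((t, 0) : Pt m l) ∈ N →
      evalM B (ι (t, 0)) = evalM B₀ (ι (t, 0)) := by
    intro B B₀ hB hB₀ hBB t ht
    rw [← sub_eq_zero, ← evalM_sub hB hB₀ (hsmall' _ ht)]
    ext k j
    refine evalF_eq_zero_of_mem (hBB k j) ?_
    rintro _ ⟨α, rfl⟩
    rw [hι, sectionMap_inr]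
    exact mul_zero _
  have hsys := fun p hp => hX.pointwise (e := some) hr cX cU cV cW (hsmall' p hp)
  refine ⟨N, hNopen, ⟨⟨?_, hNf0⟩, hN₀0⟩, fun p hp => hp.1.2, fun p hp => hp.2,
    fun i => D (Sum.inl i), fun α => D (Sum.inr α), fun p => evalM U (ι p),
    fun p => evalM V (ι p), fun p => evalM W (ι p), fun i => hdiff (cX _) _,
    fun α => hdiff (cX _) _, hdiff1 cU, hdiff1 cV, hdiff1 cW, fun t ht => ?_,
    fun p hp α k => ?_, fun p hp => ?_⟩
  · rw [Set.mem_preimage, mem_ball_zero_iff, hι, norm_sectionMap_zero]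
    exact hcR
  · have hz := (hball _ ht.1.1).1.1
    rw [hι, projT_sectionMap, ← hι] at hz
    refine ⟨fun i => ?_, ?_, ?_, ?_⟩
    · rw [hz.1 i, ← hinit (cX _) (cA i) (iX i) t ht]
      exact one_smul ℂ _
    · rw [hz.2.1, ← hinit cU cAU iU t ht]
    · rw [hz.2.2.1, ← hinit cV cAV iV t ht]
    · rw [hz.2.2.2, ← hinit cW cAW iW t ht]
  · obtain ⟨K', hK', hKv⟩ := hasFDerivAt_evalF hr (hh k) (hsmall p hp)
    have hfe : f k =ᶠ[𝓝 p] fun q => evalF (h k) (ι q) := by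
      filter_upwards [hNopen.mem_nhds hp] with q hq
      rw [← (hball _ hq.1.1).1.2 k, hι, scaleMap_sectionMap hc]
    have hfd' := (hK'.comp p (hasFDerivAt_sectionMap c p)).congr_of_eventuallyEq hfe
    have hlα : sectionLin m l c (0, Pi.single α 1) = c⁻¹ • Pi.single (some (Sum.inr α)) 1 :=
      hlin (Sum.inr α)
    rw [hfd'.fderiv, ContinuousLinearMap.comp_apply, hlα, map_smul, hKv, ← hcol]
    rfl
  · obtain ⟨e1, e2, e3, e4, e5, e6⟩ := hsys p hp
    have g1 : ∀ a b, matComm (D a p) (D b p) = 0 := fun a b => by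
      rw [hD, matComm_smul, e1, smul_zero]
    have g2 : ∀ a, matComm (D a p) (evalM U (ι p)) = 0 := fun a => by
      rw [hD, matComm_smul_left, e2, smul_zero]
    have g3 : ∀ a b, mpderiv (D a) p (v b) = mpderiv (D b) p (v a) := fun a b => by
      rw [hD, hder (cX a) _ p hp, hder (cX b) _ p hp, e3, mul_comm]
    have g4 : ∀ a, mpderiv (fun p => evalM U (ι p)) p (v a) =
        matComm (evalM V (ι p)) (D a p) - D a p := fun a => by
      rw [hder1 cU p hp, e4, hD, matComm_smul_right, smul_sub]
    have g5 : ∀ a, mpderiv (fun p => evalM W (ι p)) p (v a) =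
        matComm (evalM W (ι p)) (D a p) := fun a => by
      rw [hder1 cW p hp, e5, hD, matComm_smul_right]
    have g6 : ∀ a, mpderiv (fun p => evalM V (ι p)) p (v a) =
        -matComm (evalM W (ι p)) (D a p) := fun a => by
      rw [hder1 cV p hp, e6, hD, matComm_smul_right, smul_neg]
    exact ⟨fun i j => g1 _ _, fun i α => g1 _ _, fun α β => g1 _ _,
      fun i j => g3 (Sum.inl i) (Sum.inl j), fun i α => g3 (Sum.inl i) (Sum.inr α),
      fun α β => g3 (Sum.inr α) (Sum.inr β), fun i => g2 _, fun α => g2 _,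
      fun i => g4 (Sum.inl i), fun α => g4 (Sum.inr α), fun i => g5 (Sum.inl i),
      fun α => g5 (Sum.inr α), fun i => g6 (Sum.inl i), fun α => g6 (Sum.inr α)⟩
end
end

section
/- Let f ∈ ℂ[x_0,…,x_5] be weighted homogeneous of weighted degree 9 for the weights w(x_0)=w(x_1)=w(x_2)=1, w(x_3)=w(x_4)=w(x_5)=2, and assume f has an isolated singularity at 0, i.e. the Jacobi algebra R_f := ℂ[x_0,…,x_5]/(∂f/∂x_0,…,∂f/∂x_5) is finite-dimensional over ℂ. For q ∈ ℕ let R_f^{(q)} ⊆ R_f denote the image in R_f of the space of weighted homogeneous polynomials of weighted degree 9q. Then the ℂ-subspace of R_f^{(2)} spanned by all products a·b with a, b ∈ R_f^{(1)} has codimension exactly 1 in R_f^{(2)}. -/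
/-!
Statement 7 (Lemma 6.2): for weights (1,1,1,2,2,2) and a weighted homogeneous
polynomial `f` of weighted degree 9 with isolated singularity, the span of
`R_f^{(1)} · R_f^{(1)}` has codimension exactly 1 in `R_f^{(2)}`.
-/

open MvPolynomial

section Koszul

variable {A : Type*} [CommRing A]

/-- If `X, Y, Z` is a regular sequence with `Y, Z` in the ideal generated by `g`, then a vector whose
cross product with `g` vanishes modulo `X` is a multiple of `g` modulo `X`. -/
theorem exists_dvd_sub_mul_of_dvd_cross {X Y Z : A} {g u : Fin 3 → A}
    (hY : ∀ a, X ∣ Y * a → X ∣ a)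
    (hZ : ∀ a, Z * a ∈ Ideal.span {X, Y} → a ∈ Ideal.span {X, Y})
    (hYg : Y ∈ Ideal.span (Set.range g)) (hZg : Z ∈ Ideal.span (Set.range g))
    (h0 : X ∣ g 1 * u 2 - g 2 * u 1) (h1 : X ∣ g 2 * u 0 - g 0 * u 2)
    (h2 : X ∣ g 0 * u 1 - g 1 * u 0) :
    ∃ q, ∀ i, X ∣ u i - q * g i := by
  obtain ⟨d, hd⟩ := Ideal.mem_span_range_iff_exists_fun.1 hYg
  obtain ⟨e, he⟩ := Ideal.mem_span_range_iff_exists_fun.1 hZg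
  simp only [Fin.sum_univ_three] at hd he
  obtain ⟨k0, h0⟩ := h0
  obtain ⟨k1, h1⟩ := h1
  obtain ⟨k2, h2⟩ := h2
  set t := d 0 * u 0 + d 1 * u 1 + d 2 * u 2 with ht
  have key : ∀ i, ∃ k, Y * u i = t * g i + X * k := by
    intro i
    fin_cases i
    · refine ⟨d 2 * k1 - d 1 * k2, ?_⟩
      simp only [Fin.zero_eta, ht]
      linear_combination (-u 0) * hd + d 2 * h1 - d 1 * h2
    · refine ⟨d 0 * k2 - d 2 * k0, ?_⟩
      simp only [Fin.mk_one, ht]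
      linear_combination (-u 1) * hd + d 0 * h2 - d 2 * h0
    · refine ⟨d 1 * k0 - d 0 * k1, ?_⟩
      simp only [Fin.reduceFinMk, ht]
      linear_combination (-u 2) * hd + d 1 * h0 - d 0 * h1
  choose k hk using key
  have htm : t ∈ Ideal.span {X, Y} := by
    refine hZ t (Ideal.mem_span_pair.2
      ⟨-(e 0 * k 0 + e 1 * k 1 + e 2 * k 2), e 0 * u 0 + e 1 * u 1 + e 2 * u 2, ?_⟩)
    linear_combination e 0 * hk 0 + e 1 * hk 1 + e 2 * hk 2 + t * he
  obtain ⟨p, q, hpq⟩ := Ideal.mem_span_pair.1 htm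
  refine ⟨q, fun i => hY _ ⟨p * g i + k i, ?_⟩⟩
  linear_combination hk i - g i * hpq

/-- If the ideal generated by `g` contains a regular sequence of length three, then every syzygy of
`g` is a Koszul syzygy. -/
theorem exists_eq_cross_of_syzygy {X Y Z : A} {g a : Fin 3 → A}
    (hX : ∀ a, X * a = 0 → a = 0) (hY : ∀ a, X ∣ Y * a → X ∣ a)
    (hZ : ∀ a, Z * a ∈ Ideal.span {X, Y} → a ∈ Ideal.span {X, Y})
    (hXg : X ∈ Ideal.span (Set.range g)) (hYg : Y ∈ Ideal.span (Set.range g))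
    (hZg : Z ∈ Ideal.span (Set.range g))
    (ha : ∑ i, a i * g i = 0) :
    ∃ w : Fin 3 → A, a 0 = g 1 * w 2 - g 2 * w 1 ∧ a 1 = g 2 * w 0 - g 0 * w 2 ∧
      a 2 = g 0 * w 1 - g 1 * w 0 := by
  obtain ⟨c, hc⟩ := Ideal.mem_span_range_iff_exists_fun.1 hXg
  simp only [Fin.sum_univ_three] at hc ha
  have e0 : X * a 0 = g 1 * (a 0 * c 1 - a 1 * c 0) - g 2 * (a 2 * c 0 - a 0 * c 2) := by
    linear_combination (-a 0) * hc + c 0 * ha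
  have e1 : X * a 1 = g 2 * (a 1 * c 2 - a 2 * c 1) - g 0 * (a 0 * c 1 - a 1 * c 0) := by
    linear_combination (-a 1) * hc + c 1 * ha
  have e2 : X * a 2 = g 0 * (a 2 * c 0 - a 0 * c 2) - g 1 * (a 1 * c 2 - a 2 * c 1) := by
    linear_combination (-a 2) * hc + c 2 * ha
  obtain ⟨q, hq⟩ := exists_dvd_sub_mul_of_dvd_cross
    (u := ![a 1 * c 2 - a 2 * c 1, a 2 * c 0 - a 0 * c 2, a 0 * c 1 - a 1 * c 0])
    hY hZ hYg hZg ⟨a 0, by simpa using e0.symm⟩ ⟨a 1, by simpa using e1.symm⟩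
    ⟨a 2, by simpa using e2.symm⟩
  choose w hw using hq
  have w0 := hw 0
  have w1 := hw 1
  have w2 := hw 2
  simp only [Matrix.cons_val] at w0 w1 w2
  refine ⟨w, ?_, ?_, ?_⟩ <;> rw [← sub_eq_zero] <;> apply hX
  · linear_combination e0 + g 1 * w2 - g 2 * w1
  · linear_combination e1 + g 2 * w0 - g 0 * w2
  · linear_combination e2 + g 0 * w1 - g 1 * w0

end Koszul

namespace MvPolynomial

theorem mem_ideal_span_X_pow_image {σ R : Type*} [CommSemiring R] {x : MvPolynomial σ R}
    {s : Set σ} {N : ℕ} :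
    x ∈ Ideal.span ((fun i => (X i : MvPolynomial σ R) ^ N) '' s) ↔
      ∀ m ∈ x.support, ∃ i ∈ s, N ≤ m i := by
  have := @mem_ideal_span_monomial_image σ R _ x ((fun i => Finsupp.single i N) '' s)
  rw [Set.image_image] at this
  simp only [← X_pow_eq_monomial] at this
  simp [this]

theorem mem_ideal_span_X_pow_of_X_pow_mul_mem {σ R : Type*} [CommSemiring R]
    {x : MvPolynomial σ R} {s : Set σ} {N : ℕ} {k : σ} (hk : k ∉ s)
    (h : X k ^ N * x ∈ Ideal.span ((fun i => (X i : MvPolynomial σ R) ^ N) '' s)) :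
    x ∈ Ideal.span ((fun i => (X i : MvPolynomial σ R) ^ N) '' s) := by
  classical
  rw [mem_ideal_span_X_pow_image] at h ⊢
  intro m hm
  obtain ⟨i, hi, hle⟩ := h (Finsupp.single k N + m) (by
    rw [mem_support_iff] at hm ⊢
    rwa [X_pow_eq_monomial, coeff_monomial_mul, one_mul])
  refine ⟨i, hi, ?_⟩
  have : k ≠ i := by rintro rfl; exact hk hi
  simpa [Finsupp.single_apply, this] using hle

theorem homogeneousComponent_add_mul {σ R : Type*} [CommSemiring R]
    {g : MvPolynomial σ R} {n : ℕ} (hg : g.IsHomogeneous n) (m : ℕ) (a : MvPolynomial σ R) :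
    homogeneousComponent (m + n) (a * g) = homogeneousComponent m a * g := by
  let := gradedAlgebra (σ := σ) (R := R)
  rw [← decomposition.decompose'_apply, ← decomposition.decompose'_apply]
  exact DirectSum.coe_decompose_mul_add_of_right_mem (homogeneousSubmodule σ R) hg

theorem finrank_homogeneousSubmodule (K : Type*) [Field K] (k n : ℕ) :
    Module.finrank K (homogeneousSubmodule (Fin k) K n) = (k + n - 1).choose n := by
  have e : {d : Fin k →₀ ℕ | d.degree = n} =
      ((Finset.univ : Finset (Fin k)).finsuppAntidiag n : Set (Fin k →₀ ℕ)) := by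
    ext d
    simp [Finset.mem_finsuppAntidiag, Finsupp.degree_eq_sum]
  rw [homogeneousSubmodule_eq_finsupp_supported, e]
  refine (Module.finrank_eq_card_basis (basisRestrictSupport K _)).trans ?_
  simp [Finset.card_finsuppAntidiag_nat_eq_choose]

section ThreeQuartics

variable {K : Type*} [Field K] {g : Fin 3 → MvPolynomial (Fin 3) K}

theorem exists_eq_cross_of_syzygy {N : ℕ}
    (hN : ∀ i, X i ^ N ∈ Ideal.span (Set.range g)) {a : Fin 3 → MvPolynomial (Fin 3) K}
    (ha : ∑ i, a i * g i = 0) :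
    ∃ w : Fin 3 → MvPolynomial (Fin 3) K, a 0 = g 1 * w 2 - g 2 * w 1 ∧
      a 1 = g 2 * w 0 - g 0 * w 2 ∧ a 2 = g 0 * w 1 - g 1 * w 0 := by
  refine _root_.exists_eq_cross_of_syzygy (X := X 0 ^ N) (Y := X 1 ^ N) (Z := X 2 ^ N)
    (fun a h => (mul_eq_zero.1 h).resolve_left (pow_ne_zero _ (X_ne_zero _))) (fun a h => ?_)
    (fun a h => ?_) (hN 0) (hN 1) (hN 2) ha
  · have := mem_ideal_span_X_pow_of_X_pow_mul_mem (x := a) (s := {0}) (N := N) (k := 1) (by simp)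
    simp only [Set.image_singleton, Ideal.mem_span_singleton] at this
    exact this h
  · have := mem_ideal_span_X_pow_of_X_pow_mul_mem (x := a) (s := {0, 1}) (N := N) (k := 2)
      (by simp)
    simp only [Set.image_pair] at this
    exact this h

theorem exists_eq_mul_of_cross_eq_zero {N : ℕ}
    (hN : ∀ i, X i ^ N ∈ Ideal.span (Set.range g)) {u : Fin 3 → MvPolynomial (Fin 3) K}
    (h0 : g 1 * u 2 - g 2 * u 1 = 0) (h1 : g 2 * u 0 - g 0 * u 2 = 0)
    (h2 : g 0 * u 1 - g 1 * u 0 = 0) : ∃ q, ∀ i, u i = q * g i := by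
  have := exists_dvd_sub_mul_of_dvd_cross (X := 0) (Y := X 0 ^ N) (Z := X 1 ^ N) (g := g) (u := u)
    (fun a h => ?_) (fun a h => ?_) (hN 0) (hN 1) (by rw [h0]) (by rw [h1]) (by rw [h2])
  · simpa only [zero_dvd_iff, sub_eq_zero] using this
  · rw [zero_dvd_iff] at h ⊢
    exact (mul_eq_zero.1 h).resolve_left (pow_ne_zero _ (X_ne_zero _))
  · have := mem_ideal_span_X_pow_of_X_pow_mul_mem (x := a) (s := {0}) (N := N) (k := 1) (by simp)
    rw [Ideal.span_insert_zero] at h ⊢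
    simp only [Set.image_singleton] at this
    exact this h

/-- The map `(a₀, a₁, a₂) ↦ ∑ aᵢ gᵢ` on triples of forms of degree `n`. -/
noncomputable def sumMulForms (g : Fin 3 → MvPolynomial (Fin 3) K) (n : ℕ) :
    (Fin 3 → homogeneousSubmodule (Fin 3) K n) →ₗ[K] MvPolynomial (Fin 3) K where
  toFun a := ∑ i, (a i : MvPolynomial (Fin 3) K) * g i
  map_add' a b := by simp [add_mul, Finset.sum_add_distrib]
  map_smul' c a := by simp [Finset.smul_sum]

/-- The map sending `w` to the cross product `g × w`, on triples of forms. -/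
noncomputable def crossForms (g : Fin 3 → MvPolynomial (Fin 3) K) {m : ℕ}
    (hg : ∀ i, (g i).IsHomogeneous m) (n : ℕ) :
    (Fin 3 → homogeneousSubmodule (Fin 3) K n) →ₗ[K]
      (Fin 3 → homogeneousSubmodule (Fin 3) K (m + n)) where
  toFun w := ![⟨g 1 * w 2 - g 2 * w 1, ((hg 1).mul (w 2).2).sub ((hg 2).mul (w 1).2)⟩,
    ⟨g 2 * w 0 - g 0 * w 2, ((hg 2).mul (w 0).2).sub ((hg 0).mul (w 2).2)⟩,
    ⟨g 0 * w 1 - g 1 * w 0, ((hg 0).mul (w 1).2).sub ((hg 1).mul (w 0).2)⟩]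
  map_add' a b := by
    ext i : 2
    fin_cases i <;> simp <;> ring
  map_smul' c a := by
    ext i : 2
    fin_cases i <;> simp [smul_sub]

theorem crossForms_injective {N m n : ℕ} (hg : ∀ i, (g i).IsHomogeneous m)
    (hN : ∀ i, X i ^ N ∈ Ideal.span (Set.range g)) (hnm : n < m) :
    Function.Injective (crossForms g hg n) := by
  rw [injective_iff_map_eq_zero]
  intro u hu
  obtain ⟨q, hq⟩ := exists_eq_mul_of_cross_eq_zero hN (u := fun i => u i)
    (congrArg Subtype.val (congrFun hu 0)) (congrArg Subtype.val (congrFun hu 1))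
    (congrArg Subtype.val (congrFun hu 2))
  ext i : 2
  have hui : (u i : MvPolynomial (Fin 3) K).IsHomogeneous n := (u i).2
  by_contra hne
  have hne' : (u i : MvPolynomial (Fin 3) K) ≠ 0 := hne
  have hqg := hq i
  rw [hqg] at hne'
  have h1 := hui.totalDegree (hqg ▸ hne')
  rw [hqg, totalDegree_mul_of_isDomain (left_ne_zero_of_mul hne') (right_ne_zero_of_mul hne'),
    (hg i).totalDegree (right_ne_zero_of_mul hne')] at h1
  lia

theorem ker_sumMulForms {N m n : ℕ} (hg : ∀ i, (g i).IsHomogeneous m)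
    (hN : ∀ i, X i ^ N ∈ Ideal.span (Set.range g)) :
    LinearMap.ker (sumMulForms g (m + n)) = LinearMap.range (crossForms g hg n) := by
  apply le_antisymm
  · intro a ha
    obtain ⟨w, h0, h1, h2⟩ := exists_eq_cross_of_syzygy hN (a := fun i => a i) ha
    have key : ∀ i j, homogeneousComponent (m + n) (g i * w j) =
        g i * homogeneousComponent n (w j) := by
      intro i j
      rw [mul_comm, add_comm, homogeneousComponent_add_mul (hg i), mul_comm]
    have ha' : ∀ i, homogeneousComponent (m + n) (a i : MvPolynomial (Fin 3) K) = a i :=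
      fun i => homogeneousComponent_eq_self (a i).2
    refine ⟨fun i => ⟨homogeneousComponent n (w i), homogeneousComponent_mem _ _⟩, ?_⟩
    ext i : 2
    rw [← ha' i]
    fin_cases i <;> simp [crossForms, *]
  · rintro _ ⟨w, rfl⟩
    simp only [LinearMap.mem_ker, sumMulForms, crossForms, LinearMap.coe_mk, AddHom.coe_mk,
      Fin.sum_univ_three, Matrix.cons_val]
    ring

theorem finrank_range_sumMulForms {N m n : ℕ} (hg : ∀ i, (g i).IsHomogeneous m)
    (hN : ∀ i, X i ^ N ∈ Ideal.span (Set.range g)) (hnm : n < m) :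
    Module.finrank K (LinearMap.range (sumMulForms g (m + n))) +
      3 * (n + 2).choose n = 3 * (m + n + 2).choose (m + n) := by
  have (k : ℕ) : Module.Finite K (homogeneousSubmodule (Fin 3) K k) :=
    Module.Finite.iff_fg.2 (homogeneousSubmodule_fg _ _ _)
  have h := LinearMap.finrank_range_add_finrank_ker (sumMulForms g (m + n))
  rw [ker_sumMulForms hg hN, LinearMap.finrank_range_of_inj (crossForms_injective hg hN hnm),
    Module.finrank_pi_fintype, Module.finrank_pi_fintype] at h
  simp only [finrank_homogeneousSubmodule, Finset.sum_const, Finset.card_univ, Fintype.card_fin,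
    smul_eq_mul] at h
  rwa [show 3 + n - 1 = n + 2 by lia, show 3 + (m + n) - 1 = m + n + 2 by lia] at h

theorem mem_range_sumMulForms_of_mem_span {m n : ℕ} (hg : ∀ i, (g i).IsHomogeneous m)
    {h : MvPolynomial (Fin 3) K} (hh : h.IsHomogeneous (n + m))
    (hI : h ∈ Ideal.span (Set.range g)) : h ∈ LinearMap.range (sumMulForms g n) := by
  obtain ⟨a, rfl⟩ := Ideal.mem_span_range_iff_exists_fun.1 hI
  refine ⟨fun i => ⟨homogeneousComponent n (a i), homogeneousComponent_mem _ _⟩, ?_⟩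
  rw [← homogeneousComponent_eq_self hh, map_sum]
  simp only [sumMulForms, LinearMap.coe_mk, AddHom.coe_mk, homogeneousComponent_add_mul (hg _)]

/-- The quotient of `K[y₀, y₁, y₂]` by three quartics generating an ideal primary to the irrelevant
ideal is one-dimensional in degree `9`. -/
theorem exists_socle_generator {N : ℕ} (hg : ∀ i, (g i).IsHomogeneous 4)
    (hN : ∀ i, X i ^ N ∈ Ideal.span (Set.range g)) :
    ∃ t : MvPolynomial (Fin 3) K, t.IsHomogeneous 9 ∧ t ∉ Ideal.span (Set.range g) ∧
      ∀ h : MvPolynomial (Fin 3) K, h.IsHomogeneous 9 →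
        ∃ (a : Fin 3 → MvPolynomial (Fin 3) K) (c : K), (∀ i, (a i).IsHomogeneous 5) ∧
          h = ∑ i, a i * g i + c • t := by
  have (k : ℕ) : Module.Finite K (homogeneousSubmodule (Fin 3) K k) :=
    Module.Finite.iff_fg.2 (homogeneousSubmodule_fg _ _ _)
  set T := LinearMap.range (sumMulForms g 5) with hT
  have hrk : Module.finrank K T = 54 := by
    have := finrank_range_sumMulForms (n := 1) hg hN (by norm_num)
    norm_num [Nat.choose] at this
    change Module.finrank K T + 9 = 63 at this
    lia
  have hH : Module.finrank K (homogeneousSubmodule (Fin 3) K 9) = 55 := by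
    rw [finrank_homogeneousSubmodule]
    norm_num [Nat.choose]
  have hle : T ≤ homogeneousSubmodule (Fin 3) K 9 := by
    rintro _ ⟨a, rfl⟩
    exact Submodule.sum_mem (homogeneousSubmodule (Fin 3) K 9) fun i _ => (a i).2.mul (hg i)
  obtain ⟨t, htH, htT⟩ : ∃ t ∈ homogeneousSubmodule (Fin 3) K 9, t ∉ T := by
    by_contra! hcon
    have := le_antisymm hle hcon
    rw [← this, hrk] at hH
    norm_num at hH
  refine ⟨t, htH, fun ht => htT (mem_range_sumMulForms_of_mem_span hg htH ht), fun h hh => ?_⟩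
  have hsup : T ⊔ K ∙ t = homogeneousSubmodule (Fin 3) K 9 := by
    apply Submodule.eq_of_le_of_finrank_le
    · exact sup_le hle (by simpa using htH)
    · rw [hH, Nat.succ_le_iff, ← hrk]
      exact Submodule.finrank_lt_finrank_of_lt (left_lt_sup.2 (by simpa using htT))
  have hmem : h ∈ T ⊔ K ∙ t := hsup ▸ hh
  obtain ⟨_, ⟨a, rfl⟩, y, hy, rfl⟩ := Submodule.mem_sup.1 hmem
  obtain ⟨c, rfl⟩ := Submodule.mem_span_singleton.1 hy
  exact ⟨fun i => a i, c, fun i => (a i).2, rfl⟩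

end ThreeQuartics

theorem exists_X_pow_mem_of_finite_quotient {σ K : Type*} [Field K]
    {I : Ideal (MvPolynomial σ K)}
    (hI : letI := gradedAlgebra (σ := σ) (R := K); I.IsHomogeneous (homogeneousSubmodule σ K))
    [Module.Finite K (MvPolynomial σ K ⧸ I)] (i : σ) : ∃ n, X i ^ n ∈ I := by
  obtain ⟨p, hp, hpI⟩ := Algebra.IsIntegral.isIntegral (R := K) (Ideal.Quotient.mk I (X i))
  have hmem : Polynomial.aeval (X i) p ∈ I := by
    rw [← Ideal.Quotient.eq_zero_iff_mem, ← hpI, Polynomial.aeval_def, Polynomial.hom_eval₂]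
    rfl
  refine ⟨p.natDegree, ?_⟩
  have := homogeneousComponent_mem_of_mem hI hmem p.natDegree
  have hc : ∀ k, homogeneousComponent p.natDegree (p.coeff k • (X i : MvPolynomial σ K) ^ k) =
      if p.natDegree = k then p.coeff k • X i ^ k else 0 := fun k => by
    rw [map_smul, homogeneousComponent_of_mem (isHomogeneous_X_pow i k)]
    split_ifs <;> simp
  rw [Polynomial.aeval_eq_sum_range, map_sum] at this
  simpa [hc, hp.coeff_natDegree] using this

end MvPolynomial

section Weights

theorem weight_eq_sum_coords (d : Fin 6 →₀ ℕ) :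
    Finsupp.weight ![1, 1, 1, 2, 2, 2] d = d 0 + d 1 + d 2 + 2 * (d 3 + d 4 + d 5) := by
  simp [Finsupp.weight_apply, Finsupp.sum_fintype, Fin.sum_univ_six]
  ring

theorem natAdd_three_injective : Function.Injective (Fin.natAdd 3 : Fin 3 → Fin 6) :=
  Fin.natAdd_injective 3 3

theorem weight_mapDomain_natAdd (d : Fin 3 →₀ ℕ) :
    Finsupp.weight ![1, 1, 1, 2, 2, 2] (d.mapDomain (Fin.natAdd 3 : Fin 3 → Fin 6)) =
      2 * d.degree := by
  rw [Finsupp.weight_apply, Finsupp.sum_mapDomain_index (by simp) (by simp [add_mul]),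
    Finsupp.sum_fintype _ _ (by simp), Finsupp.degree_eq_sum, Finset.mul_sum]
  refine Finset.sum_congr rfl fun i _ => ?_
  fin_cases i <;> simp [Fin.natAdd] <;> ring

variable {K : Type*} [Field K]

theorem isWeightedHomogeneous_rename_natAdd {p : MvPolynomial (Fin 3) K} {n : ℕ}
    (hp : p.IsHomogeneous n) :
    (rename (Fin.natAdd 3 : Fin 3 → Fin 6) p).IsWeightedHomogeneous ![1, 1, 1, 2, 2, 2]
      (2 * n) := by
  intro d hd
  obtain ⟨u, rfl, hu⟩ := coeff_rename_ne_zero _ _ _ hd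
  have hun : u.degree = n := by
    rw [Finsupp.degree_eq_weight_one]
    exact hp hu
  rw [weight_mapDomain_natAdd, hun]

theorem two_mul_degree_eq_of_coeff_killCompl_ne_zero {p : MvPolynomial (Fin 6) K} {n : ℕ}
    (hp : p.IsWeightedHomogeneous ![1, 1, 1, 2, 2, 2] n) {d : Fin 3 →₀ ℕ}
    (hd : coeff d (killCompl natAdd_three_injective p) ≠ 0) : 2 * d.degree = n := by
  rw [coeff_killCompl] at hd
  rw [← weight_mapDomain_natAdd, hp hd]

theorem isHomogeneous_killCompl_natAdd {p : MvPolynomial (Fin 6) K} {n : ℕ}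
    (hp : p.IsWeightedHomogeneous ![1, 1, 1, 2, 2, 2] (2 * n)) :
    (killCompl natAdd_three_injective p).IsHomogeneous n := by
  intro d hd
  have := two_mul_degree_eq_of_coeff_killCompl_ne_zero hp hd
  change Finsupp.weight (fun _ => 1) d = n
  rw [← Finsupp.degree_eq_weight_one]
  lia

theorem killCompl_natAdd_eq_zero {p : MvPolynomial (Fin 6) K} {n : ℕ}
    (hp : p.IsWeightedHomogeneous ![1, 1, 1, 2, 2, 2] (2 * n + 1)) :
    killCompl natAdd_three_injective p = 0 := by
  ext d
  by_contra hd
  have := two_mul_degree_eq_of_coeff_killCompl_ne_zero hp hd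
  lia

theorem exists_le_sum_three_eq {p q r k : ℕ} (h : k ≤ p + q + r) :
    ∃ p' q' r', p' ≤ p ∧ q' ≤ q ∧ r' ≤ r ∧ p' + q' + r' = k :=
  ⟨min p k, min q (k - min p k), k - min p k - min q (k - min p k), by lia, by lia, by lia, by lia⟩

/-- An exponent of weight `18` involving a variable of weight `1` splits into two exponents of
weight `9`. -/
theorem exists_add_eq_of_weight_eq {d : Fin 6 →₀ ℕ}
    (hd : Finsupp.weight ![1, 1, 1, 2, 2, 2] d = 18) (hpos : 0 < d 0 + d 1 + d 2) :
    ∃ a b : Fin 6 →₀ ℕ, a + b = d ∧ Finsupp.weight ![1, 1, 1, 2, 2, 2] a = 9 ∧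
      Finsupp.weight ![1, 1, 1, 2, 2, 2] b = 9 := by
  rw [weight_eq_sum_coords] at hd
  obtain ⟨k, l, hk, hl, hkl⟩ : ∃ k l, k ≤ d 0 + d 1 + d 2 ∧ l ≤ d 3 + d 4 + d 5 ∧
      k + 2 * l = 9 := by
    by_cases h : 4 ≤ d 3 + d 4 + d 5
    · exact ⟨1, 4, by lia, h, rfl⟩
    · exact ⟨9 - 2 * (d 3 + d 4 + d 5), d 3 + d 4 + d 5, by lia, le_rfl, by lia⟩
  obtain ⟨a0, a1, a2, h0, h1, h2, hs⟩ := exists_le_sum_three_eq hk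
  obtain ⟨a3, a4, a5, h3, h4, h5, ht⟩ := exists_le_sum_three_eq hl
  let a : Fin 6 →₀ ℕ := Finsupp.equivFunOnFinite.symm ![a0, a1, a2, a3, a4, a5]
  have ha : a ≤ d := fun i => by fin_cases i <;> simpa [a]
  have hwa : Finsupp.weight ![1, 1, 1, 2, 2, 2] a = 9 := by
    rw [weight_eq_sum_coords]
    simp only [a, Finsupp.equivFunOnFinite_symm_apply_apply, Matrix.cons_val]
    lia
  refine ⟨a, d - a, add_tsub_cancel_of_le ha, hwa, ?_⟩
  have := congrArg (Finsupp.weight ![1, 1, 1, 2, 2, 2]) (add_tsub_cancel_of_le ha)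
  rw [map_add, hwa, weight_eq_sum_coords d] at this
  lia

theorem mem_mul_of_killCompl_eq_zero {p : MvPolynomial (Fin 6) K}
    (hp : p.IsWeightedHomogeneous ![1, 1, 1, 2, 2, 2] 18)
    (h0 : killCompl natAdd_three_injective p = 0) :
    p ∈ weightedHomogeneousSubmodule K ![1, 1, 1, 2, 2, 2] 9 *
      weightedHomogeneousSubmodule K ![1, 1, 1, 2, 2, 2] 9 := by
  rw [← p.support_sum_monomial_coeff]
  refine Submodule.sum_mem _ fun d hd => ?_
  rw [mem_support_iff] at hd
  have hpos : 0 < d 0 + d 1 + d 2 := by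
    by_contra hcon
    have hsub : (d.support : Set (Fin 6)) ⊆ Set.range (Fin.natAdd 3 : Fin 3 → Fin 6) := by
      intro i hi
      have hi' : d i ≠ 0 := by simpa using hi
      fin_cases i
      · exact absurd hi' (by simp; lia)
      · exact absurd hi' (by simp; lia)
      · exact absurd hi' (by simp; lia)
      · exact ⟨0, rfl⟩
      · exact ⟨1, rfl⟩
      · exact ⟨2, rfl⟩
    rw [← Finsupp.mapDomain_comapDomain _ natAdd_three_injective d hsub,
      ← coeff_killCompl natAdd_three_injective, h0] at hd
    exact hd (coeff_zero _)
  obtain ⟨a, b, hab, ha, hb⟩ := exists_add_eq_of_weight_eq (hp hd) hpos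
  have : monomial d (coeff d p) = monomial a (coeff d p) * monomial b 1 := by
    rw [monomial_mul, hab, mul_one]
  rw [this]
  exact Submodule.mul_mem_mul (isWeightedHomogeneous_monomial _ _ _ ha)
    (isWeightedHomogeneous_monomial _ _ _ hb)

theorem killCompl_eq_zero_of_mem_mul {p : MvPolynomial (Fin 6) K}
    (hp : p ∈ weightedHomogeneousSubmodule K ![1, 1, 1, 2, 2, 2] 9 *
      weightedHomogeneousSubmodule K ![1, 1, 1, 2, 2, 2] 9) :
    killCompl natAdd_three_injective p = 0 := by
  induction hp using Submodule.mul_induction_on' with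
  | mem_mul_mem m hm n hn => rw [map_mul, killCompl_natAdd_eq_zero (n := 4) hm, zero_mul]
  | add x _ y _ hx hy => rw [map_add, hx, hy, add_zero]

end Weights

section Jacobian

variable {K : Type*} [Field K] {f : MvPolynomial (Fin 6) K}

/-- The coefficients of the variables of weight `1` in the part of `f` linear in them. -/
noncomputable def linearPart (f : MvPolynomial (Fin 6) K) (i : Fin 3) : MvPolynomial (Fin 3) K :=
  killCompl natAdd_three_injective (pderiv (Fin.castAdd 3 i) f)

theorem isWeightedHomogeneous_pderiv_castAdd
    (hf : f.IsWeightedHomogeneous ![1, 1, 1, 2, 2, 2] 9) (i : Fin 3) :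
    (pderiv (Fin.castAdd 3 i) f).IsWeightedHomogeneous ![1, 1, 1, 2, 2, 2] 8 :=
  hf.pderiv (by fin_cases i <;> rfl)

theorem isHomogeneous_linearPart (hf : f.IsWeightedHomogeneous ![1, 1, 1, 2, 2, 2] 9)
    (i : Fin 3) : (linearPart f i).IsHomogeneous 4 :=
  isHomogeneous_killCompl_natAdd (n := 4) (isWeightedHomogeneous_pderiv_castAdd hf i)

theorem span_pderiv_le_comap_linearPart (hf : f.IsWeightedHomogeneous ![1, 1, 1, 2, 2, 2] 9) :
    Ideal.span (Set.range fun i => pderiv i f) ≤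
      (Ideal.span (Set.range (linearPart f))).comap (killCompl natAdd_three_injective) := by
  rw [Ideal.span_le]
  rintro _ ⟨i, rfl⟩
  change killCompl natAdd_three_injective (pderiv i f) ∈ Ideal.span (Set.range (linearPart f))
  refine Fin.addCases (m := 3) (n := 3) (fun j => Ideal.subset_span ⟨j, rfl⟩) (fun j => ?_) i
  rw [killCompl_natAdd_eq_zero (n := 3) (hf.pderiv (by fin_cases j <;> rfl))]
  exact Ideal.zero_mem _

theorem exists_X_pow_mem_span_linearPart (hf : f.IsWeightedHomogeneous ![1, 1, 1, 2, 2, 2] 9)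
    [Module.Finite K (MvPolynomial (Fin 6) K ⧸ Ideal.span (Set.range fun i => pderiv i f))] :
    ∃ N, ∀ i, X i ^ N ∈ Ideal.span (Set.range (linearPart f)) := by
  have hsurj : Function.Surjective (killCompl (R := K) natAdd_three_injective) :=
    fun p => ⟨_, killCompl_rename_app natAdd_three_injective p⟩
  have : Module.Finite K (MvPolynomial (Fin 3) K ⧸ Ideal.span (Set.range (linearPart f))) :=
    Module.Finite.of_surjective
      (Ideal.quotientMapₐ _ _ (span_pderiv_le_comap_linearPart hf)).toLinearMap
      (Ideal.quotientMap_surjective (H := span_pderiv_le_comap_linearPart hf) hsurj)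
  have hhom := letI := gradedAlgebra (σ := Fin 3) (R := K)
    Ideal.homogeneous_span (homogeneousSubmodule (Fin 3) K) (Set.range (linearPart f)) (by
      rintro _ ⟨i, rfl⟩
      exact ⟨4, isHomogeneous_linearPart hf i⟩)
  choose n hn using exists_X_pow_mem_of_finite_quotient hhom
  exact ⟨∑ i, n i, fun i => Ideal.mem_of_dvd _
    (pow_dvd_pow _ (Finset.single_le_sum (fun _ _ => Nat.zero_le _) (Finset.mem_univ i))) (hn i)⟩

end Jacobian

theorem stmt_7
    (wt : Fin 6 → ℕ) (hwt : wt = ![1, 1, 1, 2, 2, 2])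
    (f : MvPolynomial (Fin 6) ℂ)
    (hf : f.IsWeightedHomogeneous wt 9)
    (J : Ideal (MvPolynomial (Fin 6) ℂ))
    (hJ : J = Ideal.span (Set.range fun i => MvPolynomial.pderiv i f))
    (hfin : FiniteDimensional ℂ (MvPolynomial (Fin 6) ℂ ⧸ J)) :
    ∀ (R1 R2 P : Submodule ℂ (MvPolynomial (Fin 6) ℂ ⧸ J)),
      R1 = Submodule.map (Ideal.Quotient.mkₐ ℂ J).toLinearMap
        (weightedHomogeneousSubmodule ℂ wt 9) →
      R2 = Submodule.map (Ideal.Quotient.mkₐ ℂ J).toLinearMap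
        (weightedHomogeneousSubmodule ℂ wt 18) →
      P = Submodule.span ℂ {x | ∃ a ∈ R1, ∃ b ∈ R1, x = a * b} →
      P ≤ R2 ∧ Module.finrank ℂ R2 = Module.finrank ℂ P + 1 := by
  rintro R1 R2 P hR1 hR2 hP
  subst hwt
  set W := weightedHomogeneousSubmodule ℂ (![1, 1, 1, 2, 2, 2] : Fin 6 → ℕ)
  have hJI : J ≤ (Ideal.span (Set.range (linearPart f))).comap
      (killCompl natAdd_three_injective) := hJ ▸ span_pderiv_le_comap_linearPart hf
  set π := (Ideal.Quotient.mkₐ ℂ J).toLinearMap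
  have hker : ∀ p q, π p = π q ↔ p - q ∈ J := fun p q => Ideal.Quotient.eq
  have hPW : P = (W 9 * W 9).map π := by
    rw [Submodule.map_mul, ← hR1, Submodule.mul_eq_span_mul_set, hP]
    congr 1
    ext x
    simp [Set.mem_mul, eq_comm]
  have hPR : P ≤ R2 := by
    rw [hPW, hR2]
    exact Submodule.map_mono (weightedHomogeneousSubmodule_mul _ 9 9)
  obtain ⟨N, hN⟩ : ∃ N, ∀ i, X i ^ N ∈ Ideal.span (Set.range (linearPart f)) := by
    rw [hJ] at hfin
    exact exists_X_pow_mem_span_linearPart hf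
  obtain ⟨t, ht, htI, hdecomp⟩ := exists_socle_generator (isHomogeneous_linearPart hf) hN
  set v := rename (Fin.natAdd 3 : Fin 3 → Fin 6) t
  have hv : v ∈ W 18 := isWeightedHomogeneous_rename_natAdd ht
  have hvP : π v ∉ P := by
    rw [hPW]
    rintro ⟨q, hq, hqv⟩
    have := hJI ((hker v q).1 hqv.symm)
    rw [Ideal.mem_comap, map_sub, killCompl_eq_zero_of_mem_mul hq, sub_zero,
      killCompl_rename_app] at this
    exact htI this
  have hR : R2 = P ⊔ ℂ ∙ π v := by
    apply le_antisymm
    · rw [hR2]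
      rintro _ ⟨w, hw, rfl⟩
      obtain ⟨a, c, ha, hac⟩ := hdecomp _ (isHomogeneous_killCompl_natAdd (n := 9) hw)
      set j := ∑ i, rename (Fin.natAdd 3 : Fin 3 → Fin 6) (a i) * pderiv (Fin.castAdd 3 i) f
      have hjJ : j ∈ J := Ideal.sum_mem _ fun i _ =>
        Ideal.mul_mem_left _ _ (hJ ▸ Ideal.subset_span ⟨_, rfl⟩)
      have hjW : j ∈ W 18 := Submodule.sum_mem _ fun i _ =>
        (isWeightedHomogeneous_rename_natAdd (ha i)).mul
          (isWeightedHomogeneous_pderiv_castAdd hf i)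
      have hq : w - j - c • v ∈ W 9 * W 9 := by
        refine mem_mul_of_killCompl_eq_zero
          ((W 18).sub_mem ((W 18).sub_mem hw hjW) ((W 18).smul_mem c hv)) ?_
        simp only [map_sub, map_smul, hac, j, v, map_sum, map_mul, killCompl_rename_app]
        simp [linearPart]
      have hw' : π w = π (w - j - c • v) + c • π v := by
        rw [← map_smul π, ← map_add, hker]
        simpa using hjJ
      rw [hw', hPW]
      exact Submodule.add_mem_sup (Submodule.mem_map_of_mem hq)
        (Submodule.smul_mem _ _ (Submodule.mem_span_singleton_self _))
    · refine sup_le hPR ?_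
      rw [Submodule.span_singleton_le_iff_mem, hR2]
      exact Submodule.mem_map_of_mem hv
  refine ⟨hPR, ?_⟩
  rw [hR, Submodule.finrank_sup_span_singleton hvP]
end
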